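/- arXiv:2409.10474 — 2 statements merged into one kernel-verified Lean document; each statement's English description precedes it below -/
import Mathlib

section
/- Let φ : S₁ → S₂ be a surjective unital local completely isometric map between local operator systems generating unital locally C*-algebras A₁ and A₂. Then for each admissible local boundary representation π₁ : A₁ → B(H) for S₁ there exists an admissible local boundary representation π₂ : A₂ → B(H) for S₂ such that π₂ ∘ φ = π₁|_{S₁}. -/
open scoped ComplexOrder

/-- A C*-seminorm on a complex *-algebra. -/
structure IsCstarSeminorm {A : Type*} [Ring A] [StarRing A] [Algebra ℂ A] (p : A → ℝ) : Prop where
  nonneg : ∀ a, 0 ≤ p a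
  map_zero' : p 0 = 0
  add_le : ∀ a b, p (a + b) ≤ p a + p b
  smul : ∀ (c : ℂ) (a : A), p (c • a) = ‖c‖ * p a
  mul_le : ∀ a b, p (a * b) ≤ p a * p b
  star_eq : ∀ a, p (star a) = p a
  cstar : ∀ a, p (star a * a) = p a ^ 2

/-- The family of canonical C*-seminorms on the matrix algebras `Mₙ(A)` induced by a
C*-seminorm `p` on `A`. -/
structure IsMatrixCstarSeminormFamily {A : Type*} [Ring A] [StarRing A] [Algebra ℂ A]
    (p : A → ℝ) (pn : ∀ n : ℕ, Matrix (Fin n) (Fin n) A → ℝ) : Prop where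
  cstar : ∀ n, IsCstarSeminorm (pn n)
  ker : ∀ n (M : Matrix (Fin n) (Fin n) A), pn n M = 0 ↔ ∀ i j, p (M i j) = 0
  one : ∀ a : A, pn 1 (fun _ _ => a) = p a

/-- `λ`-positivity of a matrix over `A` relative to the matrix seminorm `pn` (at level `λ`):
`M = b*b + c` with `pn c = 0`. -/
def LamPos {A : Type*} [Ring A] [StarRing A]
    (pn : ∀ n : ℕ, Matrix (Fin n) (Fin n) A → ℝ) (n : ℕ)
    (M : Matrix (Fin n) (Fin n) A) : Prop :=
  ∃ x c : Matrix (Fin n) (Fin n) A, pn n c = 0 ∧ M = star x * x + c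

/-- Positivity of a matrix of bounded operators, i.e. positivity in `B(H^{⊕n}) ≅ Mₙ(B(H))`. -/
def MatPosOp {H : Type*} [NormedAddCommGroup H] [InnerProductSpace ℂ H] [CompleteSpace H]
    {n : ℕ} (T : Matrix (Fin n) (Fin n) (H →L[ℂ] H)) : Prop :=
  ∃ X : Matrix (Fin n) (Fin n) (H →L[ℂ] H), T = star X * X

/-- The bounded operator on `H^{⊕n}` (with the `ℓ²`-Hilbert space structure) induced by an
`n × n` matrix of bounded operators on `H`. -/
noncomputable def matOp {H : Type*} [NormedAddCommGroup H] [InnerProductSpace ℂ H]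
    {n : ℕ} (T : Matrix (Fin n) (Fin n) (H →L[ℂ] H)) :
    PiLp 2 (fun _ : Fin n => H) →L[ℂ] PiLp 2 (fun _ : Fin n => H) :=
  ((PiLp.continuousLinearEquiv 2 ℂ (fun _ : Fin n => H)).symm :
      ((_ : Fin n) → H) →L[ℂ] PiLp 2 (fun _ : Fin n => H)) ∘L
    (ContinuousLinearMap.pi fun i => ∑ j, (T i j) ∘L (ContinuousLinearMap.proj j)) ∘L
    ((PiLp.continuousLinearEquiv 2 ℂ (fun _ : Fin n => H)) :
      PiLp 2 (fun _ : Fin n => H) →L[ℂ] ((_ : Fin n) → H))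

/-- A map into `B(H)` has trivial commutant (irreducibility). -/
def HasTrivialCommutant {R H : Type*} [NormedAddCommGroup H] [InnerProductSpace ℂ H]
    (φ : R → (H →L[ℂ] H)) : Prop :=
  ∀ T : H →L[ℂ] H, (∀ a, T * φ a = φ a * T) → ∃ c : ℂ, T = c • (1 : H →L[ℂ] H)

/-- Complete positivity at level `λ` for a linear map defined on all of `A`, with values in
`B(H)`: `λ`-positive matrices go to positive operator matrices, and matrices annihilated by the
`λ`-th matrix seminorm go to zero. -/
def IsLamCPmap {A H : Type*} [Ring A] [StarRing A] [Algebra ℂ A]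
    [NormedAddCommGroup H] [InnerProductSpace ℂ H] [CompleteSpace H]
    (pn : ∀ n : ℕ, Matrix (Fin n) (Fin n) A → ℝ) (φ : A →ₗ[ℂ] (H →L[ℂ] H)) : Prop :=
  (∀ (n : ℕ) (M : Matrix (Fin n) (Fin n) A), LamPos pn n M → MatPosOp (M.map φ)) ∧
  (∀ (n : ℕ) (M : Matrix (Fin n) (Fin n) A), pn n M = 0 → M.map φ = 0)

/-- Complete positivity at level `λ` for a linear map defined on a local operator system
`S ⊆ A`, with values in `B(H)`. -/
def IsLamCPmapOn {A H : Type*} [Ring A] [StarRing A] [Algebra ℂ A]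
    [NormedAddCommGroup H] [InnerProductSpace ℂ H] [CompleteSpace H]
    (pn : ∀ n : ℕ, Matrix (Fin n) (Fin n) A → ℝ) (S : Submodule ℂ A)
    (φ : ↥S →ₗ[ℂ] (H →L[ℂ] H)) : Prop :=
  (∀ (n : ℕ) (M : Matrix (Fin n) (Fin n) ↥S), LamPos pn n (M.map Subtype.val) →
      MatPosOp (M.map fun s => φ s)) ∧
  (∀ (n : ℕ) (M : Matrix (Fin n) (Fin n) ↥S), pn n (M.map Subtype.val) = 0 →
      M.map (fun s => φ s) = 0)

/-- Complete positivity (in the C*-algebraic, purely algebraic sense) of a linear map from a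
ring with involution to `B(H)`: matrices of the form `x*x` are sent to positive operator
matrices. For a C*-algebra this is the usual notion of complete positivity. -/
def IsCstarCPmap {R H : Type*} [Ring R] [StarRing R] [Algebra ℂ R]
    [NormedAddCommGroup H] [InnerProductSpace ℂ H] [CompleteSpace H]
    (φ : R →ₗ[ℂ] (H →L[ℂ] H)) : Prop :=
  ∀ (n : ℕ) (M : Matrix (Fin n) (Fin n) R),
    (∃ x : Matrix (Fin n) (Fin n) R, M = star x * x) → MatPosOp (M.map φ)

/-- A boundary representation (in the sense of Arveson) of a C*-algebra `R` for the operator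
system `T ⊆ R`: an irreducible representation which is the unique unital completely positive
extension of its restriction to `T`. -/
def IsBoundaryRep {R H : Type*} [Ring R] [StarRing R] [Algebra ℂ R]
    [NormedAddCommGroup H] [InnerProductSpace ℂ H] [CompleteSpace H]
    (T : Set R) (ψ : R →⋆ₐ[ℂ] (H →L[ℂ] H)) : Prop :=
  HasTrivialCommutant ⇑ψ ∧
  ∀ χ : R →ₗ[ℂ] (H →L[ℂ] H), χ 1 = 1 → IsCstarCPmap χ → (∀ t ∈ T, χ t = ψ t) →
    ∀ b, χ b = ψ b

/-- An admissible local boundary representation of the locally C*-algebra `A` for the local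
operator system `S ⊆ A`. -/
def IsAdmLocBdryRep {Λ A H : Type*} [Ring A] [StarRing A] [Algebra ℂ A]
    [NormedAddCommGroup H] [InnerProductSpace ℂ H] [CompleteSpace H]
    (p : Λ → A → ℝ) (pn : Λ → ∀ n : ℕ, Matrix (Fin n) (Fin n) A → ℝ)
    (S : Submodule ℂ A) (π : A →⋆ₐ[ℂ] (H →L[ℂ] H)) : Prop :=
  HasTrivialCommutant ⇑π ∧
  ∃ l₀ : Λ, (∀ a, ‖π a‖ ≤ p l₀ a) ∧
    ∀ φ : A →ₗ[ℂ] (H →L[ℂ] H), φ 1 = 1 → (∃ l, IsLamCPmap (pn l) φ) →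
      (∀ a, ‖φ a‖ ≤ p l₀ a) → (∀ s ∈ S, φ s = π s) → ∀ a, φ a = π a

/-- An admissible local completely positive map between local operator systems
`S₁ ⊆ A₁` and `S₂ ⊆ A₂` (same index set `Λ` of seminorms). -/
def IsAdmLocCP {Λ A₁ A₂ : Type*} [Ring A₁] [StarRing A₁] [Algebra ℂ A₁]
    [Ring A₂] [StarRing A₂] [Algebra ℂ A₂]
    (pn₁ : Λ → ∀ n : ℕ, Matrix (Fin n) (Fin n) A₁ → ℝ)
    (pn₂ : Λ → ∀ n : ℕ, Matrix (Fin n) (Fin n) A₂ → ℝ)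
    (S₁ : Submodule ℂ A₁) (S₂ : Submodule ℂ A₂) (φ : ↥S₁ →ₗ[ℂ] ↥S₂) : Prop :=
  ∀ (l : Λ) (n : ℕ) (M : Matrix (Fin n) (Fin n) ↥S₁),
    (LamPos (pn₁ l) n (M.map Subtype.val) →
      LamPos (pn₂ l) n (M.map fun s => ((φ s : ↥S₂) : A₂))) ∧
    (pn₁ l n (M.map Subtype.val) = 0 → pn₂ l n (M.map fun s => ((φ s : ↥S₂) : A₂)) = 0)

/-- A local completely isometric map between local operator systems. -/
def IsLocCompIsometric {Λ A₁ A₂ : Type*} [Ring A₁] [StarRing A₁] [Algebra ℂ A₁]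
    [Ring A₂] [StarRing A₂] [Algebra ℂ A₂]
    (pn₁ : Λ → ∀ n : ℕ, Matrix (Fin n) (Fin n) A₁ → ℝ)
    (pn₂ : Λ → ∀ n : ℕ, Matrix (Fin n) (Fin n) A₂ → ℝ)
    (S₁ : Submodule ℂ A₁) (S₂ : Submodule ℂ A₂) (φ : ↥S₁ →ₗ[ℂ] ↥S₂) : Prop :=
  ∀ (l : Λ) (n : ℕ) (M : Matrix (Fin n) (Fin n) ↥S₁),
    pn₂ l n (M.map fun s => ((φ s : ↥S₂) : A₂)) = pn₁ l n (M.map Subtype.val)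

/-- A completely positive map (algebraic sense) between operator systems `T₁ ⊆ R₁`, `T₂ ⊆ R₂`
sitting in C*-algebras. -/
def IsCstarCPmapOn {R₁ R₂ : Type*} [Ring R₁] [StarRing R₁] [Algebra ℂ R₁]
    [Ring R₂] [StarRing R₂] [Algebra ℂ R₂]
    (T₁ : Submodule ℂ R₁) (T₂ : Submodule ℂ R₂) (ψ : ↥T₁ →ₗ[ℂ] ↥T₂) : Prop :=
  ∀ (n : ℕ) (M : Matrix (Fin n) (Fin n) ↥T₁),
    (∃ x : Matrix (Fin n) (Fin n) R₁, M.map Subtype.val = star x * x) →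
    ∃ y : Matrix (Fin n) (Fin n) R₂, M.map (fun s => ((ψ s : ↥T₂) : R₂)) = star y * y

/-- A local boundary ideal for a local operator system `S ⊆ A`: a closed two-sided *-ideal such
that the quotient map is completely isometric on `S` with respect to the quotient matrix
seminorms. -/
def IsLocBdryIdeal {Λ A : Type*} [Ring A] [StarRing A] [Algebra ℂ A] [TopologicalSpace A]
    (pn : Λ → ∀ n : ℕ, Matrix (Fin n) (Fin n) A → ℝ) (S : Submodule ℂ A)
    (I : Set A) : Prop :=
  (∃ J : TwoSidedIdeal A, (J : Set A) = I) ∧ (∀ a ∈ I, star a ∈ I) ∧ IsClosed I ∧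
  ∀ (l : Λ) (n : ℕ) (M : Matrix (Fin n) (Fin n) ↥S),
    sInf {r : ℝ | ∃ C : Matrix (Fin n) (Fin n) A, (∀ i j, C i j ∈ I) ∧
        r = pn l n (M.map Subtype.val + C)} = pn l n (M.map Subtype.val)

theorem IsCstarSeminorm.map_pow_le {A : Type*} [Ring A] [StarRing A] [Algebra ℂ A]
    {q : A → ℝ} (hq : IsCstarSeminorm q) (a : A) {n : ℕ}
    (hn : n ≠ 0) : q (a ^ n) ≤ q a ^ n := by
  induction n with
  | zero => exact absurd rfl hn
  | succ n ih =>
    rcases eq_or_ne n 0 with rfl | h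
    · simp
    rw [pow_succ, pow_succ]
    exact (hq.mul_le _ _).trans (mul_le_mul_of_nonneg_right (ih h) (hq.nonneg a))

section CStarLemmas

variable {D : Type*} [CStarAlgebra D] [PartialOrder D] [StarOrderedRing D]

/-- If `x` is accretive and `x'` satisfies `‖t - x'‖ ≤ ‖t - x‖` for all `t > 0`, then `x'` is
accretive. -/
theorem accretive_of_norm_le {D' : Type*} [CStarAlgebra D'] [PartialOrder D'] [StarOrderedRing D']
    {x : D} {x' : D'} (hx : 0 ≤ x + star x)
    (h : ∀ t : ℝ, 0 < t → ‖algebraMap ℝ D' t - x'‖ ≤ ‖algebraMap ℝ D t - x‖) :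
    0 ≤ x' + star x' := by
  have key : ∀ t : ℝ, 0 < t → 0 ≤ algebraMap ℝ D' (t⁻¹ * ‖x‖ ^ 2) + (x' + star x') := by
    intro t ht
    have h1 : star (algebraMap ℝ D t - x) * (algebraMap ℝ D t - x)
        ≤ algebraMap ℝ D (t ^ 2 + ‖x‖ ^ 2) := by
      have e : star (algebraMap ℝ D t - x) * (algebraMap ℝ D t - x)
          = algebraMap ℝ D (t ^ 2) + star x * x - t • (x + star x) := by
        simp only [Algebra.algebraMap_eq_smul_one, star_sub, star_smul, star_one, star_trivial,
          sub_mul, mul_sub, smul_mul_assoc, mul_smul_comm, one_mul, mul_one, smul_add, smul_sub,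
          pow_two,
          mul_smul]
        abel
      rw [e, map_add]
      have h2 : star x * x ≤ algebraMap ℝ D (‖x‖ ^ 2) := CStarAlgebra.star_mul_le_algebraMap_norm_sq
      have h3 : 0 ≤ t • (x + star x) := smul_nonneg ht.le hx
      calc algebraMap ℝ D (t ^ 2) + star x * x - t • (x + star x)
          ≤ algebraMap ℝ D (t ^ 2) + star x * x := sub_le_self _ h3
        _ ≤ _ := by gcongr
    have h4 : ‖algebraMap ℝ D t - x‖ ^ 2 ≤ t ^ 2 + ‖x‖ ^ 2 := by
      rw [pow_two, ← CStarRing.norm_star_mul_self]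
      exact (CStarAlgebra.norm_le_iff_le_algebraMap _ (by positivity)
        (star_mul_self_nonneg _)).2 h1
    have h5 : ‖algebraMap ℝ D' t - x'‖ ^ 2 ≤ t ^ 2 + ‖x‖ ^ 2 :=
      (pow_le_pow_left₀ (norm_nonneg _) (h t ht) 2).trans h4
    have h6 : star (algebraMap ℝ D' t - x') * (algebraMap ℝ D' t - x')
        ≤ algebraMap ℝ D' (t ^ 2 + ‖x‖ ^ 2) :=
      CStarAlgebra.star_mul_le_algebraMap_norm_sq.trans (algebraMap_mono _ h5)
    have e : star (algebraMap ℝ D' t - x') * (algebraMap ℝ D' t - x')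
        = algebraMap ℝ D' (t ^ 2) + star x' * x' - t • (x' + star x') := by
      simp only [Algebra.algebraMap_eq_smul_one, star_sub, star_smul, star_one, star_trivial,
        sub_mul, mul_sub, smul_mul_assoc, mul_smul_comm, one_mul, mul_one, smul_add, smul_sub,
          pow_two,
        mul_smul]
      abel
    rw [e, map_add, ← sub_nonneg] at h6
    have h7 : 0 ≤ algebraMap ℝ D' (‖x‖ ^ 2) + t • (x' + star x') := by
      refine (add_nonneg h6 (star_mul_self_nonneg x')).trans_eq ?_
      abel
    have h8 := smul_nonneg (inv_nonneg.2 ht.le) h7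
    rwa [smul_add, smul_smul, inv_mul_cancel₀ ht.ne', one_smul, Algebra.algebraMap_eq_smul_one,
      smul_smul, ← Algebra.algebraMap_eq_smul_one] at h8
  have lim : Filter.Tendsto (fun t : ℝ => algebraMap ℝ D' (t⁻¹ * ‖x‖ ^ 2) + (x' + star x'))
      Filter.atTop (nhds (algebraMap ℝ D' (0 * ‖x‖ ^ 2) + (x' + star x'))) := by
    refine Filter.Tendsto.add_const _ ?_
    exact ((continuous_algebraMap ℝ D').tendsto _).comp (tendsto_inv_atTop_zero.mul_const _)
  have := CStarAlgebra.isClosed_nonneg.mem_of_tendsto lim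
    (Filter.eventually_atTop.2 ⟨1, fun t ht => key t (by linarith)⟩)
  simpa using this

/-- A C*-seminorm on a C*-algebra is dominated by the norm. -/
theorem IsCstarSeminorm.le_norm {q : D → ℝ} (hq : IsCstarSeminorm q) (a : D) : q a ≤ ‖a‖ := by
  have q1 : q 1 ≤ 1 := by
    have := hq.cstar 1
    simp only [star_one, mul_one] at this
    nlinarith [hq.nonneg 1]
  have hu : ∀ u ∈ unitary D, q u ≤ 1 := by
    intro u hu
    have := hq.cstar u
    rw [Unitary.star_mul_self_of_mem hu] at this
    nlinarith [hq.nonneg u]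
  have hsa1 : ∀ b : D, IsSelfAdjoint b → ‖b‖ ≤ 1 → q b ≤ 1 := by
    intro b hb hb1
    have e := selfAdjoint.realPart_unitarySelfAddISMul ⟨b, hb⟩ hb1
    have e2 := congrArg (Subtype.val) e
    rw [realPart_apply_coe] at e2
    set u := selfAdjoint.unitarySelfAddISMul ⟨b, hb⟩ hb1
    have e3 : b = (2⁻¹ : ℂ) • ((u : D) + star (u : D)) := by
      rw [← show _ = b from e2]
      rw [← Complex.coe_smul]
      simp
    rw [e3, hq.smul]
    have h1 := hq.add_le (u : D) (star (u : D))
    have h2 := hu u u.2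
    rw [hq.star_eq] at h1
    norm_num
    linarith
  have hsa : ∀ b : D, IsSelfAdjoint b → q b ≤ ‖b‖ := by
    intro b hb
    rcases eq_or_ne b 0 with rfl | h0
    · simp [hq.map_zero']
    have hn : 0 < ‖b‖ := norm_pos_iff.2 h0
    have := hsa1 (‖b‖⁻¹ • b) (by simp [isSelfAdjoint_iff, hb.star_eq])
      (by simp [norm_smul, hn.ne'])
    rw [← Complex.coe_smul, hq.smul] at this
    simp only [Complex.ofReal_inv, norm_inv, Complex.norm_real, norm_norm] at this
    rwa [inv_mul_le_iff₀ hn, mul_one] at this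
  have := hsa (star a * a) (IsSelfAdjoint.star_mul_self a)
  rw [hq.cstar, CStarRing.norm_star_mul_self, ← pow_two] at this
  exact (pow_le_pow_iff_left₀ (hq.nonneg a) (norm_nonneg a) two_ne_zero).1 this

/-- A faithful C*-seminorm on a C*-algebra is the norm. -/
theorem IsCstarSeminorm.eq_norm {q : D → ℝ} (hq : IsCstarSeminorm q)
    (h0 : ∀ a, q a = 0 → a = 0) (a : D) : q a = ‖a‖ := by
  have hpos : ∀ b : D, 0 ≤ b → ‖b‖ ≤ q b := by
    intro b hb
    by_contra! hlt
    obtain ⟨r, hr1, hr2⟩ := exists_between hlt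
    have hr0 : 0 < r := (hq.nonneg b).trans_lt hr1
    have : Nontrivial D := by
      by_contra h
      rw [not_nontrivial_iff_subsingleton] at h
      rw [Subsingleton.elim b 0, norm_zero] at hr2
      linarith
    let f : ℝ → ℝ := fun t => max (t - r) 0
    have hf : Continuous f := by fun_prop
    have hbs : ∀ t ∈ spectrum ℝ b, 0 ≤ t := fun t ht => spectrum_nonneg_of_nonneg hb ht
    have hqf : q (cfc f b) = 0 := by
      have bound : ∀ k : ℕ, k ≠ 0 → q (cfc f b) ≤ ‖b‖ * (q b / r) ^ k := by
        intro k hk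
        let g : ℝ → ℝ := fun t => f t / (max t r) ^ k
        have hmr : ∀ t, 0 < max t r := fun t => lt_max_of_lt_right hr0
        have hg : Continuous g := by
          refine hf.div (by fun_prop) fun t => (pow_pos (hmr t) k).ne'
        have e : cfc f b = cfc g b * b ^ k := by
          rw [← cfc_pow_id (R := ℝ) b k, ← cfc_mul g (fun x => x ^ k) b hg.continuousOn]
          refine cfc_congr fun t ht => ?_
          simp only [g]
          rcases le_total t r with h | h
          · have : f t = 0 := max_eq_right (by linarith)
            simp [this]
          · rw [max_eq_left h]
            have : t ≠ 0 := (hr0.trans_le h).ne'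
            field_simp
        have hgn : ‖cfc g b‖ ≤ ‖b‖ * (r ^ k)⁻¹ := by
          refine norm_cfc_le (by positivity) fun t ht => ?_
          have ht0 := hbs t ht
          have htb : t ≤ ‖b‖ := by
            have := spectrum.norm_le_norm_of_mem ht
            rwa [Real.norm_of_nonneg ht0] at this
          have hft : f t ≤ ‖b‖ := max_le (by linarith) (norm_nonneg _)
          have hf0 : 0 ≤ f t := le_max_right _ _
          rw [Real.norm_of_nonneg (div_nonneg hf0 (pow_pos (hmr t) k).le), div_eq_mul_inv]
          gcongr
          exact le_max_right _ _
        rw [e]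
        calc q (cfc g b * b ^ k) ≤ q (cfc g b) * q (b ^ k) := hq.mul_le _ _
          _ ≤ (‖b‖ * (r ^ k)⁻¹) * q b ^ k :=
            mul_le_mul ((hq.le_norm _).trans hgn) (hq.map_pow_le b hk) (hq.nonneg _)
              (by positivity)
          _ = _ := by rw [div_pow]; ring
      have lim : Filter.Tendsto (fun k : ℕ => ‖b‖ * (q b / r) ^ k) Filter.atTop
          (nhds (‖b‖ * 0)) :=
        (tendsto_pow_atTop_nhds_zero_of_lt_one (div_nonneg (hq.nonneg b) hr0.le)
          ((div_lt_one hr0).2 hr1)).const_mul _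
      refine le_antisymm ?_ (hq.nonneg _)
      rw [mul_zero] at lim
      exact ge_of_tendsto lim (Filter.eventually_atTop.2 ⟨1, fun k hk => bound k (by omega)⟩)
    have hz := h0 _ hqf
    have hmem : ‖b‖ ∈ spectrum ℝ b := CStarAlgebra.norm_mem_spectrum_of_nonneg hb
    have : ‖f ‖b‖‖ ≤ ‖cfc f b‖ := norm_apply_le_norm_cfc f b hmem hf.continuousOn
    rw [hz, norm_zero] at this
    have h2 : f ‖b‖ = ‖b‖ - r := max_eq_left (by linarith)
    rw [h2, Real.norm_of_nonneg (by linarith)] at this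
    linarith
  refine le_antisymm (hq.le_norm a) ?_
  have := hpos (star a * a) (star_mul_self_nonneg a)
  rw [hq.cstar, CStarRing.norm_star_mul_self, ← pow_two] at this
  exact (pow_le_pow_iff_left₀ (norm_nonneg a) (hq.nonneg a) two_ne_zero).1 this

/-- Over a C*-algebra, a self-adjoint element splits into orthogonal positive parts. -/
theorem IsSelfAdjoint.exists_nonneg_sub {x : D} (hx : IsSelfAdjoint x) :
    ∃ p n : D, 0 ≤ p ∧ 0 ≤ n ∧ x = p - n ∧ p * n = 0 :=
  ⟨x⁺, x⁻, CFC.posPart_nonneg x, CFC.negPart_nonneg x, (CFC.posPart_sub_negPart x hx).symm,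
    CFC.posPart_mul_negPart x⟩

theorem exists_eq_star_mul_self_of_nonneg {x : D} (hx : 0 ≤ x) : ∃ z : D, x = star z * z :=
  CStarAlgebra.nonneg_iff_eq_star_mul_self.1 hx

theorem mul_self_mul_self_nonneg {x : D} (hx : 0 ≤ x) : 0 ≤ x * x * x := by
  have := star_left_conjugate_nonneg hx x
  rwa [hx.star_eq] at this

end CStarLemmas

section MatrixLemmas

variable {B : Type*} [CStarAlgebra B] [PartialOrder B] [StarOrderedRing B]

theorem CStarMatrix.diag_nonneg {n : ℕ} {X : CStarMatrix (Fin n) (Fin n) B} (hX : 0 ≤ X)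
    (i : Fin n) : 0 ≤ X i i := by
  obtain ⟨Z, rfl⟩ := exists_eq_star_mul_self_of_nonneg hX
  rw [CStarMatrix.mul_apply]
  exact Finset.sum_nonneg fun k _ => star_mul_self_nonneg (Z k i)

theorem CStarMatrix.eq_zero_of_diag_eq_zero {n : ℕ} {X : CStarMatrix (Fin n) (Fin n) B}
    (hX : 0 ≤ X) (h : ∀ i, X i i = 0) : X = 0 := by
  obtain ⟨Z, rfl⟩ := exists_eq_star_mul_self_of_nonneg hX
  have hZ : Z = 0 := by
    ext k i
    have := h i
    rw [CStarMatrix.mul_apply] at this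
    have h2 := (Finset.sum_eq_zero_iff_of_nonneg
      (fun k _ => star_mul_self_nonneg (Z k i))).1 this k (Finset.mem_univ k)
    exact CStarRing.star_mul_self_eq_zero_iff _ |>.1 h2
  simp [hZ]

/-- A self-adjoint matrix over a C*-algebra `B` is positive as soon as `y* X y ≥ 0` for all
columns `y` over `B`. -/
theorem CStarMatrix.nonneg_of_forall {n : ℕ} {X : CStarMatrix (Fin n) (Fin n) B}
    (hX : IsSelfAdjoint X)
    (h : ∀ y : Fin n → B, 0 ≤ ∑ i, ∑ j, star (y i) * X i j * y j) : 0 ≤ X := by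
  obtain ⟨P, N, hP0, hN0, hPN, hmul⟩ := hX.exists_nonneg_sub
  have hNs : star N = N := hN0.star_eq
  have e1 : X * N = -(N * N) := by rw [hPN, sub_mul, hmul, zero_sub]
  have e2 : N * X * N = -(N * N * N) := by rw [mul_assoc, e1]; simp [mul_assoc]
  have hN3 : 0 ≤ N * N * N := mul_self_mul_self_nonneg hN0
  have h0 : N * N * N = 0 := by
    refine CStarMatrix.eq_zero_of_diag_eq_zero hN3 fun i => le_antisymm ?_ (diag_nonneg hN3 i)
    have := h fun k => N k i
    have e3 : ∑ k, ∑ l, star (N k i) * X k l * N l i = (N * X * N) i i := by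
      rw [mul_assoc, CStarMatrix.mul_apply]
      refine Finset.sum_congr rfl fun k _ => ?_
      rw [CStarMatrix.mul_apply, Finset.mul_sum]
      refine Finset.sum_congr rfl fun l _ => ?_
      rw [← CStarMatrix.star_apply, hNs, mul_assoc]
    rw [e3, e2] at this
    exact neg_nonneg.1 this
  have h4 : N * N = 0 := by
    rw [← CStarRing.star_mul_self_eq_zero_iff, star_mul, hNs, ← mul_assoc, h0, zero_mul]
  have h5 : N = 0 := by
    rw [← CStarRing.star_mul_self_eq_zero_iff, hNs, h4]
  rwa [hPN, h5, sub_zero]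

end MatrixLemmas

section SeminormFamily

variable {A : Type*} [Ring A] [StarRing A] [Algebra ℂ A]

theorem IsCstarSeminorm.eq_of_sub_eq_zero {q : A → ℝ} (hq : IsCstarSeminorm q) {a b : A}
    (h : q (a - b) = 0) : q a = q b := by
  have h' : q (b - a) = 0 := by
    have := hq.smul (-1) (a - b)
    rw [h, mul_zero, neg_one_smul, neg_sub] at this
    exact this
  have h1 := hq.add_le (a - b) b
  have h2 := hq.add_le (b - a) a
  rw [sub_add_cancel] at h1 h2
  exact le_antisymm (by linarith) (by linarith)

/-- The canonical matrix seminorms of a C*-seminorm are the C*-norms of the matrices over the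
associated C*-algebra. -/
theorem IsMatrixCstarSeminormFamily.eq_norm {B : Type*} [CStarAlgebra B] [PartialOrder B]
    [StarOrderedRing B] {p : A → ℝ} {pn : ∀ n : ℕ, Matrix (Fin n) (Fin n) A → ℝ}
    (hpn : IsMatrixCstarSeminormFamily p pn) {π : A →⋆ₐ[ℂ] B} (hsurj : Function.Surjective π)
    (hnorm : ∀ a, ‖π a‖ = p a) (n : ℕ) (M : Matrix (Fin n) (Fin n) A) :
    pn n M = ‖CStarMatrix.ofMatrix (M.map π)‖ := by
  let lift : CStarMatrix (Fin n) (Fin n) B → Matrix (Fin n) (Fin n) A :=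
    fun X => Matrix.of fun i j => Function.surjInv hsurj (X i j)
  let proj : Matrix (Fin n) (Fin n) A → CStarMatrix (Fin n) (Fin n) B :=
    fun M => CStarMatrix.ofMatrix (M.map π)
  have hproj : ∀ X, ∃ M, proj M = X := fun X => ⟨lift X, by
    ext i j; exact Function.surjInv_eq hsurj _⟩
  let q : CStarMatrix (Fin n) (Fin n) B → ℝ := fun X => pn n (lift X)
  have hc := hpn.cstar n
  have hq : ∀ M, q (proj M) = pn n M := fun M => hc.eq_of_sub_eq_zero <| (hpn.ker n _).2
    fun i j => by
      rw [← hnorm, norm_eq_zero, Matrix.sub_apply, map_sub, sub_eq_zero]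
      exact Function.surjInv_eq hsurj _
  have hadd : ∀ M N, proj (M + N) = proj M + proj N := fun M N => by
    ext i j; exact map_add π _ _
  have hmul : ∀ M N, proj (M * N) = proj M * proj N := fun M N => by
    ext i j
    simp [proj, CStarMatrix.mul_apply, Matrix.mul_apply]
  have hstar : ∀ M, proj (star M) = star (proj M) := fun M => by
    ext i j; exact map_star π _
  have hsmul : ∀ (c : ℂ) M, proj (c • M) = c • proj M := fun c M => by
    ext i j; exact map_smul π _ _
  have h0 : proj 0 = 0 := by ext i j; exact map_zero π
  have hqc : IsCstarSeminorm q :=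
    { nonneg := fun X => hc.nonneg _
      map_zero' := by rw [← h0, hq, hc.map_zero']
      add_le := fun X Y => by
        obtain ⟨M, rfl⟩ := hproj X
        obtain ⟨N, rfl⟩ := hproj Y
        simpa only [← hadd, hq] using hc.add_le M N
      smul := fun c X => by
        obtain ⟨M, rfl⟩ := hproj X
        simpa only [← hsmul, hq] using hc.smul c M
      mul_le := fun X Y => by
        obtain ⟨M, rfl⟩ := hproj X
        obtain ⟨N, rfl⟩ := hproj Y
        simpa only [← hmul, hq] using hc.mul_le M N
      star_eq := fun X => by
        obtain ⟨M, rfl⟩ := hproj X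
        simpa only [← hstar, hq] using hc.star_eq M
      cstar := fun X => by
        obtain ⟨M, rfl⟩ := hproj X
        simpa only [← hstar, ← hmul, hq] using hc.cstar M }
  rw [← hq]
  refine hqc.eq_norm (fun X hX => ?_) (proj M)
  obtain ⟨M, rfl⟩ := hproj X
  rw [hq, hpn.ker] at hX
  ext i j
  exact norm_eq_zero.1 ((hnorm _).trans (hX i j))

end SeminormFamily

section CPForms

/-- A completely positive form on a `*`-algebra `B` over a complex vector space `W`: a map
`b ↦ G b` from `B` to the sesquilinear forms on `W` for which
`∑ᵢⱼ G (yᵢ* yⱼ) wᵢ wⱼ ≥ 0` for all finite families. -/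
structure IsCPForm {B W : Type*} [Ring B] [StarRing B] [Algebra ℂ B] [AddCommGroup W]
    [Module ℂ W] (G : B → W → W → ℂ) : Prop where
  add : ∀ a b v w, G (a + b) v w = G a v w + G b v w
  smul : ∀ (c : ℂ) b v w, G (c • b) v w = c * G b v w
  add_left : ∀ b v v' w, G b (v + v') w = G b v w + G b v' w
  smul_left : ∀ (c : ℂ) b v w, G b (c • v) w = starRingEnd ℂ c * G b v w
  add_right : ∀ b v w w', G b v (w + w') = G b v w + G b v w'
  smul_right : ∀ (c : ℂ) b v w, G b v (c • w) = c * G b v w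
  pos : ∀ (n : ℕ) (y : Fin n → B) (w : Fin n → W),
    0 ≤ ∑ i, ∑ j, G (star (y i) * y j) (w i) (w j)

namespace IsCPForm

variable {B W : Type*} [Ring B] [StarRing B] [Algebra ℂ B] [AddCommGroup W] [Module ℂ W]
  {G : B → W → W → ℂ}

theorem zero_left (hG : IsCPForm G) (b : B) (w : W) : G b 0 w = 0 := by
  simpa using hG.smul_left 0 b 0 w

theorem zero_right (hG : IsCPForm G) (b : B) (v : W) : G b v 0 = 0 := by
  simpa using hG.smul_right 0 b v 0

theorem neg (hG : IsCPForm G) (b : B) (v w : W) : G (-b) v w = -G b v w := by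
  simpa using hG.smul (-1) b v w

theorem sub (hG : IsCPForm G) (a b : B) (v w : W) : G (a - b) v w = G a v w - G b v w := by
  rw [sub_eq_add_neg, hG.add, hG.neg, sub_eq_add_neg]

theorem sum (hG : IsCPForm G) {ι : Type*} (s : Finset ι) (b : ι → B) (v w : W) :
    G (∑ i ∈ s, b i) v w = ∑ i ∈ s, G (b i) v w :=
  map_sum (AddMonoidHom.mk' (fun b => G b v w) fun a b => hG.add a b v w) b s

theorem sum_left (hG : IsCPForm G) {ι : Type*} (s : Finset ι) (b : B) (v : ι → W) (w : W) :
    G b (∑ i ∈ s, v i) w = ∑ i ∈ s, G b (v i) w :=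
  map_sum (AddMonoidHom.mk' (fun v => G b v w) fun v v' => hG.add_left b v v' w) v s

theorem sum_right (hG : IsCPForm G) {ι : Type*} (s : Finset ι) (b : B) (v : W) (w : ι → W) :
    G b v (∑ i ∈ s, w i) = ∑ i ∈ s, G b v (w i) :=
  map_sum (AddMonoidHom.mk' (fun w => G b v w) fun w w' => hG.add_right b v w w') w s

theorem sum_nonneg (hG : IsCPForm G) {ι : Type*} [Fintype ι] (y : ι → B) (w : ι → W) :
    0 ≤ ∑ i, ∑ j, G (star (y i) * y j) (w i) (w j) := by
  let e := Fintype.equivFin ι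
  have := hG.pos _ (y ∘ e.symm) (w ∘ e.symm)
  rw [← e.sum_comp] at this
  simp_rw [← e.sum_comp (fun j => G (star ((y ∘ e.symm) _) * (y ∘ e.symm) j) _ _)] at this
  simpa using this

theorem self_nonneg (hG : IsCPForm G) (b : B) (w : W) : 0 ≤ G (star b * b) w w := by
  simpa using hG.pos 1 (fun _ => b) (fun _ => w)

theorem star_apply (hG : IsCPForm G) (b : B) (v w : W) :
    G (star b) w v = starRingEnd ℂ (G b v w) := by
  have key : ∀ w, (G b v w).im + (G (star b) w v).im = 0 := by
    intro w
    have h := hG.pos 2 ![1, b] ![v, w]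
    have h1 := hG.self_nonneg 1 v
    have h2 := hG.self_nonneg b w
    simp only [Fin.sum_univ_two, Matrix.cons_val_zero, Matrix.cons_val_one, star_one, one_mul,
      mul_one, Complex.nonneg_iff, Complex.add_im] at h h1 h2
    linarith [h.2, h1.2, h2.2]
  have h1 := key w
  have h2 := key (Complex.I • w)
  rw [hG.smul_right, hG.smul_left] at h2
  simp only [Complex.conj_I, Complex.mul_im, Complex.I_re, Complex.I_im, Complex.neg_re,
    Complex.neg_im] at h2
  apply Complex.ext
  · rw [Complex.conj_re]; linarith
  · rw [Complex.conj_im]; linarith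

theorem two_mul_re_add_nonneg (hG : IsCPForm G) (b : B) (v w : W) :
    0 ≤ (G 1 v v).re + 2 * (G b v w).re + (G (star b * b) w w).re := by
  have h := (Complex.nonneg_iff.1 (hG.pos 2 ![1, b] ![v, w])).1
  simp only [Fin.sum_univ_two, Matrix.cons_val_zero, Matrix.cons_val_one, star_one, one_mul,
    mul_one, hG.star_apply, Complex.add_re, Complex.conj_re] at h
  linarith

/-- A completely positive form is real-positive on accretive matrices. -/
theorem re_sum_nonneg (hG : IsCPForm G) {n : ℕ} {X Y : Matrix (Fin n) (Fin n) B}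
    (h : X + star X = star Y * Y) (w : Fin n → W) :
    0 ≤ (∑ i, ∑ j, G (X i j) (w i) (w j)).re := by
  have h1 : ∑ i, ∑ j, G ((X + star X) i j) (w i) (w j)
      = (∑ i, ∑ j, G (X i j) (w i) (w j))
        + starRingEnd ℂ (∑ i, ∑ j, G (X i j) (w i) (w j)) := by
    simp only [Matrix.add_apply, hG.add, Finset.sum_add_distrib]
    congr 1
    rw [Finset.sum_comm, map_sum]
    refine Finset.sum_congr rfl fun i _ => ?_
    rw [map_sum]
    exact Finset.sum_congr rfl fun j _ => hG.star_apply _ _ _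
  have h2 : 0 ≤ ∑ i, ∑ j, G ((X + star X) i j) (w i) (w j) := by
    have e : ∑ i, ∑ j, G ((X + star X) i j) (w i) (w j)
        = ∑ k, ∑ i, ∑ j, G (star (Y k i) * Y k j) (w i) (w j) := by
      rw [h, Finset.sum_comm (s := Finset.univ) (t := Finset.univ)
        (f := fun k i => ∑ j, G (star (Y k i) * Y k j) (w i) (w j))]
      refine Finset.sum_congr rfl fun i _ => ?_
      rw [Finset.sum_comm]
      refine Finset.sum_congr rfl fun j _ => ?_
      rw [Matrix.mul_apply, hG.sum]
      rfl
    rw [e]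
    exact Finset.sum_nonneg fun k _ => hG.pos n (Y k) w
  rw [h1, Complex.add_conj] at h2
  have := (Complex.nonneg_iff.1 h2).1
  rw [Complex.ofReal_re] at this
  linarith

end IsCPForm

end CPForms

section Extension

/-- M. Riesz extension of a complex functional `f` along `g`, real-positive on a cone `K`. -/
theorem exists_extension_of_cone {V E : Type*} [AddCommGroup V] [Module ℂ V] [AddCommGroup E]
    [Module ℂ E] (g : V →ₗ[ℂ] E) (f : V →ₗ[ℂ] ℂ) (K : PointedCone ℝ E)
    (hf : ∀ v, g v ∈ K → 0 ≤ (f v).re) (hK : ∀ y, ∃ v, g v + y ∈ K) :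
    ∃ F : E →ₗ[ℂ] ℂ, (∀ v, F (g v) = f v) ∧ ∀ y ∈ K, 0 ≤ (F y).re := by
  have hre : ∀ v, g v = 0 → (f v).re = 0 := fun v hv => by
    have h1 := hf v (hv ▸ K.zero_mem)
    have h2 := hf (-v) (by rw [map_neg, hv, neg_zero]; exact K.zero_mem)
    rw [map_neg, Complex.neg_re] at h2
    linarith
  have hker : LinearMap.ker g ≤ LinearMap.ker f := fun v hv => by
    rw [LinearMap.mem_ker] at hv ⊢
    have h1 := hre v hv
    have h2 := hre (Complex.I • v) (by rw [map_smul, hv, smul_zero])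
    rw [map_smul, smul_eq_mul, Complex.I_mul_re] at h2
    exact Complex.ext h1 (by simpa using h2)
  let f₀ : LinearMap.range g →ₗ[ℂ] ℂ :=
    (LinearMap.ker g).liftQ f hker ∘ₗ g.quotKerEquivRange.symm.toLinearMap
  have hf₀ : ∀ v, f₀ ⟨g v, v, rfl⟩ = f v := fun v => by
    have := LinearMap.quotKerEquivRange_symm_apply_image g v ⟨v, rfl⟩
    simp only [f₀, LinearMap.comp_apply, LinearEquiv.coe_coe, this]
    exact Submodule.liftQ_apply _ _ _
  let fr : E →ₗ.[ℝ] ℝ :=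
    { domain := (LinearMap.range g).restrictScalars ℝ
      toFun := Complex.reLm ∘ₗ f₀.restrictScalars ℝ }
  obtain ⟨F, hF1, hF2⟩ := riesz_extension K fr
    (by
      rintro ⟨_, v, rfl⟩ hv
      exact (hf v hv).trans_eq (congrArg Complex.re (hf₀ v)).symm)
    (fun y => by
      obtain ⟨v, hv⟩ := hK y
      exact ⟨⟨g v, v, rfl⟩, hv⟩)
  have hFg : ∀ v, F (g v) = (f v).re := fun v =>
    (hF1 ⟨g v, v, rfl⟩).trans (congrArg Complex.re (hf₀ v))
  refine ⟨Module.Dual.extendRCLike F, fun v => ?_, fun y hy => ?_⟩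
  · rw [Module.Dual.extendRCLike_apply, RCLike.I_to_complex, ← map_smul, hFg, hFg, map_smul]
    apply Complex.ext <;> simp
  · rw [Module.Dual.extendRCLike_apply]
    simpa using hF2 y hy

end Extension

section Transfer

theorem algebraMap_sub_ofMatrix_map {B₁ : Type*} [CStarAlgebra B₁] {S : Type*}
    [AddCommGroup S] [Module ℂ S]
    {j : S →ₗ[ℂ] B₁} {u : S} (hu : j u = 1) {n : ℕ} (N : Matrix (Fin n) (Fin n) S) (t : ℝ) :
    algebraMap ℝ (CStarMatrix (Fin n) (Fin n) B₁) t - CStarMatrix.ofMatrix (N.map j)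
      = CStarMatrix.ofMatrix ((Matrix.diagonal (fun _ => (t : ℂ) • u) - N).map j) := by
  rw [Algebra.algebraMap_eq_smul_one]
  ext i k
  simp [CStarMatrix.one_apply, Matrix.diagonal_apply]
  split_ifs <;> simp [hu]

section

variable {B₁ B₂ : Type*} [CStarAlgebra B₁] [PartialOrder B₁] [StarOrderedRing B₁]
  [CStarAlgebra B₂] [PartialOrder B₂] [StarOrderedRing B₂]

theorem nonneg_smul_add_star_mul_mul (a b d : B₁) :
    0 ≤ (1 + ‖b‖ ^ 2) • (star a * a + star d * d)
      + (star a * (b * d) + star (star a * (b * d))) := by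
  have h1 : 0 ≤ star (a + b * d) * (a + b * d) := star_mul_self_nonneg _
  have h2 : 0 ≤ ‖b‖ ^ 2 • (star a * a) := smul_nonneg (by positivity) (star_mul_self_nonneg _)
  have h3 : 0 ≤ star d * d := star_mul_self_nonneg _
  have h4 : star d * (star b * b) * d ≤ star d * algebraMap ℝ B₁ (‖b‖ ^ 2) * d :=
    star_left_conjugate_le_conjugate CStarAlgebra.star_mul_le_algebraMap_norm_sq d
  rw [← sub_nonneg] at h4
  refine (add_nonneg (add_nonneg (add_nonneg h1 h2) h3) h4).trans_eq ?_
  simp only [Algebra.algebraMap_eq_smul_one, star_add, star_mul, star_star, mul_add, add_mul,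
    add_smul, one_smul, smul_add, mul_smul_comm, smul_mul_assoc, mul_one, mul_assoc]
  abel

/-- A unital matrix norm preserving correspondence preserves accretivity of matrices. -/
theorem accretive_map_of_norm_eq {S : Type*} [AddCommGroup S] [Module ℂ S]
    {j₁ : S →ₗ[ℂ] B₁} {j₂ : S →ₗ[ℂ] B₂} {u : S} (hu₁ : j₁ u = 1) (hu₂ : j₂ u = 1)
    (hiso : ∀ (n : ℕ) (N : Matrix (Fin n) (Fin n) S),
      ‖CStarMatrix.ofMatrix (N.map j₁)‖ = ‖CStarMatrix.ofMatrix (N.map j₂)‖)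
    {n : ℕ} {N : Matrix (Fin n) (Fin n) S}
    (hN : 0 ≤ CStarMatrix.ofMatrix (N.map j₂) + star (CStarMatrix.ofMatrix (N.map j₂))) :
    0 ≤ CStarMatrix.ofMatrix (N.map j₁) + star (CStarMatrix.ofMatrix (N.map j₁)) := by
  refine accretive_of_norm_le hN fun t _ => ?_
  exact ((congrArg norm (algebraMap_sub_ofMatrix_map hu₁ N t)).trans
    ((hiso _ _).trans (congrArg norm (algebraMap_sub_ofMatrix_map hu₂ N t)).symm)).le

end

theorem Module.Basis.exists_finite_expansion {ι W : Type*} [AddCommGroup W] [Module ℂ W]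
    (b : Module.Basis ι ℂ W) (F : Finset W) :
    ∃ (n : ℕ) (k : Fin n → ι) (r : W → Fin n → ℂ), Function.Injective k ∧
      ∀ w ∈ F, w = ∑ i, r w i • b (k i) := by
  classical
  let s : Finset ι := F.biUnion fun w => (b.repr w).support
  refine ⟨s.card, fun i => s.equivFin.symm i, fun w i => b.repr w (s.equivFin.symm i),
    Subtype.val_injective.comp s.equivFin.symm.injective, fun w hw => ?_⟩
  rw [s.equivFin.symm.sum_comp (fun i : s => (b.repr w i • b i : W)),
    Finset.sum_coe_sort s (fun i => (b.repr w i • b i : W))]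
  refine (b.linearCombination_repr w).symm.trans ?_
  rw [Finsupp.linearCombination_apply, Finsupp.sum]
  refine Finset.sum_subset (fun i hi => Finset.mem_biUnion.2 ⟨w, hw, hi⟩) fun i _ hi => ?_
  rw [Finsupp.notMem_support_iff.1 hi, zero_smul]

/-- Sesquilinear expressions along a finitely supported family only depend on a matrix of
coefficients with respect to vectors spanning the family. -/
theorem exists_matrix_sum_eq {S W : Type*} [AddCommGroup S] [Module ℂ S] [AddCommGroup W]
    [Module ℂ W] {n : ℕ} {e : Fin n → W} {r : W → Fin n → ℂ} {v : (W × W) →₀ S}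
    (h₁ : ∀ p ∈ v.support, p.1 = ∑ i, r p.1 i • e i)
    (h₂ : ∀ p ∈ v.support, p.2 = ∑ i, r p.2 i • e i) {Z : Type*} [AddCommGroup Z] [Module ℂ Z]
    (T : W → W → S →ₗ[ℂ] Z)
    (hT : ∀ (a b : Fin n → ℂ) (t : S), T (∑ i, a i • e i) (∑ j, b j • e j) t
      = ∑ i, ∑ j, (starRingEnd ℂ (a i) * b j) • T (e i) (e j) t) :
    ∑ i, ∑ j, T (e i) (e j) (v.sum fun p t => (starRingEnd ℂ (r p.1 i) * r p.2 j) • t)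
      = v.sum fun p t => T p.1 p.2 t := by
  have : ∀ p ∈ v.support, T p.1 p.2 (v p)
      = ∑ i, ∑ j, (starRingEnd ℂ (r p.1 i) * r p.2 j) • T (e i) (e j) (v p) := fun p hp => by
    conv_lhs => rw [h₁ p hp, h₂ p hp]
    exact hT _ _ _
  simp only [Finsupp.sum, map_sum, map_smul]
  rw [Finset.sum_congr rfl this, Finset.sum_comm (s := v.support)]
  refine Finset.sum_congr rfl fun i _ => ?_
  rw [Finset.sum_comm]

end Transfer

section TransferForm

/-- A completely positive form as a linear functional of its algebra variable. -/
def IsCPForm.linearMap {B W : Type*} [Ring B] [StarRing B] [Algebra ℂ B] [AddCommGroup W]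
    [Module ℂ W] {G : B → W → W → ℂ} (hG : IsCPForm G) (v w : W) : B →ₗ[ℂ] ℂ where
  toFun b := G b v w
  map_add' a b := hG.add a b v w
  map_smul' c b := hG.smul c b v w

/-- The compression of a formal matrix with entries in `B`, indexed by vectors of `W`, along a
linear map `y : W → B`. -/
noncomputable def compression {B W : Type*} [CStarAlgebra B] [AddCommGroup W] [Module ℂ W]
    (y : W →ₗ[ℂ] B) : ((W × W) →₀ B) →ₗ[ℂ] B :=
  Finsupp.lsum ℂ fun p => LinearMap.mulLeft ℂ (star (y p.1)) ∘ₗ LinearMap.mulRight ℂ (y p.2)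

theorem compression_single {B W : Type*} [CStarAlgebra B] [AddCommGroup W] [Module ℂ W]
    (y : W →ₗ[ℂ] B) (p : W × W) (b : B) :
    compression y (Finsupp.single p b) = star (y p.1) * (b * y p.2) := by
  rw [compression, Finsupp.lsum_single]
  rfl

variable {B₁ B₂ : Type*} [CStarAlgebra B₁] [PartialOrder B₁] [StarOrderedRing B₁]
  [CStarAlgebra B₂] [PartialOrder B₂] [StarOrderedRing B₂]

/-- The cone of formal matrices over `B` all of whose compressions are accretive. -/
def accretiveCone (B W : Type*) [CStarAlgebra B] [PartialOrder B] [StarOrderedRing B]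
    [AddCommGroup W] [Module ℂ W] : PointedCone ℝ ((W × W) →₀ B) where
  carrier := {M | ∀ y : W →ₗ[ℂ] B, 0 ≤ compression y M + star (compression y M)}
  zero_mem' y := by simp
  add_mem' {M N} hM hN y := by
    rw [map_add, star_add]
    exact (add_nonneg (hM y) (hN y)).trans_eq (by abel)
  smul_mem' c M hM y := by
    have : compression y (c • M) = (c : ℝ) • compression y M :=
      map_smul ((compression y).restrictScalars ℝ) (c : ℝ) M
    rw [this, star_smul, star_trivial, ← smul_add]
    exact smul_nonneg c.2 (hM y)

theorem mem_accretiveCone {B W : Type*} [CStarAlgebra B] [PartialOrder B] [StarOrderedRing B]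
    [AddCommGroup W] [Module ℂ W] {M : (W × W) →₀ B} :
    M ∈ accretiveCone B W ↔ ∀ y : W →ₗ[ℂ] B, 0 ≤ compression y M + star (compression y M) :=
  Iff.rfl

theorem isCPForm_of_accretiveCone {W : Type*} [AddCommGroup W] [Module ℂ W]
    {F : ((W × W) →₀ B₂) →ₗ[ℂ] ℂ} (hF : ∀ M ∈ accretiveCone B₂ W, 0 ≤ (F M).re) :
    IsCPForm fun b v w => F (Finsupp.single (v, w) b) := by
  have hskew : ∀ M, (∀ y : W →ₗ[ℂ] B₂, compression y M + star (compression y M) = 0) →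
      (F M).re = 0 := fun M hM => by
    have h1 := hF M (mem_accretiveCone.2 fun y => (hM y).ge)
    have h2 := hF (-M) (mem_accretiveCone.2 fun y => by
      rw [map_neg, star_neg, ← neg_add, hM y, neg_zero])
    rw [map_neg, Complex.neg_re] at h2
    linarith
  have hzero : ∀ M, (∀ y : W →ₗ[ℂ] B₂, compression y M = 0) → F M = 0 := fun M hM => by
    have h1 := hskew M fun y => by rw [hM y, star_zero, add_zero]
    have h2 := hskew (Complex.I • M) fun y => by
      rw [map_smul, hM y, smul_zero, star_zero, add_zero]
    rw [map_smul, smul_eq_mul, Complex.I_mul_re] at h2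
    exact Complex.ext h1 (by simpa using h2)
  refine
    { add := fun a b v w => by rw [Finsupp.single_add, map_add]
      smul := fun c b v w => by rw [← Finsupp.smul_single, map_smul, smul_eq_mul]
      add_left := fun b v v' w => ?_
      smul_left := fun c b v w => ?_
      add_right := fun b v w w' => ?_
      smul_right := fun c b v w => ?_
      pos := fun n y w => ?_ }
  · rw [← map_add, ← sub_eq_zero, ← map_sub]
    refine hzero _ fun y => ?_
    simp only [map_sub, map_add, compression_single, star_add]
    noncomm_ring
  · rw [← smul_eq_mul, ← map_smul, ← sub_eq_zero, ← map_sub]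
    refine hzero _ fun y => ?_
    simp only [map_sub, map_smul, compression_single, star_smul, smul_mul_assoc]
    exact sub_self _
  · rw [← map_add, ← sub_eq_zero, ← map_sub]
    refine hzero _ fun y => ?_
    simp only [map_sub, map_add, compression_single]
    noncomm_ring
  · rw [← smul_eq_mul, ← map_smul, ← sub_eq_zero, ← map_sub]
    refine hzero _ fun y => ?_
    simp only [map_sub, map_smul, compression_single, mul_smul_comm]
    exact sub_self _
  · simp_rw [← map_sum]
    set M : (W × W) →₀ B₂ := ∑ i, ∑ j, Finsupp.single (w i, w j) (star (y i) * y j)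
    have hM : ∀ z : W →ₗ[ℂ] B₂, compression z M
        = star (∑ i, y i * z (w i)) * ∑ i, y i * z (w i) := fun z => by
      simp only [M, map_sum, compression_single, star_sum, star_mul, Finset.sum_mul,
        Finset.mul_sum, mul_assoc]
      exact Finset.sum_comm
    have h1 := hF M (mem_accretiveCone.2 fun z => by
      rw [hM, star_mul, star_star]
      exact add_nonneg (star_mul_self_nonneg _) (star_mul_self_nonneg _))
    have h2 := hskew (Complex.I • M) fun z => by
      rw [map_smul, hM, star_smul, star_mul, star_star, ← add_smul]
      simp
    rw [map_smul, smul_eq_mul, Complex.I_mul_re, neg_eq_zero] at h2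
    exact Complex.nonneg_iff.2 ⟨h1, h2.symm⟩

theorem exists_map_add_mem_accretiveCone {S W : Type*} [AddCommGroup S] [Module ℂ S]
    [AddCommGroup W] [Module ℂ W] {j : S →ₗ[ℂ] B₂} {u : S} (hu : j u = 1) (M : (W × W) →₀ B₂) :
    ∃ v : (W × W) →₀ S, Finsupp.mapRange.linearMap j v + M ∈ accretiveCone B₂ W := by
  induction M using Finsupp.induction_linear with
  | zero => exact ⟨0, by simp⟩
  | add M N hM hN =>
    obtain ⟨v, hv⟩ := hM
    obtain ⟨v', hv'⟩ := hN
    refine ⟨v + v', ?_⟩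
    have := add_mem hv hv'
    rwa [add_add_add_comm, ← map_add] at this
  | single p b =>
    let c : ℂ := (((1 + ‖b‖ ^ 2) / 2 : ℝ) : ℂ)
    refine ⟨Finsupp.single (p.1, p.1) (c • u) + Finsupp.single (p.2, p.2) (c • u),
      mem_accretiveCone.2 fun y => ?_⟩
    have h := nonneg_smul_add_star_mul_mul (y p.1) b (y p.2)
    refine h.trans_eq ?_
    simp only [map_add, Finsupp.mapRange.linearMap_apply, Finsupp.mapRange_single,
      compression_single, map_smul, hu, star_add, smul_mul_assoc, one_mul, mul_smul_comm,
      star_smul, star_mul, star_star]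
    have hc : star c = c := Complex.conj_ofReal _
    have hcr : ∀ x : B₂, c • x = ((1 + ‖b‖ ^ 2) / 2) • x := fun x => Complex.coe_smul _ _
    have h2 : ∀ x : B₂, (1 + ‖b‖ ^ 2) • x
        = ((1 + ‖b‖ ^ 2) / 2) • x + ((1 + ‖b‖ ^ 2) / 2) • x := fun x => by
      rw [← add_smul, add_halves]
    rw [hc, hcr, hcr, h2, smul_add]
    abel

/-- Completely positive forms pass from `B₁` to `B₂` along a unital complete isometry between
subspaces of `B₁` and `B₂`. -/
theorem IsCPForm.exists_transfer {S : Type*} [AddCommGroup S] [Module ℂ S]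
    {j₁ : S →ₗ[ℂ] B₁} {j₂ : S →ₗ[ℂ] B₂} {u : S} (hu₁ : j₁ u = 1) (hu₂ : j₂ u = 1)
    (hiso : ∀ (n : ℕ) (N : Matrix (Fin n) (Fin n) S),
      ‖CStarMatrix.ofMatrix (N.map j₁)‖ = ‖CStarMatrix.ofMatrix (N.map j₂)‖)
    {W : Type*} [AddCommGroup W] [Module ℂ W] {G : B₁ → W → W → ℂ} (hG : IsCPForm G) :
    ∃ G' : B₂ → W → W → ℂ, IsCPForm G' ∧ ∀ t v w, G' (j₂ t) v w = G (j₁ t) v w := by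
  classical
  let g : ((W × W) →₀ S) →ₗ[ℂ] ((W × W) →₀ B₂) := Finsupp.mapRange.linearMap j₂
  let f : ((W × W) →₀ S) →ₗ[ℂ] ℂ := Finsupp.lsum ℂ fun p => hG.linearMap p.1 p.2 ∘ₗ j₁
  obtain ⟨F, hFg, hF⟩ := exists_extension_of_cone g f (accretiveCone B₂ W)
    (fun v hv => by
      let b := Module.Basis.ofVectorSpace ℂ W
      obtain ⟨n, k, r, hk, hr⟩ :=
        b.exists_finite_expansion (v.support.image Prod.fst ∪ v.support.image Prod.snd)
      have hr₁ : ∀ p ∈ v.support, p.1 = ∑ i, r p.1 i • b (k i) := fun p hp =>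
        hr _ (Finset.mem_union_left _ (Finset.mem_image_of_mem _ hp))
      have hr₂ : ∀ p ∈ v.support, p.2 = ∑ i, r p.2 i • b (k i) := fun p hp =>
        hr _ (Finset.mem_union_right _ (Finset.mem_image_of_mem _ hp))
      let N : Matrix (Fin n) (Fin n) S := fun i j =>
        v.sum fun p t => (starRingEnd ℂ (r p.1 i) * r p.2 j) • t
      have hfN : f v = ∑ i, ∑ j, G (j₁ (N i j)) (b (k i)) (b (k j)) :=
        (exists_matrix_sum_eq hr₁ hr₂ (fun w w' => hG.linearMap w w' ∘ₗ j₁)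
          fun x y t => by
            change G (j₁ t) _ _ = ∑ i, ∑ j, _ • G (j₁ t) _ _
            simp only [hG.sum_left, hG.sum_right, hG.smul_left, hG.smul_right, smul_eq_mul,
              mul_assoc]).symm
      have hgN : ∀ y : Fin n → B₂, ∑ i, ∑ j, star (y i) * j₂ (N i j) * y j
          = compression (b.constr ℂ (Function.extend k y 0)) (g v) := fun y => by
        set z := b.constr ℂ (Function.extend k y 0)
        have hz : ∀ i, z (b (k i)) = y i := fun i => by
          rw [Module.Basis.constr_basis, hk.extend_apply]
        have h := exists_matrix_sum_eq hr₁ hr₂ (fun w w' =>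
            (LinearMap.mulLeft ℂ (star (z w)) ∘ₗ LinearMap.mulRight ℂ (z w')) ∘ₗ j₂)
          fun x y t => by
            simp only [LinearMap.comp_apply, LinearMap.mulLeft_apply, LinearMap.mulRight_apply,
              map_sum, map_smul, star_sum, star_smul, Finset.sum_mul, Finset.mul_sum,
              smul_mul_assoc, mul_smul_comm, Finset.smul_sum, smul_smul]
            rw [Finset.sum_comm]
            simp only [mul_comm, starRingEnd_apply]
        have h2 : compression z (g v) = v.sum fun p t => star (z p.1) * (j₂ t * z p.2) := by
          simp only [compression, g, Finsupp.mapRange.linearMap_apply, Finsupp.coe_lsum]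
          rw [Finsupp.sum_mapRange_index (by simp)]
          rfl
        rw [h2]
        refine Eq.trans ?_ h
        refine Finset.sum_congr rfl fun i _ => Finset.sum_congr rfl fun j _ => ?_
        simp only [LinearMap.comp_apply, LinearMap.mulLeft_apply, LinearMap.mulRight_apply, hz,
          mul_assoc]
        rfl
      have hN₂ : 0 ≤ CStarMatrix.ofMatrix (N.map j₂)
          + star (CStarMatrix.ofMatrix (N.map j₂)) := by
        refine CStarMatrix.nonneg_of_forall (IsSelfAdjoint.add_star_self _) fun y => ?_
        have h := mem_accretiveCone.1 hv (b.constr ℂ (Function.extend k y 0))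
        rw [← hgN] at h
        refine h.trans_eq ?_
        simp only [CStarMatrix.add_apply, CStarMatrix.star_apply, mul_add, add_mul,
          Finset.sum_add_distrib, star_sum, star_mul, star_star, mul_assoc]
        congr 1
        exact Finset.sum_comm
      obtain ⟨Y, hY⟩ := exists_eq_star_mul_self_of_nonneg
        (accretive_map_of_norm_eq hu₁ hu₂ hiso hN₂)
      rw [hfN]
      exact hG.re_sum_nonneg (X := N.map j₁) (Y := CStarMatrix.ofMatrix.symm Y) hY _)
    (exists_map_add_mem_accretiveCone hu₂)
  refine ⟨_, isCPForm_of_accretiveCone hF, fun t v w => ?_⟩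
  have := hFg (Finsupp.single (v, w) t)
  simp only [g, f, Finsupp.mapRange.linearMap_apply, Finsupp.mapRange_single,
    Finsupp.lsum_single] at this
  exact this

end TransferForm

section Operators

variable {B : Type*} [CStarAlgebra B] [PartialOrder B] [StarOrderedRing B]
  {H : Type*} [NormedAddCommGroup H] [InnerProductSpace ℂ H]

theorem IsCPForm.apply_star_mul_self_le {W : Type*} [AddCommGroup W] [Module ℂ W]
    {G : B → W → W → ℂ} (hG : IsCPForm G) (b : B) (w : W) :
    (G (star b * b) w w).re ≤ ‖b‖ ^ 2 * (G 1 w w).re := by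
  have h : 0 ≤ algebraMap ℝ B (‖b‖ ^ 2) - star b * b :=
    sub_nonneg.2 CStarAlgebra.star_mul_le_algebraMap_norm_sq
  obtain ⟨z, hz⟩ := exists_eq_star_mul_self_of_nonneg h
  have h2 := (Complex.nonneg_iff.1 (hG.self_nonneg z w)).1
  rw [← hz, hG.sub, Algebra.algebraMap_eq_smul_one, ← Complex.coe_smul, hG.smul, Complex.sub_re,
    Complex.re_ofReal_mul] at h2
  linarith

theorem IsCPForm.norm_apply_le {G : B → H → H → ℂ} (hG : IsCPForm G)
    (h1 : ∀ h k, G 1 h k = inner ℂ h k) (b : B) (h k : H) :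
    ‖G b h k‖ ≤ (1 + ‖b‖ ^ 2) / 2 * ‖h‖ * ‖k‖ := by
  have h1' : ∀ h, (G 1 h h).re = ‖h‖ ^ 2 := fun h => by
    rw [h1]; exact inner_self_eq_norm_sq (𝕜 := ℂ) h
  have key : ∀ h k, 2 * ‖G b h k‖ ≤ ‖h‖ ^ 2 + ‖b‖ ^ 2 * ‖k‖ ^ 2 := fun h k => by
    obtain ⟨c, hc, hcG⟩ := RCLike.exists_norm_eq_mul_self (K := ℂ) (G b h k)
    have h2 := hG.two_mul_re_add_nonneg b h (-c • k)
    have h3 := hG.apply_star_mul_self_le b (-c • k)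
    have h4 : (G b h (-c • k)).re = -‖G b h k‖ := by
      rw [hG.smul_right, neg_mul, ← hcG]
      simp
    rw [h1', norm_smul, norm_neg, hc, one_mul] at h3
    rw [h1', h4] at h2
    linarith
  rcases eq_or_ne h 0 with rfl | hh
  · simp [hG.zero_left]
  rcases eq_or_ne k 0 with rfl | hk
  · simp [hG.zero_right]
  have hh' := norm_pos_iff.2 hh
  have hk' := norm_pos_iff.2 hk
  have h2 := key (((‖h‖⁻¹ : ℝ) : ℂ) • h) (((‖k‖⁻¹ : ℝ) : ℂ) • k)
  rw [hG.smul_left, hG.smul_right, norm_mul, norm_mul, norm_smul, norm_smul, RCLike.norm_conj,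
    Complex.norm_real, Complex.norm_real, norm_inv, norm_inv, norm_norm, norm_norm,
    inv_mul_cancel₀ hh'.ne', inv_mul_cancel₀ hk'.ne', ← mul_assoc] at h2
  have h3 : ‖G b h k‖ = (‖h‖⁻¹ * ‖k‖⁻¹ * ‖G b h k‖) * ‖h‖ * ‖k‖ := by field_simp
  rw [h3]
  gcongr
  linarith

variable [CompleteSpace H]

/-- A unital completely positive form over a Hilbert space comes from a linear map into the
bounded operators. -/
theorem IsCPForm.exists_linearMap {G : B → H → H → ℂ} (hG : IsCPForm G)
    (h1 : ∀ h k, G 1 h k = inner ℂ h k) :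
    ∃ Ψ : B →ₗ[ℂ] (H →L[ℂ] H), (∀ b h k, inner ℂ h (Ψ b k) = G b h k) ∧ Ψ 1 = 1 := by
  have hT : ∀ b, ∃ T : H →L[ℂ] H, ∀ h k, inner ℂ h (T k) = G b h k := fun b => by
    let f : H →ₗ⋆[ℂ] H →ₗ[ℂ] ℂ :=
      LinearMap.mk₂'ₛₗ (starRingEnd ℂ) (RingHom.id ℂ) (G b) (hG.add_left b) (hG.smul_left · b)
        (hG.add_right b) (hG.smul_right · b)
    let T := InnerProductSpace.continuousLinearMapOfBilin
      (f.mkContinuous₂ ((1 + ‖b‖ ^ 2) / 2) (hG.norm_apply_le h1 b))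
    refine ⟨ContinuousLinearMap.adjoint T, fun h k => ?_⟩
    rw [ContinuousLinearMap.adjoint_inner_right]
    exact InnerProductSpace.continuousLinearMapOfBilin_apply _ h k
  choose T hT using hT
  refine ⟨{ toFun := T
            map_add' := fun a b => ?_
            map_smul' := fun c b => ?_ }, hT, ?_⟩
  · ext k
    refine ext_inner_left ℂ fun h => ?_
    rw [add_apply, inner_add_right, hT, hT, hT, hG.add]
  · ext k
    refine ext_inner_left ℂ fun h => ?_
    rw [RingHom.id_apply, smul_apply, inner_smul_right, hT, hT, hG.smul]
  · ext k
    refine ext_inner_left ℂ fun h => ?_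
    exact (hT 1 h k).trans (h1 h k)

end Operators

section FormCP

/-- Complete positivity of an operator valued linear map, in terms of its sesquilinear forms. -/
def IsFormCP {B H : Type*} [Ring B] [StarRing B] [Algebra ℂ B] [NormedAddCommGroup H]
    [InnerProductSpace ℂ H] (Ψ : B →ₗ[ℂ] (H →L[ℂ] H)) : Prop :=
  IsCPForm fun b h k => inner ℂ h (Ψ b k)

theorem isFormCP_of_sum_nonneg {B H : Type*} [Ring B] [StarRing B] [Algebra ℂ B]
    [NormedAddCommGroup H] [InnerProductSpace ℂ H] {Ψ : B →ₗ[ℂ] (H →L[ℂ] H)}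
    (h : ∀ (n : ℕ) (y : Fin n → B) (w : Fin n → H),
      0 ≤ ∑ i, ∑ j, inner ℂ (w i) (Ψ (star (y i) * y j) (w j))) : IsFormCP Ψ where
  add a b v w := by rw [map_add, add_apply, inner_add_right]
  smul c b v w := by rw [map_smul, smul_apply, inner_smul_right]
  add_left b v v' w := inner_add_left _ _ _
  smul_left c b v w := inner_smul_left _ _ _
  add_right b v w w' := by rw [map_add, inner_add_right]
  smul_right c b v w := by rw [map_smul, inner_smul_right]
  pos := h

theorem IsFormCP.sq_norm_apply_le {B H : Type*} [Ring B] [StarRing B] [Algebra ℂ B]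
    [NormedAddCommGroup H] [InnerProductSpace ℂ H] {Ψ : B →ₗ[ℂ] (H →L[ℂ] H)}
    (hΨ : IsFormCP Ψ) (h1 : Ψ 1 = 1) (b : B) (k : H) :
    ‖Ψ b k‖ ^ 2 ≤ (inner ℂ k (Ψ (star b * b) k)).re := by
  have h := IsCPForm.two_mul_re_add_nonneg hΨ b (-(Ψ b k)) k
  have e : (inner ℂ (Ψ b k) (Ψ b k)).re = ‖Ψ b k‖ ^ 2 := inner_self_eq_norm_sq (𝕜 := ℂ) _
  simp only [h1, one_apply_eq_self, inner_neg_left, inner_neg_right, neg_neg, Complex.neg_re,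
    e] at h
  linarith

theorem eq_zero_of_quadratic_nonneg {a M : ℝ} (h : ∀ c : ℝ, 0 ≤ 2 * c * a + c ^ 2 * M) :
    a = 0 := by
  have := discrim_le_zero (a := M) (b := 2 * a) (c := 0) fun x => by linarith [h x]
  rw [discrim] at this
  nlinarith [sq_nonneg a]

variable {H : Type*} [NormedAddCommGroup H] [InnerProductSpace ℂ H]

section Algebraic

variable {B : Type*} [Ring B] [StarRing B] [Algebra ℂ B] {Ψ : B →ₗ[ℂ] (H →L[ℂ] H)}

theorem IsFormCP.map_star [CompleteSpace H] (hΨ : IsFormCP Ψ) (b : B) :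
    Ψ (star b) = star (Ψ b) := by
  ext k
  refine ext_inner_left ℂ fun h => ?_
  rw [ContinuousLinearMap.star_eq_adjoint, ContinuousLinearMap.adjoint_inner_right,
    ← inner_conj_symm (Ψ b h)]
  exact IsCPForm.star_apply hΨ b k h

/-- An element `x` attaining equality in the Kadison–Schwarz inequality belongs to the
multiplicative domain. -/
theorem IsFormCP.map_mul_of_le [CompleteSpace H] (hΨ : IsFormCP Ψ) (h1 : Ψ 1 = 1) {x : B}
    (hx : ∀ k, (inner ℂ k (Ψ (star x * x) k)).re ≤ ‖Ψ x k‖ ^ 2) (y : B) :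
    Ψ (y * x) = Ψ y * Ψ x := by
  ext k
  set g := Ψ x k with hg
  set D := Ψ (y * x) k - Ψ y g with hD
  have e : ∀ z : H, (inner ℂ z z).re = ‖z‖ ^ 2 := inner_self_eq_norm_sq (𝕜 := ℂ)
  have key : ‖D‖ ^ 2 = 0 := eq_zero_of_quadratic_nonneg
    (M := (inner ℂ D (Ψ (star (star y) * star y) D)).re) fun c => by
    have h := (Complex.nonneg_iff.1
      (IsCPForm.pos hΨ 3 ![x, 1, star y] ![k, -g, (c : ℂ) • D])).1
    have s1 : (inner ℂ k (Ψ (star x) g)).re = ‖g‖ ^ 2 := by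
      rw [hΨ.map_star, ContinuousLinearMap.star_eq_adjoint,
        ContinuousLinearMap.adjoint_inner_right, e]
    have s2 : (inner ℂ D (Ψ (y * x) k)).re - (inner ℂ D (Ψ y g)).re = ‖D‖ ^ 2 := by
      rw [← Complex.sub_re, ← inner_sub_right, e]
    have s3 : (inner ℂ k (Ψ (star x * star y) D)).re = (inner ℂ D (Ψ (y * x) k)).re := by
      rw [← star_mul, hΨ.map_star, ContinuousLinearMap.star_eq_adjoint,
        ContinuousLinearMap.adjoint_inner_right, ← inner_conj_symm, Complex.conj_re]
    have s4 : (inner ℂ g (Ψ (star y) D)).re = (inner ℂ D (Ψ y g)).re := by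
      rw [hΨ.map_star, ContinuousLinearMap.star_eq_adjoint,
        ContinuousLinearMap.adjoint_inner_right, ← inner_conj_symm, Complex.conj_re]
    simp only [Fin.sum_univ_three, Matrix.cons_val_zero, Matrix.cons_val_one, Matrix.cons_val,
      star_one, mul_one, one_mul, h1, one_apply_eq_self, map_neg, map_smul, inner_neg_left,
      inner_neg_right, inner_smul_left, inner_smul_right, star_star, Complex.add_re,
      Complex.neg_re, Complex.conj_ofReal, Complex.re_ofReal_mul, ← hg, e, s1, s3, s4] at h ⊢
    have hk := hx k
    rw [← hg] at hk
    rw [← s2]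
    linarith
  have : D = 0 := by simpa using key
  exact sub_eq_zero.1 this

end Algebraic

variable {B : Type*} [CStarAlgebra B] [PartialOrder B] [StarOrderedRing B]
  {Ψ : B →ₗ[ℂ] (H →L[ℂ] H)}

theorem IsFormCP.norm_le (hΨ : IsFormCP Ψ) (h1 : Ψ 1 = 1) (b : B) : ‖Ψ b‖ ≤ ‖b‖ := by
  refine ContinuousLinearMap.opNorm_le_bound _ (norm_nonneg b) fun k => ?_
  have h2 := hΨ.sq_norm_apply_le h1 b k
  have h3 := IsCPForm.apply_star_mul_self_le hΨ b k
  have e : (inner ℂ k k).re = ‖k‖ ^ 2 := inner_self_eq_norm_sq (𝕜 := ℂ) _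
  simp only [h1, one_apply_eq_self, e] at h3
  rw [← pow_le_pow_iff_left₀ (norm_nonneg _) (by positivity) two_ne_zero, mul_pow]
  exact h2.trans h3

theorem IsFormCP.continuous (hΨ : IsFormCP Ψ) (h1 : Ψ 1 = 1) : Continuous Ψ :=
  AddMonoidHomClass.continuous_of_bound Ψ 1 fun b => by simpa using hΨ.norm_le h1 b

/-- A unital completely positive map is multiplicative as soon as its multiplicative domain
contains a generating set. -/
theorem IsFormCP.map_mul_of_dense [CompleteSpace H] (hΨ : IsFormCP Ψ) (h1 : Ψ 1 = 1) {s : Set B}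
    (hs : ∀ C : Subalgebra ℂ B, IsClosed (C : Set B) → s ⊆ C → C = ⊤)
    (hmul : ∀ x ∈ s, ∀ k, (inner ℂ k (Ψ (star x * x) k)).re ≤ ‖Ψ x k‖ ^ 2) (y x : B) :
    Ψ (y * x) = Ψ y * Ψ x := by
  have hc := hΨ.continuous h1
  let C : Subalgebra ℂ B :=
    { carrier := {x | ∀ y, Ψ (y * x) = Ψ y * Ψ x}
      mul_mem' := fun {a b} ha hb y => by rw [← mul_assoc, hb, ha, hb, mul_assoc]
      add_mem' := fun {a b} ha hb y => by rw [mul_add, map_add, ha, hb, map_add, mul_add]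
      algebraMap_mem' := fun c y => by
        rw [Algebra.algebraMap_eq_smul_one, mul_smul_comm, mul_one, map_smul, map_smul, h1,
          mul_smul_comm, mul_one] }
  have hC : IsClosed (C : Set B) := by
    have : (C : Set B) = ⋂ y, {x | Ψ (y * x) = Ψ y * Ψ x} := by ext x; simp [C]
    rw [this]
    exact isClosed_iInter fun y => isClosed_eq (hc.comp (continuous_const.mul continuous_id))
      (continuous_const.mul hc)
  have := hs C hC fun x hx => hΨ.map_mul_of_le h1 (hmul x hx)
  exact (this ▸ Algebra.mem_top : x ∈ C) y

end FormCP

section BoundaryTransfer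

theorem IsCPForm.comp_linearMap {B W W' : Type*} [Ring B] [StarRing B] [Algebra ℂ B]
    [AddCommGroup W] [Module ℂ W] [AddCommGroup W'] [Module ℂ W'] {G : B → W → W → ℂ}
    (hG : IsCPForm G) (L : W' →ₗ[ℂ] W) : IsCPForm fun b v w => G b (L v) (L w) where
  add a b v w := hG.add a b _ _
  smul c b v w := hG.smul c b _ _
  add_left b v v' w := by rw [map_add, hG.add_left]
  smul_left c b v w := by rw [map_smul, hG.smul_left]
  add_right b v w w' := by rw [map_add, hG.add_right]
  smul_right c b v w := by rw [map_smul, hG.smul_right]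
  pos n y w := hG.pos n y fun i => L (w i)

/-- The `2 × 2` amplification of a completely positive form along the row `(1, x)`. -/
theorem IsCPForm.amplify {B W : Type*} [Ring B] [StarRing B] [Algebra ℂ B]
    [AddCommGroup W] [Module ℂ W] {G : B → W → W → ℂ} (hG : IsCPForm G) (x : B) :
    IsCPForm fun (b : B) (p q : W × W) => G b p.1 q.1 + G (b * x) p.1 q.2
      + (G (star x * b) p.2 q.1 + G (star x * b * x) p.2 q.2) where
  add a b v w := by simp only [add_mul, mul_add, hG.add]; ring
  smul c b v w := by simp only [smul_mul_assoc, mul_smul_comm, hG.smul]; ring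
  add_left b v v' w := by simp only [Prod.fst_add, Prod.snd_add, hG.add_left]; ring
  smul_left c b v w := by simp only [Prod.smul_fst, Prod.smul_snd, hG.smul_left]; ring
  add_right b v w w' := by simp only [Prod.fst_add, Prod.snd_add, hG.add_right]; ring
  smul_right c b v w := by simp only [Prod.smul_fst, Prod.smul_snd, hG.smul_right]; ring
  pos n y w := by
    have := hG.sum_nonneg (Sum.elim y fun i => y i * x)
      (Sum.elim (fun i => (w i).1) fun i => (w i).2)
    simp only [Fintype.sum_sum_type, Sum.elim_inl, Sum.elim_inr, star_mul, mul_assoc,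
      Finset.sum_add_distrib] at this ⊢
    exact this.trans_eq (add_add_add_comm _ _ _ _)

theorem StarAlgHom.isFormCP {B H : Type*} [Ring B] [StarRing B] [Algebra ℂ B]
    [NormedAddCommGroup H] [InnerProductSpace ℂ H] [CompleteSpace H]
    (Ψ : B →⋆ₐ[ℂ] (H →L[ℂ] H)) : IsFormCP (Ψ : B →ₗ[ℂ] (H →L[ℂ] H)) := by
  refine isFormCP_of_sum_nonneg fun n y w => ?_
  have : ∑ i, ∑ j, inner ℂ (w i) (Ψ (star (y i) * y j) (w j))
      = inner ℂ (∑ i, Ψ (y i) (w i)) (∑ j, Ψ (y j) (w j)) := by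
    simp only [sum_inner, inner_sum, map_mul, map_star, ContinuousLinearMap.star_eq_adjoint,
      mul_apply_eq_comp, ContinuousLinearMap.adjoint_inner_right]
    exact Finset.sum_comm
  rw [inner_self_eq_norm_sq_to_K, ← RCLike.ofReal_pow] at this
  refine le_of_le_of_eq ?_ this.symm
  exact RCLike.ofReal_nonneg.2 (sq_nonneg _)

variable {B₁ B₂ : Type*} [CStarAlgebra B₁] [PartialOrder B₁] [StarOrderedRing B₁]
  [CStarAlgebra B₂] [PartialOrder B₂] [StarOrderedRing B₂]
  {H : Type*} [NormedAddCommGroup H] [InnerProductSpace ℂ H] [CompleteSpace H]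
  {S : Type*} [AddCommGroup S] [Module ℂ S] {j₁ : S →ₗ[ℂ] B₁} {j₂ : S →ₗ[ℂ] B₂} {u : S}

theorem IsCPForm.exists_isFormCP {G : B₁ → H → H → ℂ} (hG : IsCPForm G)
    (h1 : ∀ h k, G 1 h k = inner ℂ h k) :
    ∃ Ψ : B₁ →ₗ[ℂ] (H →L[ℂ] H),
      IsFormCP Ψ ∧ Ψ 1 = 1 ∧ ∀ b h k, inner ℂ h (Ψ b k) = G b h k := by
  obtain ⟨Ψ, hΨ, hΨ1⟩ := hG.exists_linearMap h1
  refine ⟨Ψ, ?_, hΨ1, hΨ⟩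
  have : (fun b h k => inner ℂ h (Ψ b k)) = G := by funext b h k; exact hΨ b h k
  rw [IsFormCP, this]
  exact hG

/-- A unital completely positive map on `B₁` has a unital completely positive counterpart on
`B₂` with the same values along a unital complete isometry. -/
theorem IsFormCP.exists_transfer (hu₁ : j₁ u = 1) (hu₂ : j₂ u = 1)
    (hiso : ∀ (n : ℕ) (N : Matrix (Fin n) (Fin n) S),
      ‖CStarMatrix.ofMatrix (N.map j₁)‖ = ‖CStarMatrix.ofMatrix (N.map j₂)‖)
    {Ψ₁ : B₁ →ₗ[ℂ] (H →L[ℂ] H)} (hΨ₁ : IsFormCP Ψ₁) (h1 : Ψ₁ 1 = 1) :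
    ∃ Ψ : B₂ →ₗ[ℂ] (H →L[ℂ] H), IsFormCP Ψ ∧ Ψ 1 = 1 ∧ ∀ s, Ψ (j₂ s) = Ψ₁ (j₁ s) := by
  obtain ⟨G, hG, hGj⟩ := IsCPForm.exists_transfer hu₁ hu₂ hiso hΨ₁
  obtain ⟨Ψ, hΨ, hΨ1, hΨG⟩ := hG.exists_isFormCP fun h k => by
    rw [← hu₂, hGj, hu₁, h1, one_apply_eq_self]
  refine ⟨Ψ, hΨ, hΨ1, fun s => ?_⟩
  ext k
  refine ext_inner_left ℂ fun h => ?_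
  rw [hΨG, hGj]

/-- If `Ψ₁` has the unique extension property, then every unital completely positive map on
`B₂` agreeing with `Ψ₁` along the complete isometry attains equality in the Kadison–Schwarz
inequality on the operator system. -/
theorem IsFormCP.apply_star_mul_self_le_of_unique (hu₁ : j₁ u = 1) (hu₂ : j₂ u = 1)
    (hiso : ∀ (n : ℕ) (N : Matrix (Fin n) (Fin n) S),
      ‖CStarMatrix.ofMatrix (N.map j₁)‖ = ‖CStarMatrix.ofMatrix (N.map j₂)‖)
    {Ψ₁ : B₁ →⋆ₐ[ℂ] (H →L[ℂ] H)}
    (hunique : ∀ Φ : B₁ →ₗ[ℂ] (H →L[ℂ] H), IsFormCP Φ → Φ 1 = 1 →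
      (∀ s, Φ (j₁ s) = Ψ₁ (j₁ s)) → ∀ b, Φ b = Ψ₁ b)
    {Ψ : B₂ →ₗ[ℂ] (H →L[ℂ] H)} (hΨ : IsFormCP Ψ) (h1 : Ψ 1 = 1)
    (hj : ∀ s, Ψ (j₂ s) = Ψ₁ (j₁ s)) (s : S) (k : H) :
    (inner ℂ k (Ψ (star (j₂ s) * j₂ s) k)).re ≤ ‖Ψ (j₂ s) k‖ ^ 2 := by
  obtain ⟨Γ, hΓ, hΓj⟩ := IsCPForm.exists_transfer hu₂ hu₁ (fun n N => (hiso n N).symm)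
    (IsCPForm.amplify hΨ (j₂ s))
  obtain ⟨Φ, hΦ, hΦ1, hΦΓ⟩ :=
    (hΓ.comp_linearMap (LinearMap.inl ℂ H H)).exists_isFormCP fun h k => by
      rw [← hu₁, hΓj, hu₂]
      simp [h1]
  have hΦj := hunique Φ hΦ hΦ1 fun t => by
    ext k
    refine ext_inner_left ℂ fun h => ?_
    rw [hΦΓ, hΓj, ← hj]
    simp
  have h := hΓ.two_mul_re_add_nonneg (-j₁ s) (0, k) (k, 0)
  have e1 : Γ 1 (0, k) (0, k) = inner ℂ k (Ψ (star (j₂ s) * j₂ s) k) := by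
    rw [← hu₁, hΓj, hu₂]
    simp
  have e2 : Γ (-j₁ s) (0, k) (k, 0) = -inner ℂ k (Ψ (star (j₂ s) * j₂ s) k) := by
    rw [hΓ.neg, hΓj]
    simp
  have e3 : (Γ (star (-j₁ s) * -j₁ s) (k, 0) (k, 0)).re = ‖Ψ (j₂ s) k‖ ^ 2 := by
    have := hΦΓ (star (j₁ s) * j₁ s) k k
    rw [LinearMap.inl_apply] at this
    rw [star_neg, neg_mul_neg, ← this, hΦj, map_mul, StarHomClass.map_star,
      ContinuousLinearMap.star_eq_adjoint, mul_apply_eq_comp,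
      ContinuousLinearMap.adjoint_inner_right, hj]
    exact inner_self_eq_norm_sq (𝕜 := ℂ) _
  rw [e1, e2, e3, Complex.neg_re] at h
  linarith

end BoundaryTransfer

section Seminorms

/-- A closed subalgebra of `B` containing the image of a generating operator system is
everything. -/
theorem eq_top_of_isClosed_of_image_subset {Λ A : Type*} {B : Λ → Type*} [Ring A] [StarRing A]
    [Algebra ℂ A] [StarModule ℂ A] [TopologicalSpace A] [∀ l, NormedRing (B l)]
    [∀ l, StarRing (B l)] [∀ l, NormedAlgebra ℂ (B l)] {π : ∀ l, A →⋆ₐ[ℂ] B l}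
    (hind : Topology.IsInducing fun (a : A) l => π l a) {S : Submodule ℂ A}
    (hstar : ∀ s ∈ S, star s ∈ S)
    (hgen : closure (StarAlgebra.adjoin ℂ (S : Set A) : Set A) = Set.univ) {l : Λ}
    (hsurj : Function.Surjective (π l)) (C : Subalgebra ℂ (B l)) (hC : IsClosed (C : Set (B l)))
    (hSC : π l '' S ⊆ C) : C = ⊤ := by
  have hcont : Continuous (π l) := (continuous_apply l).comp hind.continuous
  have hadj : Algebra.adjoin ℂ ((S : Set A) ∪ star (S : Set A))
      ≤ C.comap (π l : A →ₐ[ℂ] B l) := by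
    refine Algebra.adjoin_le (Set.union_subset (fun s hs => hSC ⟨s, hs, rfl⟩) fun s hs => ?_)
    exact hSC ⟨s, star_star s ▸ hstar _ hs, rfl⟩
  have huniv : Set.univ ⊆ π l ⁻¹' C :=
    hgen ▸ closure_minimal (fun a ha => hadj ha) (hC.preimage hcont)
  refine eq_top_iff.2 fun b _ => ?_
  obtain ⟨a, rfl⟩ := hsurj b
  exact huniv (Set.mem_univ a)

/-- A linear map dominated by a surjective one factors through it. -/
theorem exists_linearMap_comp_eq {A B E : Type*} [AddCommGroup A] [Module ℂ A]
    [NormedAddCommGroup B] [Module ℂ B] [NormedAddCommGroup E] [Module ℂ E] {π : A →ₗ[ℂ] B}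
    (hπ : Function.Surjective π) {χ : A →ₗ[ℂ] E} (h : ∀ a, ‖χ a‖ ≤ ‖π a‖) :
    ∃ Ψ : B →ₗ[ℂ] E, ∀ a, Ψ (π a) = χ a := by
  obtain ⟨g, hg⟩ := π.exists_rightInverse_of_surjective (LinearMap.range_eq_top.2 hπ)
  refine ⟨χ ∘ₗ g, fun a => ?_⟩
  have h0 : π (g (π a) - a) = 0 := by
    rw [map_sub, sub_eq_zero]
    exact LinearMap.congr_fun hg (π a)
  have := h (g (π a) - a)
  rw [h0, norm_zero, norm_le_zero_iff, map_sub, sub_eq_zero] at this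
  exact this

variable {A B H : Type*} [Ring A] [StarRing A] [Algebra ℂ A] [CStarAlgebra B]
  [NormedAddCommGroup H] [InnerProductSpace ℂ H] [CompleteSpace H]

theorem exists_starAlgHom_comp_eq {π : A →⋆ₐ[ℂ] B} (hπ : Function.Surjective π)
    {χ : A →⋆ₐ[ℂ] (H →L[ℂ] H)} (h : ∀ a, ‖χ a‖ ≤ ‖π a‖) :
    ∃ Ψ : B →⋆ₐ[ℂ] (H →L[ℂ] H), ∀ a, Ψ (π a) = χ a := by
  obtain ⟨Ψ, hΨ⟩ := exists_linearMap_comp_eq (π := (π : A →ₗ[ℂ] B)) hπ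
    (χ := (χ : A →ₗ[ℂ] (H →L[ℂ] H))) h
  replace hΨ : ∀ a, Ψ (π a) = χ a := hΨ
  have h1 : Ψ 1 = 1 := by rw [← map_one π, hΨ, map_one]
  have hmul : ∀ x y, Ψ (x * y) = Ψ x * Ψ y := fun x y => by
    obtain ⟨a, rfl⟩ := hπ x
    obtain ⟨b, rfl⟩ := hπ y
    rw [← map_mul, hΨ, hΨ, hΨ, map_mul]
  refine ⟨⟨AlgHom.ofLinearMap Ψ h1 hmul, fun x => ?_⟩, hΨ⟩
  obtain ⟨a, rfl⟩ := hπ x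
  change Ψ (star (π a)) = star (Ψ (π a))
  rw [← map_star, hΨ, hΨ, map_star]

theorem IsFormCP.matPosOp {R : Type*} [Ring R] [StarRing R] [Algebra ℂ R]
    {Φ : R →ₗ[ℂ] (H →L[ℂ] H)} (hΦ : IsFormCP Φ) {n : ℕ} (x : Matrix (Fin n) (Fin n) R) :
    MatPosOp ((star x * x).map Φ) := by
  set T := (star x * x).map Φ with hT
  have hTij : ∀ i j, T i j = ∑ k, Φ (star (x k i) * x k j) := fun i j => by
    simp [hT, Matrix.mul_apply, Matrix.star_apply]
  have hsa : IsSelfAdjoint (CStarMatrix.ofMatrix T) := by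
    ext1 i j
    change star (T j i) = T i j
    simp only [hTij, star_sum, ← hΦ.map_star, star_mul, star_star]
  have hpos : 0 ≤ CStarMatrix.ofMatrix T := by
    refine CStarMatrix.nonneg_of_forall hsa fun Y => ?_
    rw [ContinuousLinearMap.nonneg_iff_isPositive, ContinuousLinearMap.isPositive_iff_complex]
    intro h
    set R := ∑ i, ∑ j, star (Y i) * T i j * Y j with hR
    have hval : inner ℂ h (R h)
        = ∑ k, ∑ i, ∑ j, inner ℂ (Y i h) (Φ (star (x k i) * x k j) (Y j h)) := by
      simp only [hR, sum_apply, inner_sum, mul_apply_eq_comp,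
        ContinuousLinearMap.star_eq_adjoint, ContinuousLinearMap.adjoint_inner_right, hTij]
      exact (Finset.sum_congr rfl fun i _ => Finset.sum_comm).trans Finset.sum_comm
    have h0 : 0 ≤ inner ℂ h (R h) :=
      hval ▸ Finset.sum_nonneg fun k _ => IsCPForm.pos hΦ n (x k) fun i => Y i h
    obtain ⟨hre, him⟩ := Complex.nonneg_iff.1 h0
    change (((inner ℂ (R h) h).re : ℝ) : ℂ) = inner ℂ (R h) h ∧ 0 ≤ (inner ℂ (R h) h).re
    rw [← inner_conj_symm, Complex.conj_re]
    refine ⟨Complex.ext (by rw [Complex.conj_re, Complex.ofReal_re]) ?_, hre⟩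
    rw [Complex.conj_im, ← him, neg_zero, Complex.ofReal_im]
  obtain ⟨Z, hZ⟩ := exists_eq_star_mul_self_of_nonneg hpos
  refine ⟨CStarMatrix.ofMatrix.symm Z, ?_⟩
  ext1 i j
  have := congrArg (fun X : CStarMatrix (Fin n) (Fin n) (H →L[ℂ] H) => X i j) hZ
  simpa [CStarMatrix.mul_apply, Matrix.mul_apply, Matrix.star_apply,
    CStarMatrix.star_apply] using this

/-- A completely positive map on the quotient C*-algebra pulls back to a map that is completely
positive at the corresponding level. -/
theorem IsFormCP.isLamCPmap_comp {p : A → ℝ} {pn : ∀ n : ℕ, Matrix (Fin n) (Fin n) A → ℝ}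
    (hpn : IsMatrixCstarSeminormFamily p pn) {π : A →⋆ₐ[ℂ] B} (hnorm : ∀ a, ‖π a‖ = p a)
    {Φ : B →ₗ[ℂ] (H →L[ℂ] H)} (hΦ : IsFormCP Φ) :
    IsLamCPmap pn (Φ ∘ₗ (π : A →ₗ[ℂ] B)) := by
  have hker : ∀ n (M : Matrix (Fin n) (Fin n) A), pn n M = 0 → ∀ i j, π (M i j) = 0 :=
    fun n M hM i j => norm_eq_zero.1 ((hnorm _).trans ((hpn.ker n M).1 hM i j))
  refine ⟨?_, fun n M hM => ?_⟩
  · rintro n _ ⟨x, c, hc, rfl⟩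
    convert hΦ.matPosOp (x.map π) using 1
    ext1 i j
    simp [Matrix.mul_apply, Matrix.star_apply, hker n c hc i j, StarHomClass.map_star]
  · ext1 i j
    simp [hker n M hM i j]

/-- A map that is completely positive at some level and factors through `π` induces a
completely positive map on the range of `π`. -/
theorem IsLamCPmap.isFormCP {p : A → ℝ} {pn : ∀ n : ℕ, Matrix (Fin n) (Fin n) A → ℝ}
    (hpn : IsMatrixCstarSeminormFamily p pn) {π : A →⋆ₐ[ℂ] B} (hπ : Function.Surjective π)
    {χ : A →ₗ[ℂ] (H →L[ℂ] H)} (hχ : IsLamCPmap pn χ) {Ψ : B →ₗ[ℂ] (H →L[ℂ] H)}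
    (hΨ : ∀ a, Ψ (π a) = χ a) : IsFormCP Ψ := by
  refine isFormCP_of_sum_nonneg fun n y w => ?_
  rcases Nat.eq_zero_or_pos n with rfl | hn
  · simp
  choose a ha using fun i => hπ (y i)
  let k₀ : Fin n := ⟨0, hn⟩
  let x : Matrix (Fin n) (Fin n) A :=
    Matrix.of fun k j => if k = k₀ then a j else 0
  have hx : ∀ i j, (star x * x) i j = star (a i) * a j := fun i j => by
    rw [Matrix.mul_apply, Finset.sum_eq_single k₀] <;> simp +contextual [x, Matrix.star_apply]
  obtain ⟨X, hX⟩ := hχ.1 n (star x * x) ⟨x, 0, (hpn.cstar n).map_zero', (add_zero _).symm⟩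
  have hij : ∀ i j, Ψ (star (y i) * y j) = ∑ k, star (X k i) * X k j := fun i j => by
    rw [← ha, ← ha, ← map_star, ← map_mul, hΨ, ← hx]
    exact (congrFun (congrFun hX i) j).trans (by simp [Matrix.mul_apply, Matrix.star_apply])
  have hval : ∑ i, ∑ j, inner ℂ (w i) (Ψ (star (y i) * y j) (w j))
      = ∑ k, inner ℂ (∑ i, X k i (w i)) (∑ j, X k j (w j)) := by
    simp only [hij, sum_apply, sum_inner, inner_sum, mul_apply_eq_comp,
      ContinuousLinearMap.star_eq_adjoint, ContinuousLinearMap.adjoint_inner_right]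
    exact (Finset.sum_congr rfl fun i _ => Finset.sum_comm).trans
      (Finset.sum_comm.trans (Finset.sum_congr rfl fun k _ => Finset.sum_comm))
  rw [hval]
  refine Finset.sum_nonneg fun k _ => ?_
  rw [inner_self_eq_norm_sq_to_K, ← RCLike.ofReal_pow]
  exact RCLike.ofReal_nonneg.2 (sq_nonneg _)

end Seminorms

section LevelTransfer

variable {H : Type*} [NormedAddCommGroup H] [InnerProductSpace ℂ H] [CompleteSpace H]

/-- A representation of `B₁` with the unique extension property relative to `j₁` transfers to
`B₂` along a unital complete isometry. -/
theorem exists_starAlgHom_transfer {B₁ B₂ : Type*} [CStarAlgebra B₁] [PartialOrder B₁]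
    [StarOrderedRing B₁] [CStarAlgebra B₂] [PartialOrder B₂] [StarOrderedRing B₂]
    {S : Type*} [AddCommGroup S] [Module ℂ S] {j₁ : S →ₗ[ℂ] B₁} {j₂ : S →ₗ[ℂ] B₂} {u : S}
    (hu₁ : j₁ u = 1) (hu₂ : j₂ u = 1)
    (hiso : ∀ (n : ℕ) (N : Matrix (Fin n) (Fin n) S),
      ‖CStarMatrix.ofMatrix (N.map j₁)‖ = ‖CStarMatrix.ofMatrix (N.map j₂)‖)
    (hdense : ∀ C : Subalgebra ℂ B₂, IsClosed (C : Set B₂) → Set.range j₂ ⊆ C → C = ⊤)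
    {Ψ₁ : B₁ →⋆ₐ[ℂ] (H →L[ℂ] H)}
    (hunique : ∀ Φ : B₁ →ₗ[ℂ] (H →L[ℂ] H), IsFormCP Φ → Φ 1 = 1 →
      (∀ s, Φ (j₁ s) = Ψ₁ (j₁ s)) → ∀ b, Φ b = Ψ₁ b) :
    ∃ Ψ₂ : B₂ →⋆ₐ[ℂ] (H →L[ℂ] H), (∀ s, Ψ₂ (j₂ s) = Ψ₁ (j₁ s)) ∧
      ∀ Ψ : B₂ →ₗ[ℂ] (H →L[ℂ] H), IsFormCP Ψ → Ψ 1 = 1 →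
        (∀ s, Ψ (j₂ s) = Ψ₁ (j₁ s)) → ∀ b, Ψ b = Ψ₂ b := by
  have hmul : ∀ Ψ : B₂ →ₗ[ℂ] (H →L[ℂ] H), IsFormCP Ψ → Ψ 1 = 1 →
      (∀ s, Ψ (j₂ s) = Ψ₁ (j₁ s)) → ∀ y x, Ψ (y * x) = Ψ y * Ψ x := fun Ψ hΨ h1 hj =>
    hΨ.map_mul_of_dense h1 hdense fun x hx k => by
      obtain ⟨s, rfl⟩ := hx
      exact IsFormCP.apply_star_mul_self_le_of_unique hu₁ hu₂ hiso hunique hΨ h1 hj s k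
  obtain ⟨Ψ, hΨ, h1, hj⟩ := IsFormCP.exists_transfer hu₁ hu₂ hiso Ψ₁.isFormCP (map_one Ψ₁)
  replace hj : ∀ s, Ψ (j₂ s) = Ψ₁ (j₁ s) := hj
  refine ⟨⟨AlgHom.ofLinearMap Ψ h1 (hmul Ψ hΨ h1 hj), hΨ.map_star⟩, hj,
    fun Ψ' hΨ' h1' hj' b => ?_⟩
  let C : Subalgebra ℂ B₂ := AlgHom.equalizer (AlgHom.ofLinearMap Ψ' h1' (hmul Ψ' hΨ' h1' hj'))
    (AlgHom.ofLinearMap Ψ h1 (hmul Ψ hΨ h1 hj))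
  have hC : IsClosed (C : Set B₂) := isClosed_eq (hΨ'.continuous h1') (hΨ.continuous h1)
  have hCtop : C = ⊤ := hdense C hC <| by
    rintro _ ⟨s, rfl⟩
    exact (hj' s).trans (hj s).symm
  exact (hCtop ▸ Algebra.mem_top : b ∈ C)

/-- Irreducibility only depends on the restriction to a generating set. -/
theorem HasTrivialCommutant.of_commute {B R : Type*} [CStarAlgebra B] [PartialOrder B]
    [StarOrderedRing B] {Ψ : B →⋆ₐ[ℂ] (H →L[ℂ] H)} {s : Set B}
    (hdense : ∀ C : Subalgebra ℂ B, IsClosed (C : Set B) → s ⊆ C → C = ⊤)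
    (hΨ : HasTrivialCommutant Ψ) {ψ : R → (H →L[ℂ] H)} (h : ∀ x ∈ s, ∃ a, ψ a = Ψ x) :
    HasTrivialCommutant ψ := by
  intro T hT
  refine hΨ T fun b => ?_
  have hc : Continuous Ψ := Ψ.isFormCP.continuous (map_one Ψ)
  let C : Subalgebra ℂ B := (Subalgebra.centralizer ℂ {T}).comap (Ψ : B →ₐ[ℂ] (H →L[ℂ] H))
  have hmem : ∀ x, x ∈ C ↔ T * Ψ x = Ψ x * T := fun x => by
    simp [C, Subalgebra.mem_centralizer_iff]
  have hC : IsClosed (C : Set B) := by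
    have : (C : Set B) = {x | T * Ψ x = Ψ x * T} := Set.ext hmem
    rw [this]
    exact isClosed_eq (continuous_const.mul hc) (hc.mul continuous_const)
  have hCtop : C = ⊤ := hdense C hC fun x hx => by
    obtain ⟨a, ha⟩ := h x hx
    exact (hmem x).2 (ha ▸ hT a)
  exact (hmem b).1 (hCtop ▸ Algebra.mem_top)

/-- The single-level form of the transfer of boundary representations. -/
theorem exists_transfer_of_level {A₁ A₂ B₁ B₂ : Type*} [Ring A₁] [StarRing A₁] [Algebra ℂ A₁]
    [Ring A₂] [StarRing A₂] [Algebra ℂ A₂] [CStarAlgebra B₁] [CStarAlgebra B₂]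
    {p₁ : A₁ → ℝ} {p₂ : A₂ → ℝ} {π₁ : A₁ →⋆ₐ[ℂ] B₁} {π₂ : A₂ →⋆ₐ[ℂ] B₂}
    (hsurj₁ : Function.Surjective π₁) (hnorm₁ : ∀ a, ‖π₁ a‖ = p₁ a)
    (hsurj₂ : Function.Surjective π₂) (hnorm₂ : ∀ a, ‖π₂ a‖ = p₂ a)
    {pn₁ : ∀ n : ℕ, Matrix (Fin n) (Fin n) A₁ → ℝ} (hpn₁ : IsMatrixCstarSeminormFamily p₁ pn₁)
    {pn₂ : ∀ n : ℕ, Matrix (Fin n) (Fin n) A₂ → ℝ} (hpn₂ : IsMatrixCstarSeminormFamily p₂ pn₂)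
    {S₁ : Submodule ℂ A₁} (hS₁one : (1 : A₁) ∈ S₁) {S₂ : Submodule ℂ A₂}
    (hdense₁ : ∀ C : Subalgebra ℂ B₁, IsClosed (C : Set B₁) → π₁ '' S₁ ⊆ C → C = ⊤)
    (hdense₂ : ∀ C : Subalgebra ℂ B₂, IsClosed (C : Set B₂) → π₂ '' S₂ ⊆ C → C = ⊤)
    {φ : ↥S₁ →ₗ[ℂ] ↥S₂} (hφsurj : Function.Surjective φ)
    (hφ1 : ((φ ⟨1, hS₁one⟩ : ↥S₂) : A₂) = 1)
    (hφ : ∀ (n : ℕ) (M : Matrix (Fin n) (Fin n) ↥S₁),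
      pn₂ n (M.map fun s => ((φ s : ↥S₂) : A₂)) = pn₁ n (M.map Subtype.val))
    {ρ₁ : A₁ →⋆ₐ[ℂ] (H →L[ℂ] H)} (hirr : HasTrivialCommutant ρ₁) (hbound : ∀ a, ‖ρ₁ a‖ ≤ p₁ a)
    (hunique : ∀ χ : A₁ →ₗ[ℂ] (H →L[ℂ] H), χ 1 = 1 → IsLamCPmap pn₁ χ →
      (∀ a, ‖χ a‖ ≤ p₁ a) → (∀ s ∈ S₁, χ s = ρ₁ s) → ∀ a, χ a = ρ₁ a) :
    ∃ ρ₂ : A₂ →⋆ₐ[ℂ] (H →L[ℂ] H), HasTrivialCommutant ρ₂ ∧ (∀ a, ‖ρ₂ a‖ ≤ p₂ a) ∧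
      (∀ Ψ : B₂ →ₗ[ℂ] (H →L[ℂ] H), IsFormCP Ψ → Ψ 1 = 1 → (∀ s ∈ S₂, Ψ (π₂ s) = ρ₂ s) →
        ∀ a, Ψ (π₂ a) = ρ₂ a) ∧
      ∀ s : ↥S₁, ρ₂ ((φ s : ↥S₂) : A₂) = ρ₁ (s : A₁) := by
  let _ := CStarAlgebra.spectralOrder B₁
  have := CStarAlgebra.spectralOrderedRing B₁
  let _ := CStarAlgebra.spectralOrder B₂
  have := CStarAlgebra.spectralOrderedRing B₂
  let j₁ : ↥S₁ →ₗ[ℂ] B₁ := (π₁ : A₁ →ₗ[ℂ] B₁) ∘ₗ S₁.subtype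
  let j₂ : ↥S₁ →ₗ[ℂ] B₂ := (π₂ : A₂ →ₗ[ℂ] B₂) ∘ₗ S₂.subtype ∘ₗ φ
  have hj₁ : ∀ s, j₁ s = π₁ s := fun s => rfl
  have hj₂ : ∀ s, j₂ s = π₂ (φ s) := fun s => rfl
  have hu₁ : j₁ ⟨1, hS₁one⟩ = 1 := map_one π₁
  have hu₂ : j₂ ⟨1, hS₁one⟩ = 1 := by rw [hj₂, hφ1, map_one]
  have hiso : ∀ (n : ℕ) (N : Matrix (Fin n) (Fin n) ↥S₁),
      ‖CStarMatrix.ofMatrix (N.map j₁)‖ = ‖CStarMatrix.ofMatrix (N.map j₂)‖ := fun n N => by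
    have := hφ n N
    rw [hpn₁.eq_norm hsurj₁ hnorm₁, hpn₂.eq_norm hsurj₂ hnorm₂] at this
    exact this.symm
  have hrange₂ : Set.range j₂ = π₂ '' S₂ := by
    ext b
    constructor
    · rintro ⟨s, rfl⟩
      exact ⟨_, (φ s).2, rfl⟩
    · rintro ⟨a, ha, rfl⟩
      obtain ⟨s, hs⟩ := hφsurj ⟨a, ha⟩
      exact ⟨s, by rw [hj₂, hs]⟩
  obtain ⟨Ψ₁, hΨ₁⟩ := exists_starAlgHom_comp_eq hsurj₁ (χ := ρ₁) fun a =>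
    (hbound a).trans (hnorm₁ a).ge
  have hΨ₁u : ∀ Φ : B₁ →ₗ[ℂ] (H →L[ℂ] H), IsFormCP Φ → Φ 1 = 1 →
      (∀ s, Φ (j₁ s) = Ψ₁ (j₁ s)) → ∀ b, Φ b = Ψ₁ b := fun Φ hΦ h1 hj b => by
    obtain ⟨a, rfl⟩ := hsurj₁ b
    rw [hΨ₁]
    refine hunique (Φ ∘ₗ (π₁ : A₁ →ₗ[ℂ] B₁)) ?_ (hΦ.isLamCPmap_comp hpn₁ hnorm₁)
      (fun a => (hΦ.norm_le h1 (π₁ a)).trans (hnorm₁ a).le)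
      (fun s hs => (hj ⟨s, hs⟩).trans (hΨ₁ s)) a
    exact (congrArg Φ (map_one π₁)).trans h1
  obtain ⟨Ψ₂, hΨ₂, hΨ₂u⟩ := exists_starAlgHom_transfer hu₁ hu₂ hiso (hrange₂ ▸ hdense₂) hΨ₁u
  have hρ : ∀ s : ↥S₁, (Ψ₂.comp π₂) ((φ s : ↥S₂) : A₂) = ρ₁ (s : A₁) := fun s =>
    (hΨ₂ s).trans (hΨ₁ s)
  refine ⟨Ψ₂.comp π₂, ?_, fun a => ?_, fun Ψ hΨ h1 hj a => ?_, hρ⟩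
  · refine HasTrivialCommutant.of_commute (Ψ := Ψ₁) hdense₁ (fun T hT => hirr T fun a => ?_) ?_
    · rw [← hΨ₁]
      exact hT _
    · rintro _ ⟨s, hs, rfl⟩
      exact ⟨φ ⟨s, hs⟩, (hρ ⟨s, hs⟩).trans (hΨ₁ s).symm⟩
  · exact (Ψ₂.isFormCP.norm_le (map_one Ψ₂) (π₂ a)).trans (hnorm₂ a).le
  · exact hΨ₂u Ψ hΨ h1 (fun s => (hj _ (φ s).2).trans (hΨ₂ s)) (π₂ a)

end LevelTransfer

/-- along a surjective unital local completely isometric map `φ : S₁ → S₂`,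
every admissible local boundary representation for `S₁` is carried to one for `S₂`. -/
theorem stmt15 {Λ : Type*} [Preorder Λ] {A₁ : Type*} [Ring A₁] [StarRing A₁] [Algebra ℂ A₁] [StarModule ℂ A₁]
    {A₂ : Type*} [Ring A₂] [StarRing A₂] [Algebra ℂ A₂] [StarModule ℂ A₂]
    {B₁ : Λ → Type*} [∀ l, NormedRing (B₁ l)] [∀ l, StarRing (B₁ l)] [∀ l, CStarRing (B₁ l)]
    [∀ l, NormedAlgebra ℂ (B₁ l)] [∀ l, StarModule ℂ (B₁ l)] [∀ l, CompleteSpace (B₁ l)]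
    {B₂ : Λ → Type*} [∀ l, NormedRing (B₂ l)] [∀ l, StarRing (B₂ l)] [∀ l, CStarRing (B₂ l)]
    [∀ l, NormedAlgebra ℂ (B₂ l)] [∀ l, StarModule ℂ (B₂ l)] [∀ l, CompleteSpace (B₂ l)]
    (p₁ : Λ → A₁ → ℝ) (hp₁ : ∀ l, IsCstarSeminorm (p₁ l))
    (hmono₁ : ∀ ⦃l₁ l₂ : Λ⦄, l₁ ≤ l₂ → ∀ a, p₁ l₁ a ≤ p₁ l₂ a)
    (p₂ : Λ → A₂ → ℝ) (hp₂ : ∀ l, IsCstarSeminorm (p₂ l))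
    (hmono₂ : ∀ ⦃l₁ l₂ : Λ⦄, l₁ ≤ l₂ → ∀ a, p₂ l₁ a ≤ p₂ l₂ a)
    (π₁ : ∀ l, A₁ →⋆ₐ[ℂ] B₁ l) (hsurj₁ : ∀ l, Function.Surjective ⇑(π₁ l))
    (hnorm₁ : ∀ l a, ‖(π₁ l) a‖ = p₁ l a)
    (π₂ : ∀ l, A₂ →⋆ₐ[ℂ] B₂ l) (hsurj₂ : ∀ l, Function.Surjective ⇑(π₂ l))
    (hnorm₂ : ∀ l a, ‖(π₂ l) a‖ = p₂ l a)
    (pn₁ : Λ → ∀ n : ℕ, Matrix (Fin n) (Fin n) A₁ → ℝ)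
    (hpn₁ : ∀ l, IsMatrixCstarSeminormFamily (p₁ l) (pn₁ l))
    (pn₂ : Λ → ∀ n : ℕ, Matrix (Fin n) (Fin n) A₂ → ℝ)
    (hpn₂ : ∀ l, IsMatrixCstarSeminormFamily (p₂ l) (pn₂ l))
    (S₁ : Submodule ℂ A₁) (hS₁star : ∀ s ∈ S₁, star s ∈ S₁) (hS₁one : (1 : A₁) ∈ S₁)
    (S₂ : Submodule ℂ A₂) (hS₂star : ∀ s ∈ S₂, star s ∈ S₂) (hS₂one : (1 : A₂) ∈ S₂)
    [TopologicalSpace A₁] (hind₁ : Topology.IsInducing (fun a : A₁ => fun l => (π₁ l) a))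
    [TopologicalSpace A₂] (hind₂ : Topology.IsInducing (fun a : A₂ => fun l => (π₂ l) a))
    (hgen₁ : closure ((StarAlgebra.adjoin ℂ (S₁ : Set A₁) : StarSubalgebra ℂ A₁) : Set A₁)
      = Set.univ)
    (hgen₂ : closure ((StarAlgebra.adjoin ℂ (S₂ : Set A₂) : StarSubalgebra ℂ A₂) : Set A₂)
      = Set.univ)
    {H : Type*} [NormedAddCommGroup H] [InnerProductSpace ℂ H] [CompleteSpace H]
    (φ : ↥S₁ →ₗ[ℂ] ↥S₂) (hφsurj : Function.Surjective ⇑φ)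
    (hφ1 : ((φ ⟨1, hS₁one⟩ : ↥S₂) : A₂) = 1)
    (hφ : IsLocCompIsometric pn₁ pn₂ S₁ S₂ φ)
    (π₁rep : A₁ →⋆ₐ[ℂ] (H →L[ℂ] H)) (h₁ : IsAdmLocBdryRep p₁ pn₁ S₁ π₁rep) :
    ∃ π₂rep : A₂ →⋆ₐ[ℂ] (H →L[ℂ] H),
      IsAdmLocBdryRep p₂ pn₂ S₂ π₂rep ∧
      ∀ s : ↥S₁, π₂rep ((φ s : ↥S₂) : A₂) = π₁rep (s : A₁) := by
  obtain ⟨hirr, l₀, hbound, huep⟩ := h₁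
  let _ : CStarAlgebra (B₁ l₀) := {}
  let _ : CStarAlgebra (B₂ l₀) := {}
  obtain ⟨ρ₂, hirr₂, hbound₂, hunique₂, hρ⟩ := exists_transfer_of_level (hsurj₁ l₀) (hnorm₁ l₀)
    (hsurj₂ l₀) (hnorm₂ l₀) (hpn₁ l₀) (hpn₂ l₀) hS₁one
    (eq_top_of_isClosed_of_image_subset hind₁ hS₁star hgen₁ (hsurj₁ l₀))
    (eq_top_of_isClosed_of_image_subset hind₂ hS₂star hgen₂ (hsurj₂ l₀)) hφsurj hφ1 (hφ l₀)
    hirr hbound fun χ h1 hχ => huep χ h1 ⟨l₀, hχ⟩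
  refine ⟨ρ₂, ⟨hirr₂, l₀, hbound₂, fun χ h1 ⟨l, hχ⟩ hb hj a => ?_⟩, hρ⟩
  obtain ⟨Ψ, hΨ⟩ := exists_linearMap_comp_eq (π := (π₂ l₀ : A₂ →ₗ[ℂ] B₂ l₀)) (hsurj₂ l₀)
    fun a => (hb a).trans (hnorm₂ l₀ a).ge
  replace hΨ : ∀ a, Ψ (π₂ l₀ a) = χ a := hΨ
  rw [← hΨ]
  refine hunique₂ Ψ (hχ.isFormCP (hpn₂ l) (hsurj₂ l₀) hΨ) ?_
    (fun s hs => (hΨ s).trans (hj s hs)) a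
  rw [← map_one (π₂ l₀), hΨ, h1]
end

section
/- Let A be a unital separable locally C*-algebra and S ⊆ A a local operator system with C*(S) = A. Then J = ⋂_{π ∈ Ch(S)} ker π, the intersection of the kernels of all admissible local boundary representations for S, is a local boundary ideal for S: the quotient map σ : A → A/J satisfies p̂_λⁿ([s_ij + J]) = p_λⁿ([s_ij]) for all [s_ij] ∈ M_n(S), all n ≥ 1, and all λ ∈ Λ. -/
open scoped ComplexOrder

theorem IsCompact.exists_mem_extremePoints_lexMax {E : Type*} [AddCommGroup E] [Module ℝ E]
    [TopologicalSpace E] [T2Space E] [IsTopologicalAddGroup E] [ContinuousSMul ℝ E]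
    [LocallyConvexSpace ℝ E] {K : Set E} (hK : IsCompact K) (hne : K.Nonempty)
    (h : ℕ → E →L[ℝ] ℝ) :
    ∃ f ∈ K.extremePoints ℝ, ∀ j, ∀ g ∈ K, (∀ i < j, h i g = h i f) → h j g ≤ h j f := by
  let F : ℕ → Set E := fun n => Nat.rec K (fun j T => {f ∈ T | ∀ g ∈ T, h j g ≤ h j f}) n
  have hF0 : F 0 = K := rfl
  have hFs : ∀ j, F (j + 1) = {f ∈ F j | ∀ g ∈ F j, h j g ≤ h j f} := fun j => rfl
  have hFc : ∀ j, IsCompact (F j) ∧ (F j).Nonempty := by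
    intro j
    induction j with
    | zero => exact ⟨hK, hne⟩
    | succ j ih =>
      obtain ⟨hc, hn⟩ := ih
      refine ⟨?_, ?_⟩
      · have : F (j + 1) = F j ∩ ⋂ g ∈ F j, {f | h j g ≤ h j f} := by
          rw [hFs]; ext f; simp
        rw [this]
        exact hc.inter_right (isClosed_biInter fun g _ =>
          isClosed_le continuous_const (h j).continuous)
      · obtain ⟨f, hf, hmax⟩ := hc.exists_isMaxOn hn (h j).continuous.continuousOn
        exact ⟨f, hf, fun g hg => hmax hg⟩
  have hFanti : ∀ j, F (j + 1) ⊆ F j := fun j f hf => hf.1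
  have hFK : ∀ j, F j ⊆ K := by
    intro j
    induction j with
    | zero => exact subset_rfl
    | succ j ih => exact (hFanti j).trans ih
  have hFext : ∀ j, IsExtreme ℝ K (F j) := by
    intro j
    induction j with
    | zero => exact IsExtreme.refl ℝ K
    | succ j ih =>
      refine ih.trans ⟨hFanti j, ?_⟩
      rintro x hx y hy z hz ⟨a, b, ha, hb, hab, rfl⟩
      refine ⟨hx, fun g hg => ?_⟩
      have h1 := hz.2 x hx
      have h2 := hz.2 y hy
      have h3 := hz.2 g hg
      simp only [map_add, map_smul, smul_eq_mul] at h1 h2 h3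
      obtain rfl : a = 1 - b := by linarith
      have : h j y ≤ h j x := by
        by_contra! hlt
        nlinarith [mul_pos ha (sub_pos.2 hlt)]
      nlinarith [mul_nonneg hb.le (sub_nonneg.2 this)]
  have hL : (⋂ j, F j).Nonempty :=
    IsCompact.nonempty_iInter_of_sequence_nonempty_isCompact_isClosed F hFanti
      (fun j => (hFc j).2) (hFc 0).1 (fun j => (hFc j).1.isClosed)
  have hLc : IsCompact (⋂ j, F j) :=
    (hFc 0).1.of_isClosed_subset (isClosed_iInter fun j => (hFc j).1.isClosed)
      (Set.iInter_subset _ 0)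
  obtain ⟨f, hf⟩ := hLc.extremePoints_nonempty hL
  refine ⟨f, (isExtreme_iInter hFext).extremePoints_subset_extremePoints hf, ?_⟩
  have hfL : ∀ j, f ∈ F j := Set.mem_iInter.1 hf.1
  intro j g hg hij
  have key : ∀ i ≤ j, g ∈ F i := by
    intro i
    induction i with
    | zero => exact fun _ => hg
    | succ i ih =>
      intro hi
      refine ⟨ih (by omega), fun g' hg' => ?_⟩
      rw [hij i (by omega)]
      exact (hfL (i + 1)).2 g' hg'
  exact (hfL (j + 1)).2 g (key j le_rfl)

/-- The states of a C⋆-algebra, as a subset of the product space `D → ℂ`. -/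
def stateSet (D : Type*) [CStarAlgebra D] : Set (D → ℂ) :=
  {f | (∀ a b, f (a + b) = f a + f b) ∧ (∀ (c : ℂ) a, f (c • a) = c * f a) ∧ f 1 = 1 ∧
    (∀ a, 0 ≤ f (star a * a)) ∧ ∀ a, ‖f a‖ ≤ ‖a‖}

theorem isCompact_stateSet (D : Type*) [CStarAlgebra D] : IsCompact (stateSet D) := by
  have hc : IsCompact (Set.pi Set.univ fun a : D => Metric.closedBall (0 : ℂ) ‖a‖) :=
    isCompact_univ_pi fun a => isCompact_closedBall _ _
  refine hc.of_isClosed_subset ?_ fun f hf a _ => by simpa using hf.2.2.2.2 a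
  have : stateSet D = (⋂ a, ⋂ b, {f : D → ℂ | f (a + b) = f a + f b}) ∩
      ((⋂ c : ℂ, ⋂ a, {f : D → ℂ | f (c • a) = c * f a}) ∩ ({f : D → ℂ | f 1 = 1} ∩
      ((⋂ a, {f : D → ℂ | 0 ≤ f (star a * a)}) ∩ ⋂ a, {f : D → ℂ | ‖f a‖ ≤ ‖a‖}))) := by
    ext f; simp [stateSet]
  rw [this]
  refine IsClosed.inter (isClosed_iInter fun a => isClosed_iInter fun b =>
    isClosed_eq (by fun_prop) (by fun_prop)) (IsClosed.inter (isClosed_iInter fun c =>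
    isClosed_iInter fun a => isClosed_eq (by fun_prop) (by fun_prop)) (IsClosed.inter
    (isClosed_eq (by fun_prop) (by fun_prop)) (IsClosed.inter (isClosed_iInter fun a =>
    isClosed_le (by fun_prop) (by fun_prop)) (isClosed_iInter fun a =>
    isClosed_le (by fun_prop) (by fun_prop)))))

theorem norm_apply_le_of_positive {D : Type*} [CStarAlgebra D] (f : D →ₗ[ℂ] ℂ)
    (hf : ∀ a, 0 ≤ f (star a * a)) (a : D) : ‖f a‖ ≤ (f 1).re * ‖a‖ := by
  let := CStarAlgebra.spectralOrder D
  have := CStarAlgebra.spectralOrderedRing D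
  let F : D →ₚ[ℂ] ℂ := PositiveLinearMap.mk₀ f fun b hb => by
    obtain ⟨c, rfl⟩ := CStarAlgebra.nonneg_iff_eq_star_mul_self.1 hb
    exact hf c
  have hF : ∀ b, F b = f b := fun b => rfl
  have h1 : 0 ≤ (f 1).re := by simpa using (Complex.nonneg_iff.1 (hf 1)).1
  have hn : ∀ b : D, ‖F.toPreGNS b‖ ^ 2 ≤ (f 1).re * ‖b‖ ^ 2 := by
    intro b
    have e := F.preGNS_norm_sq (F.toPreGNS b)
    rw [F.ofPreGNS_toPreGNS] at e
    have : star b * b ≤ algebraMap ℝ D (‖b‖ ^ 2) := by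
      rw [sq, ← CStarRing.norm_star_mul_self (x := b)]
      exact IsSelfAdjoint.le_algebraMap_norm_self (.star_mul_self b)
    have h2 := OrderHomClass.mono F this
    rw [← e, Algebra.algebraMap_eq_smul_one, ← Complex.coe_smul, map_smul, hF] at h2
    have h3 := (Complex.le_def.1 h2).1
    rw [← Complex.ofReal_pow, Complex.ofReal_re] at h3
    simpa [mul_comm, ← Complex.ofReal_pow] using h3
  have h4 := norm_inner_le_norm (𝕜 := ℂ) (F.toPreGNS 1) (F.toPreGNS a)
  rw [F.preGNS_inner_def] at h4
  simp only [F.ofPreGNS_toPreGNS, star_one, one_mul, hF] at h4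
  refine abs_le_of_sq_le_sq' ?_ (by positivity) |>.2
  have h5 := hn 1
  have h6 := hn a
  have h7 : ‖(1 : D)‖ ^ 2 ≤ 1 := by
    rcases subsingleton_or_nontrivial D with hD | hD
    · simp [Subsingleton.elim (1 : D) 0]
    · simp
  calc ‖f a‖ ^ 2 ≤ (‖F.toPreGNS 1‖ * ‖F.toPreGNS a‖) ^ 2 := by gcongr
    _ = ‖F.toPreGNS 1‖ ^ 2 * ‖F.toPreGNS a‖ ^ 2 := by ring
    _ ≤ ((f 1).re * 1) * ((f 1).re * ‖a‖ ^ 2) := by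
        gcongr
        exact h5.trans (by gcongr)
    _ = _ := by ring

theorem nonneg_apply_star_mul_self_of_norm_le {D : Type*} [CStarAlgebra D] (f : D →ₗ[ℂ] ℂ)
    (h1 : f 1 = 1) (hf : ∀ a, ‖f a‖ ≤ ‖a‖) (a : D) : 0 ≤ f (star a * a) := by
  let := CStarAlgebra.spectralOrder D
  have := CStarAlgebra.spectralOrderedRing D
  have hnt : Nontrivial D := by
    by_contra h
    rw [not_nontrivial_iff_subsingleton] at h
    rw [Subsingleton.elim (1 : D) 0, map_zero] at h1
    exact zero_ne_one h1
  have hreal : ∀ h : D, IsSelfAdjoint h → (f h).im = 0 := by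
    intro h hh
    by_contra hne
    have key : ∀ t : ℝ, ((f h).im + t) ^ 2 ≤ ‖h‖ ^ 2 + t ^ 2 := by
      intro t
      have e1 : ‖f (h + (Complex.I * t) • 1)‖ ^ 2 ≤ ‖h + (Complex.I * t) • (1 : D)‖ ^ 2 := by
        gcongr; exact hf _
      have e2 : ‖h + (Complex.I * t) • (1 : D)‖ ^ 2 ≤ ‖h‖ ^ 2 + t ^ 2 := by
        rw [sq, ← CStarRing.norm_star_mul_self]
        have : star (h + (Complex.I * t) • (1 : D)) * (h + (Complex.I * t) • (1 : D))
            = h * h + ((t : ℂ) ^ 2) • (1 : D) := by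
          simp only [star_add, star_smul, star_one, hh.star_eq, add_mul, mul_add, smul_mul_assoc,
            mul_smul_comm, one_mul, mul_one]
          simp only [star_mul', Complex.star_def, Complex.conj_I, Complex.conj_ofReal, neg_mul,
            neg_smul]
          have : Complex.I * (t : ℂ) * (Complex.I * t) = - (t : ℂ) ^ 2 := by
            ring_nf; simp
          rw [smul_add, smul_neg, smul_smul, this, neg_smul, neg_neg]
          abel
        rw [this]
        refine (norm_add_le _ _).trans ?_
        have h3 := norm_mul_le h h
        rw [norm_smul]
        simp
        nlinarith
      have e3 : ((f h).im + t) ^ 2 ≤ ‖f (h + (Complex.I * t) • 1)‖ ^ 2 := by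
        have := Complex.abs_im_le_norm (f (h + (Complex.I * t) • 1))
        rw [← sq_abs]
        have e : (f (h + (Complex.I * t) • 1)).im = (f h).im + t := by
          simp [h1]
        rw [e] at this
        gcongr
      linarith
    have := key ((‖h‖ ^ 2 + 1) / (2 * (f h).im))
    have h5 : 2 * (f h).im * ((‖h‖ ^ 2 + 1) / (2 * (f h).im)) = ‖h‖ ^ 2 + 1 := by
      field_simp
    nlinarith [sq_nonneg (f h).im]
  rcases eq_or_ne (‖star a * a‖) 0 with h0 | h0
  · rw [norm_eq_zero.1 h0, map_zero]
  have hr : ‖‖star a * a‖ • (1 : D) - star a * a‖ ≤ ‖star a * a‖ := by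
    refine CStarAlgebra.norm_le_norm_of_nonneg_of_le ?_ ?_ |>.trans (b := ‖‖star a * a‖ • (1 : D)‖) ?_
    · rw [sub_nonneg, ← Algebra.algebraMap_eq_smul_one]
      exact IsSelfAdjoint.le_algebraMap_norm_self (.star_mul_self a)
    · exact sub_le_self _ (star_mul_self_nonneg a)
    · simp [norm_smul]
  have h2 := (Complex.re_le_norm _).trans ((hf _).trans hr)
  rw [map_sub, ← Complex.coe_smul, map_smul, h1] at h2
  rw [Complex.nonneg_iff]
  refine ⟨?_, (hreal _ (.star_mul_self a)).symm⟩
  simp at h2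
  simpa using h2

theorem exists_mem_stateSet_apply_eq_norm {D : Type*} [CStarAlgebra D] [Nontrivial D] (a : D) :
    ∃ f ∈ stateSet D, f (star a * a) = ‖a‖ ^ 2 := by
  let := CStarAlgebra.spectralOrder D
  have := CStarAlgebra.spectralOrderedRing D
  set h : D := star a * a with hh
  have hsa : IsSelfAdjoint h := .star_mul_self a
  have hn : ‖h‖ = ‖a‖ ^ 2 := by rw [hh, CStarRing.norm_star_mul_self, sq]
  have hmem : ‖h‖ ∈ spectrum ℝ h :=
    CStarAlgebra.norm_mem_spectrum_of_nonneg (star_mul_self_nonneg a)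
  have hmem' : (‖h‖ : ℂ) ∈ spectrum ℂ h := by
    have := spectrum.algebraMap_mem ℂ hmem
    simpa using this
  have : IsStarNormal h := hsa.isStarNormal
  have hel : (‖h‖ : ℂ) ∈ spectrum ℂ (⟨h, StarAlgebra.elemental.self_mem ℂ h⟩ :
      StarAlgebra.elemental ℂ h) := by
    rwa [StarSubalgebra.spectrum_eq (hS := StarAlgebra.elemental.isClosed ℂ h)]
  rw [WeakDual.CharacterSpace.mem_spectrum_iff_exists] at hel
  obtain ⟨φ, hφ⟩ := hel
  let φ' : StrongDual ℂ (StarAlgebra.elemental ℂ h) := WeakDual.toStrongDual (φ : WeakDual ℂ _)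
  have hφn : ‖φ'‖ ≤ 1 := by
    refine ContinuousLinearMap.opNorm_le_bound _ zero_le_one fun x => ?_
    rw [one_mul]
    exact AlgHom.norm_apply_le_self (WeakDual.CharacterSpace.toAlgHom φ) x
  obtain ⟨g, hg, hgn⟩ := exists_extension_norm_eq
    (Subalgebra.toSubmodule (StarAlgebra.elemental ℂ h).toSubalgebra) φ'
  have hg1 : g 1 = 1 := by
    have := hg ⟨1, one_mem (StarAlgebra.elemental ℂ h)⟩
    refine this.trans ?_
    exact map_one φ
  have hgle : ∀ b, ‖g b‖ ≤ ‖b‖ := fun b =>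
    (g.le_of_opNorm_le (hgn.le.trans hφn) b).trans (by simp)
  refine ⟨g, ⟨fun a b => map_add g a b, fun c a => by simp, hg1,
    nonneg_apply_star_mul_self_of_norm_le (g : D →ₗ[ℂ] ℂ) hg1 hgle, hgle⟩, ?_⟩
  have := hg ⟨h, StarAlgebra.elemental.self_mem ℂ h⟩
  refine this.trans (hφ.trans ?_)
  rw [hn]; simp

namespace IsCstarSeminorm

variable {D : Type*} [CStarAlgebra D] {q : D → ℝ}

theorem apply_one_le (hq : IsCstarSeminorm q) : q 1 ≤ 1 := by
  have := hq.cstar 1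
  simp only [star_one, one_mul] at this
  nlinarith [hq.nonneg 1]

theorem le_norm_s17 (hq : IsCstarSeminorm q) (a : D) : q a ≤ ‖a‖ := by
  let := CStarAlgebra.spectralOrder D
  have := CStarAlgebra.spectralOrderedRing D
  have hunit : ∀ u ∈ unitary D, q u ≤ 1 := by
    intro u hu
    have := hq.cstar u
    rw [Unitary.star_mul_self_of_mem hu] at this
    nlinarith [hq.nonneg u, hq.apply_one_le]
  have hsa1 : ∀ h : selfAdjoint D, ‖h‖ ≤ 1 → q h ≤ 1 := by
    intro h hh
    have e := selfAdjoint.realPart_unitarySelfAddISMul h hh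
    set u := selfAdjoint.unitarySelfAddISMul h hh
    have e2 : (h : D) = (2⁻¹ : ℂ) • ((u : D) + star (u : D)) := by
      rw [← e, realPart_apply_coe, ← Complex.coe_smul]
      simp
    rw [e2, hq.smul]
    have h1 := hq.add_le u (star (u : D))
    rw [hq.star_eq] at h1
    have := hunit u u.2
    simp
    linarith
  have hsa : ∀ h : D, IsSelfAdjoint h → q h ≤ ‖h‖ := by
    intro h hh
    rcases eq_or_ne ‖h‖ 0 with h0 | h0
    · rw [norm_eq_zero.1 h0, hq.map_zero', norm_zero]
    have hpos : 0 < ‖h‖ := lt_of_le_of_ne (norm_nonneg _) (Ne.symm h0)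
    have hk : IsSelfAdjoint ((‖h‖⁻¹ : ℝ) • h) := IsSelfAdjoint.smul (.all _) hh
    have := hsa1 ⟨_, hk⟩ (by
      change ‖(‖h‖⁻¹ : ℝ) • h‖ ≤ 1
      rw [norm_smul]; simp [h0])
    change q ((‖h‖⁻¹ : ℝ) • h) ≤ 1 at this
    rw [← Complex.coe_smul, hq.smul] at this
    simp at this
    rwa [inv_mul_le_iff₀ hpos, mul_one] at this
  have := hsa (star a * a) (.star_mul_self a)
  rw [hq.cstar, CStarRing.norm_star_mul_self, ← sq] at this
  exact (abs_le_of_sq_le_sq' this (norm_nonneg _)).2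

theorem pow_le (hq : IsCstarSeminorm q) (a : D) (k : ℕ) : q (a ^ (k + 1)) ≤ q a ^ (k + 1) := by
  induction k with
  | zero => simp
  | succ k ih =>
    rw [pow_succ a, pow_succ (q a)]
    exact (hq.mul_le _ _).trans (mul_le_mul_of_nonneg_right ih (hq.nonneg a))

theorem eq_norm_s17 (hq : IsCstarSeminorm q) (h0 : ∀ a, q a = 0 → a = 0) (a : D) : q a = ‖a‖ := by
  refine le_antisymm (hq.le_norm_s17 a) ?_
  let := CStarAlgebra.spectralOrder D
  have := CStarAlgebra.spectralOrderedRing D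
  rcases subsingleton_or_nontrivial D with hD | hD
  · rw [Subsingleton.elim a 0, hq.map_zero', norm_zero]
  set h : D := star a * a with hh
  suffices H : ‖h‖ ≤ q h by
    rw [hh, hq.cstar, CStarRing.norm_star_mul_self, ← sq] at H
    exact (abs_le_of_sq_le_sq' H (hq.nonneg _)).2
  have hsa : IsSelfAdjoint h := .star_mul_self a
  have hmem : ‖h‖ ∈ spectrum ℝ h :=
    CStarAlgebra.norm_mem_spectrum_of_nonneg (star_mul_self_nonneg a)
  by_contra! hlt
  obtain ⟨s, hs1, hs2⟩ := exists_between hlt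
  have hs0 : 0 < s := (hq.nonneg h).trans_lt hs1
  let φ : ℝ → ℝ := fun t => max (t - s) 0
  have hφ : Continuous φ := by fun_prop
  have hbd : ∀ k : ℕ, q (cfc φ h) ≤ (q h / s) ^ (k + 1) * ‖h‖ := by
    intro k
    let ψ : ℝ → ℝ := fun t => φ t / (max t s) ^ (k + 1)
    have hψ : Continuous ψ := by
      refine hφ.div (by fun_prop) fun t => ?_
      have : 0 < max t s := lt_max_of_lt_right hs0
      positivity
    have e : cfc φ h = h ^ (k + 1) * cfc ψ h := by
      rw [← cfc_pow_id (R := ℝ) h (k + 1), ← cfc_mul _ _ h (by fun_prop) hψ.continuousOn]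
      congr 1
      ext t
      simp only [ψ, φ]
      rcases le_total t s with hts | hts
      · simp [max_eq_right (sub_nonpos.2 hts)]
      · have : 0 < t := hs0.trans_le hts
        rw [max_eq_left hts]
        field_simp
    have hψn : ‖cfc ψ h‖ ≤ (s⁻¹) ^ (k + 1) * ‖h‖ := by
      refine norm_cfc_le (by positivity) fun t ht => ?_
      have ht1 : t ≤ ‖h‖ := (Real.le_norm_self t).trans (spectrum.norm_le_norm_of_mem ht)
      have hm : s ≤ max t s := le_max_right _ _
      have hφ0 : 0 ≤ φ t := le_max_right _ _
      have hφ1 : φ t ≤ ‖h‖ := max_le (by linarith) (norm_nonneg _)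
      have hm0 : 0 < max t s := hs0.trans_le hm
      rw [Real.norm_of_nonneg (by positivity)]
      simp only [ψ]
      rw [div_eq_inv_mul, ← inv_pow]
      gcongr
    rw [e, div_pow, div_eq_mul_inv, mul_assoc, ← inv_pow]
    refine (hq.mul_le _ _).trans ?_
    exact mul_le_mul (hq.pow_le h k) ((hq.le_norm_s17 _).trans hψn) (hq.nonneg _)
      (pow_nonneg (hq.nonneg h) _)
  have hlim : Filter.Tendsto (fun k : ℕ => (q h / s) ^ (k + 1) * ‖h‖) Filter.atTop (nhds 0) := by
    have h1 : q h / s < 1 := (div_lt_one hs0).2 hs1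
    have := (tendsto_pow_atTop_nhds_zero_of_lt_one (div_nonneg (hq.nonneg h) hs0.le) h1)
    simpa using ((Filter.tendsto_add_atTop_iff_nat 1).2 this).mul_const ‖h‖
  have hz : cfc φ h = 0 :=
    h0 _ (le_antisymm (ge_of_tendsto' hlim hbd) (hq.nonneg _))
  have hspec : φ ‖h‖ ∈ spectrum ℝ (cfc φ h) := by
    rw [cfc_map_spectrum (R := ℝ) φ h]
    exact ⟨_, hmem, rfl⟩
  rw [hz, spectrum.zero_eq] at hspec
  have : φ ‖h‖ = ‖h‖ - s := max_eq_left (by linarith)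
  simp only [Set.mem_singleton_iff] at hspec
  linarith

end IsCstarSeminorm

open scoped InnerProductSpace
universe u

theorem exists_isometry_of_isStarProjection {K : Type*} [NormedAddCommGroup K]
    [InnerProductSpace ℂ K] [CompleteSpace K] [TopologicalSpace.SeparableSpace K]
    {P : K →L[ℂ] K} (hP : IsStarProjection P) :
    ∃ (H : Type) (_ : NormedAddCommGroup H) (_ : InnerProductSpace ℂ H) (_ : CompleteSpace H)
      (V : H →L[ℂ] K), (ContinuousLinearMap.adjoint V) ∘L V = 1 ∧
        V ∘L (ContinuousLinearMap.adjoint V) = P := by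
  have hfix : ∀ y, P (P y) = P y := fun y => congr($(hP.isIdempotentElem) y)
  let R : Submodule ℂ K := LinearMap.range (P : K →ₗ[ℂ] K)
  have hRmem : ∀ y, y ∈ R ↔ P y = y := by
    intro y
    constructor
    · rintro ⟨z, rfl⟩; exact hfix z
    · exact fun h => ⟨y, h⟩
  have hRc : IsClosed (R : Set K) := by
    have : (R : Set K) = {y | P y = y} := by ext y; exact hRmem y
    rw [this]
    exact isClosed_eq P.continuous continuous_id
  have : CompleteSpace R := hRc.completeSpace_coe
  obtain ⟨w, b, hb⟩ := exists_hilbertBasis ℂ R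
  have hw : Countable w := by
    have ho : Orthonormal ℂ (fun i : w => (i : R)) := hb ▸ b.orthonormal
    refine Set.PairwiseDisjoint.countable_of_isOpen
      (s := fun x : R => Metric.ball x (1 / 2)) (a := w) ?_ (fun _ _ => Metric.isOpen_ball)
      (fun x _ => Metric.nonempty_ball.2 (by norm_num))
    intro x hx y hy hxy
    refine Metric.ball_disjoint_ball ?_
    have hn : ‖x - y‖ ^ 2 = 2 := by
      have h1 := ho.1 ⟨x, hx⟩
      have h2 := ho.1 ⟨y, hy⟩
      have h3 := ho.2 (i := ⟨x, hx⟩) (j := ⟨y, hy⟩) (by simpa using hxy)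
      simp only at h1 h2 h3
      rw [@norm_sub_sq ℂ, h1, h2, h3]
      norm_num
    rw [dist_eq_norm]
    nlinarith [norm_nonneg (x - y)]
  obtain ⟨e, he⟩ := exists_injective_nat w
  let ι := Set.range e
  let eq : w ≃ ι := Equiv.ofInjective e he
  let b' : HilbertBasis ι ℂ R := HilbertBasis.mk (v := b ∘ eq.symm)
    (b.orthonormal.comp _ eq.symm.injective) (by
      rw [Set.range_comp, eq.symm.surjective.range_eq, Set.image_univ]
      exact b.dense_span.ge)
  let V : lp (fun _ : ι => ℂ) 2 →L[ℂ] K :=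
    R.subtypeL ∘L (b'.repr.symm.toContinuousLinearEquiv : lp (fun _ : ι => ℂ) 2 →L[ℂ] R)
  have hin : ∀ z, V z ∈ R := fun z => (b'.repr.symm z).2
  have hadj : (ContinuousLinearMap.adjoint V) ∘L V = 1 := by
    ext1 z
    refine ext_inner_right ℂ fun z' => ?_
    rw [ContinuousLinearMap.comp_apply, ContinuousLinearMap.adjoint_inner_left]
    exact b'.repr.symm.inner_map_map z z'
  refine ⟨lp (fun _ : ι => ℂ) 2, inferInstance, inferInstance, inferInstance, V, hadj, ?_⟩
  have hsurj : ∀ y ∈ R, ∃ z, V z = y := fun y hy => ⟨b'.repr ⟨y, hy⟩, by simp [V]⟩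
  have hPs : ∀ u v, ⟪P u, v⟫_ℂ = ⟪u, P v⟫_ℂ := by
    intro u v
    rw [← ContinuousLinearMap.adjoint_inner_right, ← ContinuousLinearMap.star_eq_adjoint,
      hP.isSelfAdjoint.star_eq]
  ext1 y
  obtain ⟨z, hz⟩ := hsurj (P y) ⟨y, rfl⟩
  have : ContinuousLinearMap.adjoint V y = z := by
    refine ext_inner_right ℂ fun z' => ?_
    rw [ContinuousLinearMap.adjoint_inner_left, ← (hRmem _).1 (hin z'), ← hPs, ← hz,
      ← ContinuousLinearMap.adjoint_inner_right, ← ContinuousLinearMap.comp_apply, hadj]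
    rfl
  rw [ContinuousLinearMap.comp_apply, this, hz]

theorem exists_cyclic_representation {D : Type u} [CStarAlgebra D] [TopologicalSpace.SeparableSpace D]
    (f : D →ₗ[ℂ] ℂ) (hf : ∀ a, 0 ≤ f (star a * a)) :
    ∃ (K : Type u) (_ : NormedAddCommGroup K) (_ : InnerProductSpace ℂ K) (_ : CompleteSpace K)
      (_ : TopologicalSpace.SeparableSpace K) (Ψ : D →⋆ₐ[ℂ] (K →L[ℂ] K)) (ξ : K),
      (∀ a, f a = ⟪ξ, Ψ a ξ⟫_ℂ) ∧ ∀ y, (∀ a, ⟪Ψ a ξ, y⟫_ℂ = 0) → y = 0 := by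
  let := CStarAlgebra.spectralOrder D
  have := CStarAlgebra.spectralOrderedRing D
  let F : D →ₚ[ℂ] ℂ := PositiveLinearMap.mk₀ f fun b hb => by
    obtain ⟨c, rfl⟩ := CStarAlgebra.nonneg_iff_eq_star_mul_self.1 hb
    exact hf c
  let ξ : F.GNS := (F.toPreGNS 1 : F.PreGNS)
  have hξ : ∀ a, F.gnsStarAlgHom a ξ = (F.toPreGNS a : F.PreGNS) := by
    intro a
    change F.gnsNonUnitalStarAlgHom a _ = _
    rw [PositiveLinearMap.gnsNonUnitalStarAlgHom_apply_coe]
    simp [PositiveLinearMap.leftMulMapPreGNS]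
  have hdense : DenseRange fun a => F.gnsStarAlgHom a ξ := by
    have : (fun a => F.gnsStarAlgHom a ξ) = (fun z : F.PreGNS => (z : F.GNS)) ∘ F.toPreGNS :=
      funext hξ
    rw [this]
    exact UniformSpace.Completion.denseRange_coe.comp
      F.toPreGNS.surjective.denseRange (UniformSpace.Completion.continuous_coe _)
  have hcont : Continuous fun a => F.gnsStarAlgHom a ξ :=
    (ContinuousLinearMap.apply ℂ F.GNS ξ).continuous.comp
      (map_continuous (F.gnsStarAlgHom))
  refine ⟨F.GNS, inferInstance, inferInstance, inferInstance, hdense.separableSpace hcont,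
    F.gnsStarAlgHom, ξ, fun a => ?_, fun y hy => ?_⟩
  · rw [hξ, UniformSpace.Completion.inner_coe, F.preGNS_inner_def]
    simp
    rfl
  · exact hdense.eq_zero_of_inner_right ℂ hy

/-- The matrix with entry `b` at `(i, j)` and zeros elsewhere. -/
def cstarSingle {n : ℕ} {B : Type u} [Zero B] (i j : Fin n) (b : B) : CStarMatrix (Fin n) (Fin n) B :=
  Matrix.single i j b

section
variable {n : ℕ} {B : Type u} [CStarAlgebra B]

theorem cstarSingle_mul_same (i j k : Fin n) (a b : B) :
    cstarSingle i j a * cstarSingle j k b = cstarSingle i k (a * b) :=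
  Matrix.single_mul_single_same a i j k b

theorem star_cstarSingle (i j : Fin n) (a : B) :
    star (cstarSingle i j a) = cstarSingle j i (star a) :=
  Matrix.conjTranspose_single i j a

theorem cstarSingle_add (i j : Fin n) (a b : B) :
    cstarSingle i j (a + b) = cstarSingle i j a + cstarSingle i j b :=
  Matrix.single_add i j a b

theorem smul_cstarSingle (i j : Fin n) (c : ℂ) (b : B) :
    cstarSingle i j (c • b) = c • cstarSingle i j b :=
  (Matrix.smul_single c i j b).symm

theorem eq_sum_cstarSingle (M : CStarMatrix (Fin n) (Fin n) B) :
    M = ∑ i, ∑ j, cstarSingle i j (M i j) :=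
  Matrix.matrix_eq_sum_single M

theorem cstarSingle_mul_eq_sum (i k : Fin n) (M : CStarMatrix (Fin n) (Fin n) B) :
    cstarSingle i k 1 * M = ∑ j, cstarSingle i j (M k j) := by
  have key : ∀ N : Matrix (Fin n) (Fin n) B, Matrix.single i k (1 : B) * N =
      ∑ j, Matrix.single i j (N k j) := by
    intro N
    ext r s
    rw [Matrix.sum_apply]
    rcases eq_or_ne r i with rfl | hr
    · rw [Matrix.single_mul_apply_same, Finset.sum_eq_single s]
      · simp
      · intro j _ hj
        simp [hj]
      · simp
    · rw [Matrix.single_mul_apply_of_ne _ _ _ _ _ hr, Finset.sum_eq_zero]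
      intro j _
      simp [hr.symm]
  exact key M
end

theorem exists_corner_representation {B : Type u} [CStarAlgebra B] [PartialOrder B]
    [StarOrderedRing B]
    [TopologicalSpace.SeparableSpace B] {n : ℕ}
    (f : CStarMatrix (Fin (n + 1)) (Fin (n + 1)) B →ₗ[ℂ] ℂ) (hf : ∀ M, 0 ≤ f (star M * M)) :
    ∃ (H : Type) (_ : NormedAddCommGroup H) (_ : InnerProductSpace ℂ H) (_ : CompleteSpace H)
      (ρ : B →⋆ₐ[ℂ] (H →L[ℂ] H)) (x : Fin (n + 1) → H),
      (∀ M, f M = ∑ i, ∑ j, ⟪x i, ρ (M i j) (x j)⟫_ℂ) ∧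
        ∀ y, (∀ b j, ⟪ρ b (x j), y⟫_ℂ = 0) → y = 0 := by
  have : TopologicalSpace.SeparableSpace (CStarMatrix (Fin (n + 1)) (Fin (n + 1)) B) :=
    inferInstanceAs (TopologicalSpace.SeparableSpace (Fin (n + 1) → Fin (n + 1) → B))
  obtain ⟨K, _, _, _, _, Ψ, ξ, hfξ, htot⟩ := exists_cyclic_representation f hf
  have hP : IsStarProjection (Ψ (cstarSingle 0 0 1)) :=
    ⟨by rw [IsIdempotentElem, ← map_mul, cstarSingle_mul_same, one_mul],
      by rw [IsSelfAdjoint, ← map_star, star_cstarSingle, star_one]⟩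
  obtain ⟨H, _, _, _, V, hV1, hV2⟩ := exists_isometry_of_isStarProjection hP
  have hVV : ∀ z, V (ContinuousLinearMap.adjoint V z) = Ψ (cstarSingle 0 0 1) z :=
    fun z => congr($hV2 z)
  have hV1' : ∀ z, ContinuousLinearMap.adjoint V (V z) = z := fun z => congr($hV1 z)
  have hVin : ∀ a b, ⟪a, b⟫_ℂ = ⟪V a, V b⟫_ℂ := fun a b => by
    rw [← ContinuousLinearMap.adjoint_inner_right, hV1']
  have hΨ : ∀ M N z, Ψ M (Ψ N z) = Ψ (M * N) z := fun M N z => by rw [map_mul]; rfl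
  have hPV : ∀ z, Ψ (cstarSingle 0 0 1) (V z) = V z := fun z => by rw [← hVV, hV1']
  have hadj : ∀ M y z, ⟪Ψ M y, z⟫_ℂ = ⟪y, Ψ (star M) z⟫_ℂ := fun M y z => by
    rw [map_star, ContinuousLinearMap.star_eq_adjoint, ContinuousLinearMap.adjoint_inner_right]
  have hmulρ : ∀ b z, V (ContinuousLinearMap.adjoint V (Ψ (cstarSingle 0 0 b) z)) =
      Ψ (cstarSingle 0 0 b) z := fun b z => by
    rw [hVV, hΨ, cstarSingle_mul_same, one_mul]
  let ρ : B →⋆ₐ[ℂ] (H →L[ℂ] H) :=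
    { toFun := fun b => ContinuousLinearMap.adjoint V ∘L Ψ (cstarSingle 0 0 b) ∘L V
      map_one' := by ext z; simp [hPV, hV1']
      map_mul' := fun a b => by
        ext z
        simp only [mul_apply_eq_comp, ContinuousLinearMap.comp_apply, hmulρ, hΨ,
          cstarSingle_mul_same]
      map_zero' := by
        rw [show cstarSingle 0 0 (0 : B) = 0 from Matrix.single_zero _ _, map_zero]; simp
      map_add' := fun a b => by
        ext z
        simp [cstarSingle_add]
      commutes' := fun r => by
        ext z
        simp [Algebra.algebraMap_eq_smul_one, smul_cstarSingle, hPV, hV1']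
      map_star' := fun b => by
        rw [← star_cstarSingle, map_star, ContinuousLinearMap.star_eq_adjoint,
          ContinuousLinearMap.star_eq_adjoint, ContinuousLinearMap.adjoint_comp,
          ContinuousLinearMap.adjoint_comp, ContinuousLinearMap.adjoint_adjoint]
        rfl }
  have hVρ : ∀ b z, V (ρ b z) = Ψ (cstarSingle 0 0 b) (V z) := fun b z => hmulρ b (V z)
  let x : Fin (n + 1) → H := fun j => ContinuousLinearMap.adjoint V (Ψ (cstarSingle 0 j 1) ξ)
  have hVx : ∀ j, V (x j) = Ψ (cstarSingle 0 j 1) ξ := fun j => by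
    change V (ContinuousLinearMap.adjoint V _) = _
    rw [hVV, hΨ, cstarSingle_mul_same, one_mul]
  have hVρx : ∀ b j, V (ρ b (x j)) = Ψ (cstarSingle 0 j b) ξ := fun b j => by
    rw [hVρ, hVx, hΨ, cstarSingle_mul_same, mul_one]
  refine ⟨H, inferInstance, inferInstance, inferInstance, ρ, x, fun M => ?_, fun y hy => ?_⟩
  · conv_lhs => rw [eq_sum_cstarSingle M]
    simp only [map_sum]
    refine Finset.sum_congr rfl fun i _ => Finset.sum_congr rfl fun j _ => ?_
    rw [hVin, hVx, hVρx, hadj, hΨ, star_cstarSingle, cstarSingle_mul_same, star_one, one_mul, hfξ]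
  · suffices V y = 0 by rw [← hV1' y, this, map_zero]
    refine htot _ fun M => ?_
    rw [← hPV y, ← inner_conj_symm, hadj, star_cstarSingle, star_one, hΨ, cstarSingle_mul_eq_sum,
      map_sum, sum_apply, inner_sum]
    rw [Finset.sum_eq_zero, map_zero]
    intro j _
    rw [← hVρx, ← hVin, ← inner_conj_symm, hy, map_zero]

/-- Complete positivity of a linear map into the bounded operators, in kernel form. -/
def IsPosKernelMap {B H : Type*} [CStarAlgebra B] [NormedAddCommGroup H] [InnerProductSpace ℂ H]
    (χ : B →ₗ[ℂ] (H →L[ℂ] H)) : Prop :=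
  ∀ (N : ℕ) (c : Fin N → B) (y : Fin N → H),
    0 ≤ ∑ i, ∑ j, ⟪y i, χ (star (c i) * c j) (y j)⟫_ℂ

/-- The linear functional on matrices over `B` induced by an operator valued map on `B` and a
tuple of vectors. -/
noncomputable def vecFunctional {B H : Type*} [CStarAlgebra B] [NormedAddCommGroup H]
    [InnerProductSpace ℂ H] {n : ℕ} (χ : B →ₗ[ℂ] (H →L[ℂ] H)) (x : Fin n → H) :
    CStarMatrix (Fin n) (Fin n) B →ₗ[ℂ] ℂ where
  toFun M := ∑ i, ∑ j, ⟪x i, χ (M i j) (x j)⟫_ℂ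
  map_add' M N := by
    simp [CStarMatrix.add_apply, Finset.sum_add_distrib]
  map_smul' c M := by
    simp [CStarMatrix.smul_apply, Finset.mul_sum]

section vecFunctional

variable {B H : Type*} [CStarAlgebra B] [NormedAddCommGroup H] [InnerProductSpace ℂ H] {n : ℕ}
  {χ : B →ₗ[ℂ] (H →L[ℂ] H)} (x : Fin n → H)

theorem vecFunctional_apply (χ : B →ₗ[ℂ] (H →L[ℂ] H)) (M : CStarMatrix (Fin n) (Fin n) B) :
    vecFunctional χ x M = ∑ i, ∑ j, ⟪x i, χ (M i j) (x j)⟫_ℂ := rfl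

theorem vecFunctional_star_mul_self (χ : B →ₗ[ℂ] (H →L[ℂ] H))
    (M : CStarMatrix (Fin n) (Fin n) B) :
    vecFunctional χ x (star M * M) =
      ∑ r, ∑ i, ∑ j, ⟪x i, χ (star (M r i) * M r j) (x j)⟫_ℂ := by
  simp only [vecFunctional_apply, CStarMatrix.mul_apply, CStarMatrix.star_apply, map_sum,
    sum_apply, inner_sum]
  rw [Finset.sum_comm]
  calc _ = ∑ j, ∑ r, ∑ i, ⟪x i, χ (star (M r i) * M r j) (x j)⟫_ℂ :=
        Finset.sum_congr rfl fun j _ => Finset.sum_comm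
    _ = ∑ r, ∑ j, ∑ i, ⟪x i, χ (star (M r i) * M r j) (x j)⟫_ℂ := Finset.sum_comm
    _ = _ := Finset.sum_congr rfl fun r _ => Finset.sum_comm

theorem vecFunctional_diagonal (χ : B →ₗ[ℂ] (H →L[ℂ] H)) (b : B) :
    vecFunctional χ x (CStarMatrix.ofMatrix (Matrix.diagonal fun _ => b)) =
      ∑ i, ⟪x i, χ b (x i)⟫_ℂ := by
  rw [vecFunctional_apply]
  refine Finset.sum_congr rfl fun i _ => ?_
  rw [Finset.sum_eq_single i]
  · simp
  · intro j _ hj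
    simp [Matrix.diagonal_apply_ne _ hj.symm]
  · simp

theorem vecFunctional_one (χ : B →ₗ[ℂ] (H →L[ℂ] H)) :
    vecFunctional χ x 1 = ∑ i, ⟪x i, χ 1 (x i)⟫_ℂ := by
  rw [← vecFunctional_diagonal, Matrix.diagonal_one]
  rfl

theorem vecFunctional_star_mul_self_nonneg (hχ : IsPosKernelMap χ)
    (M : CStarMatrix (Fin n) (Fin n) B) : 0 ≤ vecFunctional χ x (star M * M) := by
  rw [vecFunctional_star_mul_self]
  exact Finset.sum_nonneg fun r _ => hχ n (M r) x

theorem vecFunctional_mem_stateSet [PartialOrder B] [StarOrderedRing B] (hχ : IsPosKernelMap χ)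
    (h1 : vecFunctional χ x 1 = 1) :
    ⇑(vecFunctional χ x) ∈ stateSet (CStarMatrix (Fin n) (Fin n) B) :=
  ⟨map_add _, fun c a => by simp, h1, vecFunctional_star_mul_self_nonneg x hχ, fun a => by
    simpa [h1] using norm_apply_le_of_positive _ (vecFunctional_star_mul_self_nonneg x hχ) a⟩

theorem IsPosKernelMap.smul (hχ : IsPosKernelMap χ) {c : ℝ} (hc : 0 ≤ c) :
    IsPosKernelMap ((c : ℂ) • χ) := by
  intro N b y
  have h := hχ N b y
  have e : ∑ i, ∑ j, ⟪y i, ((c : ℂ) • χ) (star (b i) * b j) (y j)⟫_ℂ =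
      c * ∑ i, ∑ j, ⟪y i, χ (star (b i) * b j) (y j)⟫_ℂ := by
    simp [Finset.mul_sum]
  rw [e]
  exact mul_nonneg (by exact_mod_cast hc) h

end vecFunctional

section irreducible

variable {B H : Type*} [CStarAlgebra B] [NormedAddCommGroup H] [InnerProductSpace ℂ H]
  [CompleteSpace H] {n : ℕ} {ρ : B →⋆ₐ[ℂ] (H →L[ℂ] H)} {x : Fin n → H}

/-- `b ↦ R ρ(b)` as a linear map. -/
noncomputable def mulLeftRep (R : H →L[ℂ] H) (ρ : B →⋆ₐ[ℂ] (H →L[ℂ] H)) :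
    B →ₗ[ℂ] (H →L[ℂ] H) :=
  LinearMap.mulLeft ℂ R ∘ₗ (ρ : B →ₐ[ℂ] (H →L[ℂ] H)).toLinearMap

theorem mulLeftRep_apply (R : H →L[ℂ] H) (b : B) (y : H) :
    mulLeftRep R ρ b y = R (ρ b y) := rfl

theorem inner_rep_left (b : B) (y z : H) : ⟪ρ b y, z⟫_ℂ = ⟪y, ρ (star b) z⟫_ℂ := by
  rw [map_star, ContinuousLinearMap.star_eq_adjoint, ContinuousLinearMap.adjoint_inner_right]

theorem rep_mul_apply (a b : B) (y : H) : ρ (a * b) y = ρ a (ρ b y) := by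
  rw [map_mul]; rfl

theorem sum_inner_mulLeftRep {R : H →L[ℂ] H} (hR : ∀ b, R * ρ b = ρ b * R) (N : ℕ)
    (c : Fin N → B) (y : Fin N → H) :
    ∑ i, ∑ j, ⟪y i, mulLeftRep R ρ (star (c i) * c j) (y j)⟫_ℂ =
      ⟪∑ i, ρ (c i) (y i), R (∑ i, ρ (c i) (y i))⟫_ℂ := by
  simp only [map_sum, sum_inner, inner_sum, mulLeftRep_apply]
  rw [Finset.sum_comm]
  refine Finset.sum_congr rfl fun i _ => Finset.sum_congr rfl fun j _ => ?_
  rw [inner_rep_left, rep_mul_apply]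
  congr 1
  exact congr($(hR (star (c j))) (ρ (c i) (y i)))

theorem isPosKernelMap_mulLeftRep {R : H →L[ℂ] H} (hR : ∀ b, R * ρ b = ρ b * R)
    (hpos : ∀ y, 0 ≤ ⟪y, R y⟫_ℂ) : IsPosKernelMap (mulLeftRep R ρ) := by
  intro N c y
  rw [sum_inner_mulLeftRep hR]
  exact hpos _

theorem inner_one_add_nonneg {T : H →L[ℂ] H} (hT : IsSelfAdjoint T) (hT1 : ‖T‖ ≤ 1) (y : H) :
    0 ≤ ⟪y, (1 + T) y⟫_ℂ := by
  have him : (⟪y, T y⟫_ℂ).im = 0 := by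
    have : (starRingEnd ℂ) ⟪y, T y⟫_ℂ = ⟪y, T y⟫_ℂ := by
      rw [inner_conj_symm, ← ContinuousLinearMap.adjoint_inner_right,
        ← ContinuousLinearMap.star_eq_adjoint, hT.star_eq]
    exact Complex.conj_eq_iff_im.1 this
  have hre : -(‖y‖ ^ 2) ≤ (⟪y, T y⟫_ℂ).re := by
    have h1 := (Complex.abs_re_le_norm ⟪y, T y⟫_ℂ).trans (norm_inner_le_norm y (T y))
    have h2 : ‖T y‖ ≤ ‖y‖ := (T.le_of_opNorm_le hT1 y).trans (by simp)
    have := (abs_le.1 (h1.trans (mul_le_mul_of_nonneg_left h2 (norm_nonneg _)))).1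
    rwa [sq]
  rw [Complex.nonneg_iff]
  have : ⟪y, y⟫_ℂ = ((‖y‖ ^ 2 : ℝ) : ℂ) := by
    rw [inner_self_eq_norm_sq_to_K]; simp
  simp only [add_apply, one_apply_eq_self, inner_add_right, this]
  constructor
  · rw [Complex.add_re, Complex.ofReal_re]; linarith
  · rw [Complex.add_im, Complex.ofReal_im, him]; simp

variable [PartialOrder B] [StarOrderedRing B]

theorem exists_eq_smul_of_extreme_of_selfAdjoint
    (hext : ⇑(vecFunctional (mulLeftRep 1 ρ) x) ∈
      (stateSet (CStarMatrix (Fin n) (Fin n) B)).extremePoints ℝ)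
    (htot : ∀ y, (∀ b j, ⟪ρ b (x j), y⟫_ℂ = 0) → y = 0)
    {T : H →L[ℂ] H} (hT : IsSelfAdjoint T) (hcomm : ∀ b, T * ρ b = ρ b * T)
    (hn : ‖T‖ ≤ 1 / 2) : ∃ c : ℂ, T = c • (1 : H →L[ℂ] H) := by
  set f := vecFunctional (mulLeftRep 1 ρ) x with hf
  set t := vecFunctional (mulLeftRep T ρ) x with ht
  have hadd : ∀ M, vecFunctional (mulLeftRep (1 + T) ρ) x M = f M + t M := by
    intro M
    simp [hf, ht, vecFunctional_apply, mulLeftRep_apply, Finset.sum_add_distrib]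
  have hsub : ∀ M, vecFunctional (mulLeftRep (1 + -T) ρ) x M = f M - t M := by
    intro M
    simp [hf, ht, vecFunctional_apply, mulLeftRep_apply, Finset.sum_add_distrib,
      sub_eq_add_neg]
  have hkp : IsPosKernelMap (mulLeftRep (1 + T) ρ) :=
    isPosKernelMap_mulLeftRep (fun b => by rw [add_mul, mul_add, hcomm, one_mul, mul_one])
      (inner_one_add_nonneg hT (by linarith))
  have hkm : IsPosKernelMap (mulLeftRep (1 + -T) ρ) :=
    isPosKernelMap_mulLeftRep
      (fun b => by rw [add_mul, mul_add, neg_mul, mul_neg, hcomm, one_mul, mul_one])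
      (inner_one_add_nonneg hT.neg (by rw [norm_neg]; linarith))
  have hf1 : f 1 = 1 := hext.1.2.2.1
  have ht1 : ∃ τ : ℝ, t 1 = τ ∧ |τ| ≤ 1 / 2 := by
    have h2 : ∀ s : ℝ, |s| ≤ 2 → 0 ≤ 1 + s * t 1 := by
      intro s hs
      have e : 1 + s * t 1 = vecFunctional (mulLeftRep (1 + (s : ℂ) • T) ρ) x 1 := by
        rw [← hf1]
        simp only [hf, ht, vecFunctional_one, mulLeftRep_apply, inner_add_right,
          Finset.sum_add_distrib, add_apply, one_apply_eq_self, smul_apply, inner_smul_right,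
          Finset.mul_sum]
      rw [e, vecFunctional_one]
      refine Finset.sum_nonneg fun i _ => ?_
      rw [mulLeftRep_apply, map_one, one_apply_eq_self]
      refine inner_one_add_nonneg ?_ ?_ _
      · rw [Complex.coe_smul]; exact IsSelfAdjoint.smul (.all _) hT
      · rw [norm_smul, Complex.norm_real, Real.norm_eq_abs]
        nlinarith [norm_nonneg T]
    obtain ⟨h3, h4⟩ := Complex.nonneg_iff.1 (h2 2 (by norm_num))
    obtain ⟨h5, -⟩ := Complex.nonneg_iff.1 (h2 (-2) (by norm_num))
    simp at h3 h4 h5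
    exact ⟨(t 1).re, Complex.ext rfl (by simpa using h4),
      abs_le.2 ⟨by linarith, by linarith⟩⟩
  obtain ⟨τ, hτ, hτ2⟩ := ht1
  have hτ3 := abs_le.1 hτ2
  have hp1 : (1 + τ) ≠ 0 := by linarith
  have hm1 : (1 - τ) ≠ 0 := by linarith
  have hp1' : (1 + τ : ℂ) ≠ 0 := by exact_mod_cast hp1
  have hm1' : (1 - τ : ℂ) ≠ 0 := by exact_mod_cast hm1
  have hsm : ∀ (c : ℝ) (R : H →L[ℂ] H) M, vecFunctional ((c : ℂ) • mulLeftRep R ρ) x M =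
      c * vecFunctional (mulLeftRep R ρ) x M := by
    intro c R M
    simp [vecFunctional_apply, Finset.mul_sum]
  have hgp := vecFunctional_mem_stateSet x (hkp.smul (c := (1 + τ)⁻¹)
    (inv_nonneg.2 (by linarith))) (by
      rw [hsm, hadd, hf1, hτ]; push_cast; field_simp)
  have hgm := vecFunctional_mem_stateSet x (hkm.smul (c := (1 - τ)⁻¹)
    (inv_nonneg.2 (by linarith))) (by
      rw [hsm, hsub, hf1, hτ]; push_cast; field_simp)
  have hseg := hext.2 hgp hgm ⟨(1 + τ) / 2, (1 - τ) / 2, by linarith, by linarith, by ring, by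
    ext M
    simp only [Pi.add_apply, Pi.smul_apply, hsm, hadd, hsub, Complex.real_smul]
    push_cast
    field_simp
    ring⟩
  have hfin : ∀ M, t M = τ * f M := by
    intro M
    have := congrFun hseg M
    rw [hsm, hadd] at this
    push_cast at this
    rw [inv_mul_eq_iff_eq_mul₀ hp1'] at this
    linear_combination this
  refine ⟨τ, ?_⟩
  have hz : ∀ b j, (T - (τ : ℂ) • 1) (ρ b (x j)) = 0 := by
    intro b j
    refine htot _ fun c i => ?_
    have h1 := hfin (cstarSingle i j (star c * b))
    have h2 : ∀ R : H →L[ℂ] H, (∀ b, R * ρ b = ρ b * R) →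
        vecFunctional (mulLeftRep R ρ) x (cstarSingle i j (star c * b)) =
        ⟪ρ c (x i), R (ρ b (x j))⟫_ℂ := by
      intro R hR
      rw [vecFunctional_apply, Finset.sum_eq_single i, Finset.sum_eq_single j]
      · rw [inner_rep_left, mulLeftRep_apply]
        rw [show cstarSingle i j (star c * b) i j = star c * b from Matrix.single_apply_same ..,
          rep_mul_apply]
        congr 1
        exact congr($(hR (star c)) (ρ b (x j)))
      · intro k _ hk
        rw [show cstarSingle i j (star c * b) i k = 0 from
          Matrix.single_apply_of_ne _ _ _ _ _ (by simp [hk.symm])]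
        simp
      · simp
      · intro k _ hk
        refine Finset.sum_eq_zero fun l _ => ?_
        rw [show cstarSingle i j (star c * b) k l = 0 from
          Matrix.single_apply_of_ne _ _ _ _ _ (by simp [hk.symm])]
        simp
      · simp
    rw [ht, hf, h2 T hcomm, h2 1 (fun b => by rw [one_mul, mul_one])] at h1
    simp only [sub_apply, smul_apply, one_apply_eq_self, inner_sub_right, inner_smul_right]
    rw [h1]
    simp
  have hadj : ContinuousLinearMap.adjoint (T - (τ : ℂ) • 1) = 0 := by
    ext y
    refine htot _ fun b j => ?_
    rw [ContinuousLinearMap.adjoint_inner_right, hz, inner_zero_left]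
  rw [← sub_eq_zero, ← ContinuousLinearMap.adjoint_adjoint (T - (τ : ℂ) • 1), hadj, map_zero]

theorem hasTrivialCommutant_of_extreme
    (hext : ⇑(vecFunctional (mulLeftRep 1 ρ) x) ∈
      (stateSet (CStarMatrix (Fin n) (Fin n) B)).extremePoints ℝ)
    (htot : ∀ y, (∀ b j, ⟪ρ b (x j), y⟫_ℂ = 0) → y = 0) : HasTrivialCommutant ⇑ρ := by
  have key : ∀ T : H →L[ℂ] H, IsSelfAdjoint T → (∀ b, T * ρ b = ρ b * T) →
      ∃ c : ℂ, T = c • (1 : H →L[ℂ] H) := by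
    intro T hT hcomm
    let r : ℝ := (2 * (‖T‖ + 1))⁻¹
    have hr : 0 < r := by positivity
    obtain ⟨c, hc⟩ := exists_eq_smul_of_extreme_of_selfAdjoint hext htot (T := r • T)
      (IsSelfAdjoint.smul (.all _) hT) (fun b => by rw [smul_mul_assoc, mul_smul_comm, hcomm]) (by
        rw [norm_smul, Real.norm_of_nonneg hr.le]
        simp only [r]
        rw [inv_mul_le_iff₀ (by positivity)]
        linarith)
    refine ⟨(r⁻¹ : ℝ) • c, ?_⟩
    rw [smul_assoc, ← hc, smul_smul, inv_mul_cancel₀ hr.ne', one_smul]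
  intro T hcomm
  have hstar : ∀ b, star T * ρ b = ρ b * star T := by
    intro b
    have := congr(star $(hcomm (star b)))
    rw [star_mul, star_mul, map_star, star_star] at this
    exact this.symm
  obtain ⟨a, ha⟩ := key (realPart T : H →L[ℂ] H) (realPart T).2 fun b => by
    rw [realPart_apply_coe, smul_mul_assoc, mul_smul_comm, add_mul, mul_add, hcomm, hstar]
  obtain ⟨c, hc⟩ := key (imaginaryPart T : H →L[ℂ] H) (imaginaryPart T).2 fun b => by
    rw [imaginaryPart_apply_coe]
    simp only [smul_mul_assoc, mul_smul_comm, sub_mul, mul_sub, hcomm, hstar]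
  refine ⟨a + Complex.I * c, ?_⟩
  rw [← realPart_add_I_smul_imaginaryPart T, ha, hc]
  module

end irreducible

section IsPosKernelMap

variable {B H : Type*} [CStarAlgebra B] [NormedAddCommGroup H] [InnerProductSpace ℂ H]
  {χ : B →ₗ[ℂ] (H →L[ℂ] H)}

theorem IsPosKernelMap.inner_star (hχ : IsPosKernelMap χ) (h1 : χ 1 = 1) (b : B) (v u : H) :
    ⟪v, χ (star b) u⟫_ℂ = (starRingEnd ℂ) ⟪u, χ b v⟫_ℂ := by
  have key : ∀ u v : H, (⟪u, χ b v⟫_ℂ + ⟪v, χ (star b) u⟫_ℂ).im = 0 := by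
    intro u v
    have h2 := (Complex.nonneg_iff.1 (hχ 2 ![1, b] ![u, v])).2
    have h3 := (Complex.nonneg_iff.1 (hχ 1 ![b] ![v])).2
    have h4 : (⟪u, u⟫_ℂ).im = 0 := inner_self_im (𝕜 := ℂ) u
    simp only [Fin.sum_univ_two, Fin.sum_univ_one, Matrix.cons_val_zero, Matrix.cons_val_one,
      star_one, one_mul, mul_one, h1, one_apply_eq_self, Complex.add_im] at h2 h3 ⊢
    linarith
  have e1 := key u v
  have e2 := key (Complex.I • u) v
  simp at e1 e2
  refine Complex.ext ?_ ?_
  · rw [Complex.conj_re]; linarith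
  · rw [Complex.conj_im]; linarith

theorem IsPosKernelMap.norm_sum_sq_le (hχ : IsPosKernelMap χ) (h1 : χ 1 = 1) {N : ℕ}
    (c : Fin N → B) (y : Fin N → H) :
    ‖∑ j, χ (c j) (y j)‖ ^ 2 ≤ (∑ i, ∑ j, ⟪y i, χ (star (c i) * c j) (y j)⟫_ℂ).re := by
  set z := ∑ j, χ (c j) (y j) with hz
  have h := (Complex.nonneg_iff.1 (hχ (N + 1) (Fin.cons 1 c) (Fin.cons (-z) y))).1
  simp only [Fin.sum_univ_succ, Fin.cons_zero, Fin.cons_succ, star_one, one_mul, mul_one, h1,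
    one_apply_eq_self, inner_neg_left, inner_neg_right, map_neg, Finset.sum_add_distrib,
    Finset.sum_neg_distrib, hχ.inner_star h1] at h
  rw [← inner_sum, ← map_sum, ← inner_sum, ← hz] at h
  have hzz : ⟪z, z⟫_ℂ = ((‖z‖ ^ 2 : ℝ) : ℂ) := by
    rw [inner_self_eq_norm_sq_to_K]; simp
  rw [hzz] at h
  simp only [Complex.add_re, Complex.neg_re, Complex.conj_re, Complex.ofReal_re] at h
  linarith

theorem IsPosKernelMap.apply_mul_of_le (hχ : IsPosKernelMap χ) (h1 : χ 1 = 1)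
    {s : B} {v : H} (h : (⟪v, χ (star s * s) v⟫_ℂ).re ≤ ‖χ s v‖ ^ 2) (b : B) :
    χ (b * s) v = χ b (χ s v) := by
  let := CStarAlgebra.spectralOrder B
  have := CStarAlgebra.spectralOrderedRing B
  set w := χ s v with hw
  obtain ⟨d, hd⟩ : ∃ d : B, ((‖b‖ ^ 2 : ℝ) : ℂ) • (1 : B) - star b * b = star d * d := by
    rw [← CStarAlgebra.nonneg_iff_eq_star_mul_self, sub_nonneg, Complex.coe_smul,
      ← Algebra.algebraMap_eq_smul_one, sq, ← CStarRing.norm_star_mul_self (x := b)]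
    exact IsSelfAdjoint.le_algebraMap_norm_self (.star_mul_self b)
  have hww : ⟪w, w⟫_ℂ = ((‖w‖ ^ 2 : ℝ) : ℂ) := by
    rw [inner_self_eq_norm_sq_to_K]; simp
  have hQd := (Complex.nonneg_iff.1 (hχ 2 ![d * s, d] ![v, -w])).1
  have hd1 : star (d * s) * (d * s) = ((‖b‖ ^ 2 : ℝ) : ℂ) • (star s * s) -
      star (b * s) * (b * s) := by
    rw [star_mul, star_mul, mul_assoc, ← mul_assoc (star d), ← hd]
    simp [sub_mul, mul_sub, mul_assoc]
  have hd2 : star (d * s) * d = ((‖b‖ ^ 2 : ℝ) : ℂ) • star s - star (b * s) * b := by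
    rw [star_mul, star_mul, mul_assoc, ← hd]
    simp [mul_sub, mul_assoc]
  have hd3 : star d * (d * s) = ((‖b‖ ^ 2 : ℝ) : ℂ) • s - star b * (b * s) := by
    rw [← mul_assoc, ← hd]
    simp [sub_mul, mul_assoc]
  simp only [Fin.sum_univ_two, Matrix.cons_val_zero, Matrix.cons_val_one, hd1, hd2, hd3, ← hd,
    map_sub, map_smul, h1, sub_apply, smul_apply, inner_sub_right, inner_smul_right, map_neg,
    inner_neg_left, inner_neg_right, one_apply_eq_self, ← hw, hww, hχ.inner_star h1 s] at hQd
  set δ := χ (b * s) v - χ b w with hδ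
  have h3 := (Complex.nonneg_iff.1 (hχ 3 ![b * s, b, 1] ![v, -w, -δ])).1
  simp only [Fin.sum_univ_three, Matrix.cons_val_zero, Matrix.cons_val_one, Matrix.cons_val,
    star_one, one_mul, mul_one, h1, one_apply_eq_self, inner_neg_left, inner_neg_right, map_neg,
    hχ.inner_star h1] at h3
  have hδδ : ⟪δ, χ (b * s) v⟫_ℂ - ⟪δ, χ b w⟫_ℂ = ((‖δ‖ ^ 2 : ℝ) : ℂ) := by
    rw [← inner_sub_right, inner_self_eq_norm_sq_to_K]; simp
  have hδδ' := congr(Complex.re $hδδ)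
  have hδδ2 : ⟪δ, δ⟫_ℂ = ((‖δ‖ ^ 2 : ℝ) : ℂ) := by
    rw [inner_self_eq_norm_sq_to_K]; simp
  rw [hδδ2] at h3
  simp only [Complex.add_re, Complex.sub_re, Complex.neg_re, Complex.conj_re, Complex.ofReal_re,
    Complex.re_ofReal_mul, neg_neg] at h3 hQd hδδ'
  have : ‖δ‖ ^ 2 ≤ 0 := by nlinarith [mul_nonneg (sq_nonneg ‖b‖) (sub_nonneg.2 h)]
  have : δ = 0 := by
    rw [← norm_eq_zero]; nlinarith [norm_nonneg δ]
  exact sub_eq_zero.1 this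

end IsPosKernelMap

/-- The scalar diagonal matrix with entry `b`. -/
def cstarDiagonal {B : Type*} [Zero B] (n : ℕ) (b : B) : CStarMatrix (Fin n) (Fin n) B :=
  CStarMatrix.ofMatrix (Matrix.diagonal fun _ => b)

section uniqueExtension

variable {B H : Type*} [CStarAlgebra B] [NormedAddCommGroup H] [InnerProductSpace ℂ H]
  [CompleteSpace H] {n : ℕ} {ρ : B →⋆ₐ[ℂ] (H →L[ℂ] H)} {x : Fin n → H}

theorem re_vecFunctional_rep_star_mul_self (M : CStarMatrix (Fin n) (Fin n) B) :
    vecFunctional (mulLeftRep 1 ρ) x (star M * M) =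
      ((∑ r, ‖∑ j, ρ (M r j) (x j)‖ ^ 2 : ℝ) : ℂ) := by
  rw [vecFunctional_star_mul_self, Complex.ofReal_sum]
  refine Finset.sum_congr rfl fun r _ => ?_
  rw [sum_inner_mulLeftRep (fun b => by rw [one_mul, mul_one]), one_apply_eq_self,
    inner_self_eq_norm_sq_to_K]
  simp

theorem re_vecFunctional_rep_diagonal (b : B) :
    (vecFunctional (mulLeftRep 1 ρ) x (cstarDiagonal n (star b * b))).re =
      ∑ k, ‖ρ b (x k)‖ ^ 2 := by
  rw [cstarDiagonal, vecFunctional_diagonal, Complex.re_sum]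
  refine Finset.sum_congr rfl fun k _ => ?_
  rw [mulLeftRep_apply, one_apply_eq_self, rep_mul_apply, ← inner_rep_left,
    inner_self_eq_norm_sq_to_K]
  simp [← Complex.ofReal_pow]

variable [PartialOrder B] [StarOrderedRing B]

theorem eq_rep_of_lexMax {s : ℕ → B}
    (hs : closure (Algebra.adjoin ℂ (Set.range s) : Set B) = Set.univ)
    (htot : ∀ y, (∀ b j, ⟪ρ b (x j), y⟫_ℂ = 0) → y = 0)
    (hx : vecFunctional (mulLeftRep 1 ρ) x 1 = 1)
    {m : CStarMatrix (Fin n) (Fin n) B} {w : ℕ → B}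
    (hw : w = fun k => ((Denumerable.ofNat (List ℕ) k).map s).prod)
    (hmax : ∀ g ∈ stateSet (CStarMatrix (Fin n) (Fin n) B),
      (g (star m * m)).re ≤ (vecFunctional (mulLeftRep 1 ρ) x (star m * m)).re)
    (hlex : ∀ k, ∀ g ∈ stateSet (CStarMatrix (Fin n) (Fin n) B),
      (g (star m * m)).re = (vecFunctional (mulLeftRep 1 ρ) x (star m * m)).re →
      (∀ i < k, (g (cstarDiagonal n (star (w i) * w i))).re =
        (vecFunctional (mulLeftRep 1 ρ) x (cstarDiagonal n (star (w i) * w i))).re) →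
      (g (cstarDiagonal n (star (w k) * w k))).re ≤
        (vecFunctional (mulLeftRep 1 ρ) x (cstarDiagonal n (star (w k) * w k))).re)
    {χ : B →ₗ[ℂ] (H →L[ℂ] H)} (hχ : IsPosKernelMap χ) (hχ1 : χ 1 = 1)
    (hχn : ∀ b, ‖χ b‖ ≤ ‖b‖) (hχs : ∀ i, χ (s i) = ρ (s i)) (hχm : ∀ i j, χ (m i j) = ρ (m i j))
    (b : B) : χ b = ρ b := by
  have hg : ⇑(vecFunctional χ x) ∈ stateSet (CStarMatrix (Fin n) (Fin n) B) := by
    refine vecFunctional_mem_stateSet x hχ ?_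
    rw [← hx]
    simp only [vecFunctional_one, hχ1, mulLeftRep_apply, map_one, one_apply_eq_self]
  have hgm : (vecFunctional χ x (star m * m)).re =
      (vecFunctional (mulLeftRep 1 ρ) x (star m * m)).re := by
    refine le_antisymm (hmax _ hg) ?_
    rw [re_vecFunctional_rep_star_mul_self, Complex.ofReal_re, vecFunctional_star_mul_self,
      Complex.re_sum]
    refine Finset.sum_le_sum fun r _ => ?_
    simpa only [hχm] using hχ.norm_sum_sq_le hχ1 (m r) x
  have hdiag : ∀ c : B, (∀ b k, χ (b * c) (x k) = χ b (ρ c (x k))) →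
      (vecFunctional χ x (cstarDiagonal n (star c * c))).re =
        (vecFunctional (mulLeftRep 1 ρ) x (cstarDiagonal n (star c * c))).re := by
    intro c hc
    rw [re_vecFunctional_rep_diagonal, cstarDiagonal, vecFunctional_diagonal, Complex.re_sum]
    refine Finset.sum_congr rfl fun k _ => ?_
    have := hc 1 k
    rw [one_mul, hχ1, one_apply_eq_self] at this
    rw [hc, hχ.inner_star hχ1, this, inner_self_eq_norm_sq_to_K]
    simp [← Complex.ofReal_pow]
  have hword : ∀ k, ∀ b i, χ (b * w k) (x i) = χ b (ρ (w k) (x i)) := by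
    intro k
    induction k using Nat.strong_induction_on with
    | _ k ih =>
      rcases hl : Denumerable.ofNat (List ℕ) k with _ | ⟨a, l⟩
      · have hwk : w k = 1 := by rw [hw]; simp [hl]
        intro b i
        rw [hwk, mul_one, map_one, one_apply_eq_self]
      · have hk : k = Encodable.encode (a :: l) := by
          rw [← hl, Denumerable.encode_ofNat]
        have hlt : Encodable.encode l < k := by
          rw [hk, Encodable.encode_list_cons]
          exact Nat.lt_succ_of_le (Nat.right_le_pair _ _)
        have hwl : w (Encodable.encode l) = (l.map s).prod := by
          rw [hw]; simp
        have hwk : w k = s a * w (Encodable.encode l) := by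
          rw [hwl, hw]; simp [hl]
        have hle := hlex k _ hg hgm fun i hi => hdiag _ (ih i hi)
        have ihl := ih _ hlt
        set u := w (Encodable.encode l) with hu
        have hterm : ∀ i, ‖χ (s a) (ρ u (x i))‖ ^ 2 ≤
            (⟪ρ u (x i), χ (star (s a) * s a) (ρ u (x i))⟫_ℂ).re := fun i => by
          simpa using hχ.norm_sum_sq_le hχ1 (fun _ : Fin 1 => s a) (fun _ => ρ u (x i))
        have hchi : ∀ i, (⟪x i, χ (star (w k) * w k) (x i)⟫_ℂ).re =
            (⟪ρ u (x i), χ (star (s a) * s a) (ρ u (x i))⟫_ℂ).re := by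
          intro i
          have e : star (w k) * w k = star (star (s a) * s a * u) * u := by
            rw [hwk]; simp [mul_assoc]
          have h1 := ihl 1 i
          rw [one_mul, hχ1, one_apply_eq_self] at h1
          rw [e, ihl, hχ.inner_star hχ1, ihl, Complex.conj_re]
        rw [re_vecFunctional_rep_diagonal, cstarDiagonal, vecFunctional_diagonal,
          Complex.re_sum] at hle
        have heq : ∀ i, (⟪ρ u (x i), χ (star (s a) * s a) (ρ u (x i))⟫_ℂ).re ≤
            ‖χ (s a) (ρ u (x i))‖ ^ 2 := by
          have h2 : ∑ i, (⟪ρ u (x i), χ (star (s a) * s a) (ρ u (x i))⟫_ℂ).re ≤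
              ∑ i, ‖χ (s a) (ρ u (x i))‖ ^ 2 := by
            refine (Finset.sum_congr rfl fun i _ => (hchi i).symm).trans_le (hle.trans_eq ?_)
            exact Finset.sum_congr rfl fun i _ => by rw [hwk, rep_mul_apply, hχs]
          have h3 := (Finset.sum_eq_sum_iff_of_le fun i _ => hterm i).1
            (le_antisymm (Finset.sum_le_sum fun i _ => hterm i) h2)
          exact fun i => (h3 i (Finset.mem_univ i)).ge
        intro b i
        rw [hwk, ← mul_assoc, ihl, hχ.apply_mul_of_le hχ1 (heq i), rep_mul_apply, hχs]
  have hχc : Continuous χ :=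
    (LinearMap.mkContinuous χ 1 fun b => by simpa using hχn b).continuous
  have hρc : Continuous ρ := map_continuous ρ
  have hall : ∀ c b i, χ (b * c) (x i) = χ b (ρ c (x i)) := by
    let W : Submodule ℂ B :=
      { carrier := {c | ∀ b i, χ (b * c) (x i) = χ b (ρ c (x i))}
        add_mem' := fun {c d} hc hd b i => by simp [mul_add, hc b i, hd b i]
        zero_mem' := fun b i => by simp
        smul_mem' := fun r c hc b i => by simp [hc b i] }
    have hWc : IsClosed (W : Set B) := by
      have : (W : Set B) = ⋂ b, ⋂ i, {c | χ (b * c) (x i) = χ b (ρ c (x i))} := by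
        ext c; simp [W]
      rw [this]
      refine isClosed_iInter fun b => isClosed_iInter fun i => isClosed_eq ?_ ?_
      · exact (ContinuousLinearMap.apply ℂ H (x i)).continuous.comp (hχc.comp (by fun_prop))
      · exact (χ b).continuous.comp
          ((ContinuousLinearMap.apply ℂ H (x i)).continuous.comp hρc)
    have hsub : (Algebra.adjoin ℂ (Set.range s) : Set B) ⊆ W := by
      change Subalgebra.toSubmodule (Algebra.adjoin ℂ (Set.range s)) ≤ W
      rw [Algebra.adjoin_eq_span, Submodule.span_le]
      intro c hc
      obtain ⟨l, hl, rfl⟩ := Submonoid.exists_list_of_mem_closure hc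
      obtain ⟨l', rfl⟩ : ∃ l' : List ℕ, l'.map s = l := by
        rw [← Set.mem_range, Set.range_list_map]
        exact hl
      have := hword (Encodable.encode l')
      rw [hw] at this
      intro b i
      simpa using this b i
    intro c
    have : c ∈ closure (W : Set B) := closure_mono hsub (hs ▸ Set.mem_univ c)
    rw [hWc.closure_eq] at this
    exact this
  have hone : ∀ c i, χ c (x i) = ρ c (x i) := fun c i => by
    have := hall c 1 i
    rwa [one_mul, hχ1, one_apply_eq_self] at this
  have hz : ∀ c i, (χ b - ρ b) (ρ c (x i)) = 0 := fun c i => by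
    rw [sub_apply, ← hall, hone, rep_mul_apply, sub_self]
  have hadj : ContinuousLinearMap.adjoint (χ b - ρ b) = 0 := by
    ext y
    refine htot _ fun c j => ?_
    rw [ContinuousLinearMap.adjoint_inner_right, hz, inner_zero_left]
  rw [← sub_eq_zero, ← ContinuousLinearMap.adjoint_adjoint (χ b - ρ b), hadj, map_zero]

end uniqueExtension

theorem exists_norming_boundary_representation {B : Type u} [CStarAlgebra B] [PartialOrder B]
    [StarOrderedRing B] [TopologicalSpace.SeparableSpace B] [Nontrivial B] {s : ℕ → B}
    (hs : closure (Algebra.adjoin ℂ (Set.range s) : Set B) = Set.univ) {n : ℕ}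
    (m : CStarMatrix (Fin (n + 1)) (Fin (n + 1)) B) :
    ∃ (H : Type) (_ : NormedAddCommGroup H) (_ : InnerProductSpace ℂ H) (_ : CompleteSpace H)
      (ρ : B →⋆ₐ[ℂ] (H →L[ℂ] H)) (x : Fin (n + 1) → H), HasTrivialCommutant ⇑ρ ∧
      (∀ χ : B →ₗ[ℂ] (H →L[ℂ] H), IsPosKernelMap χ → χ 1 = 1 → (∀ b, ‖χ b‖ ≤ ‖b‖) →
        (∀ i, χ (s i) = ρ (s i)) → (∀ i j, χ (m i j) = ρ (m i j)) → ∀ b, χ b = ρ b) ∧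
      (∀ M : CStarMatrix (Fin (n + 1)) (Fin (n + 1)) B,
        ∑ r, ‖∑ j, ρ (M r j) (x j)‖ ^ 2 ≤ ‖M‖ ^ 2) ∧
      ∑ r, ‖∑ j, ρ (m r j) (x j)‖ ^ 2 = ‖m‖ ^ 2 := by
  have : Nontrivial (CStarMatrix (Fin (n + 1)) (Fin (n + 1)) B) :=
    inferInstanceAs (Nontrivial (Matrix (Fin (n + 1)) (Fin (n + 1)) B))
  let w : ℕ → B := fun k => ((Denumerable.ofNat (List ℕ) k).map s).prod
  let e : CStarMatrix (Fin (n + 1)) (Fin (n + 1)) B →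
      (CStarMatrix (Fin (n + 1)) (Fin (n + 1)) B → ℂ) →L[ℝ] ℝ := fun M =>
    Complex.reCLM ∘L ContinuousLinearMap.proj M
  obtain ⟨g₀, hg₀, hg₀m⟩ := exists_mem_stateSet_apply_eq_norm m
  obtain ⟨f, hfext, hlex⟩ := (isCompact_stateSet _).exists_mem_extremePoints_lexMax ⟨g₀, hg₀⟩
    (fun k => Nat.casesOn k (e (star m * m))
      fun k => e (cstarDiagonal (n + 1) (star (w k) * w k)))
  obtain ⟨hadd, hsmul, hone, hpos, hnorm⟩ := hfext.1
  obtain ⟨H, _, _, _, ρ, x, hf, htot⟩ := exists_corner_representation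
    (⟨⟨f, hadd⟩, hsmul⟩ : CStarMatrix (Fin (n + 1)) (Fin (n + 1)) B →ₗ[ℂ] ℂ) hpos
  obtain rfl : f = ⇑(vecFunctional (mulLeftRep 1 ρ) x) := funext hf
  have hmax : ∀ g ∈ stateSet (CStarMatrix (Fin (n + 1)) (Fin (n + 1)) B),
      (g (star m * m)).re ≤ (vecFunctional (mulLeftRep 1 ρ) x (star m * m)).re :=
    fun g hg => hlex 0 g hg (by simp)
  have hle : ∀ M : CStarMatrix (Fin (n + 1)) (Fin (n + 1)) B,
      ∑ r, ‖∑ j, ρ (M r j) (x j)‖ ^ 2 ≤ ‖M‖ ^ 2 := by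
    intro M
    have := hnorm (star M * M)
    rw [re_vecFunctional_rep_star_mul_self, Complex.norm_real, CStarRing.norm_star_mul_self,
      ← sq] at this
    exact (le_abs_self _).trans this
  refine ⟨H, inferInstance, inferInstance, inferInstance, ρ, x,
    hasTrivialCommutant_of_extreme hfext htot, fun χ hχ hχ1 hχn hχs hχm =>
      eq_rep_of_lexMax hs htot hone rfl hmax (fun k g hg h0 hk => ?_) hχ hχ1 hχn hχs hχm,
    hle, le_antisymm (hle m) ?_⟩
  · refine hlex (k + 1) g hg fun i hi => ?_
    rcases i with _ | i
    · exact h0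
    · exact hk i (by omega)
  · have := hmax g₀ hg₀
    rw [hg₀m, re_vecFunctional_rep_star_mul_self, Complex.ofReal_re, ← Complex.ofReal_pow,
      Complex.ofReal_re] at this
    exact this

section descent

variable {A : Type*} [Ring A] [StarRing A] [Algebra ℂ A] {B : Type*} [CStarAlgebra B]
  (π : A →⋆ₐ[ℂ] B)

theorem matrixSeminorm_eq_norm [PartialOrder B] [StarOrderedRing B]
    (hsurj : Function.Surjective π) {p : A → ℝ} (hnorm : ∀ a, ‖π a‖ = p a)
    {pn : ∀ n : ℕ, Matrix (Fin n) (Fin n) A → ℝ} (hpn : IsMatrixCstarSeminormFamily p pn)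
    {n : ℕ} (M : Matrix (Fin n) (Fin n) A) :
    pn n M = ‖CStarMatrix.ofMatrix (M.map π)‖ := by
  have hq := hpn.cstar n
  have hle : ∀ M M' : Matrix (Fin n) (Fin n) A, M.map π = M'.map π → pn n M ≤ pn n M' := by
    intro M M' h
    have h0 : pn n (M - M') = 0 := by
      rw [hpn.ker]
      intro i j
      rw [← hnorm, Matrix.sub_apply, map_sub,
        show π (M i j) = π (M' i j) from congr($h i j), sub_self, norm_zero]
    have := hq.add_le M' (M - M')
    rwa [add_sub_cancel, h0, add_zero] at this
  let g : B → A := Function.surjInv hsurj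
  have hg : ∀ b, π (g b) = b := Function.surjInv_eq hsurj
  let q : CStarMatrix (Fin n) (Fin n) B → ℝ := fun N => pn n (Matrix.map N g)
  have hqM : ∀ M : Matrix (Fin n) (Fin n) A, q (CStarMatrix.ofMatrix (M.map π)) = pn n M := by
    intro M
    have : (((M.map π).map g : Matrix (Fin n) (Fin n) A)).map π = M.map π := by
      ext i j; simp [hg]
    exact le_antisymm (hle _ _ this) (hle _ _ this.symm)
  have hlift : ∀ N : CStarMatrix (Fin n) (Fin n) B,
      ∃ M : Matrix (Fin n) (Fin n) A, N = CStarMatrix.ofMatrix (M.map π) := fun N =>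
    ⟨Matrix.map N g, by ext i j; exact (hg (N i j)).symm⟩
  have hmul : ∀ M M' : Matrix (Fin n) (Fin n) A, CStarMatrix.ofMatrix (M.map π) *
      CStarMatrix.ofMatrix (M'.map π) = CStarMatrix.ofMatrix ((M * M').map π) := fun M M' => by
    ext i j
    simp [CStarMatrix.mul_apply, Matrix.mul_apply]
  have hadd : ∀ M M' : Matrix (Fin n) (Fin n) A, CStarMatrix.ofMatrix (M.map π) +
      CStarMatrix.ofMatrix (M'.map π) = CStarMatrix.ofMatrix ((M + M').map π) := fun M M' => by
    ext i j
    simp [CStarMatrix.add_apply]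
  have hstar : ∀ M : Matrix (Fin n) (Fin n) A, star (CStarMatrix.ofMatrix (M.map π)) =
      CStarMatrix.ofMatrix ((star M).map π) := fun M => by
    ext i j
    exact (map_star π (M j i)).symm
  have hqs : IsCstarSeminorm q :=
    { nonneg := fun N => hq.nonneg _
      map_zero' := by
        have : (0 : CStarMatrix (Fin n) (Fin n) B) =
            CStarMatrix.ofMatrix ((0 : Matrix (Fin n) (Fin n) A).map π) := by
          ext i j; simp
        rw [this, hqM, hq.map_zero']
      add_le := fun N N' => by
        obtain ⟨M, rfl⟩ := hlift N
        obtain ⟨M', rfl⟩ := hlift N'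
        rw [hadd, hqM, hqM, hqM]
        exact hq.add_le _ _
      smul := fun c N => by
        obtain ⟨M, rfl⟩ := hlift N
        have : c • CStarMatrix.ofMatrix (M.map π) = CStarMatrix.ofMatrix ((c • M).map π) := by
          ext i j; simp [CStarMatrix.smul_apply]
        rw [this, hqM, hqM, hq.smul]
      mul_le := fun N N' => by
        obtain ⟨M, rfl⟩ := hlift N
        obtain ⟨M', rfl⟩ := hlift N'
        rw [hmul, hqM, hqM, hqM]
        exact hq.mul_le _ _
      star_eq := fun N => by
        obtain ⟨M, rfl⟩ := hlift N
        rw [hstar, hqM, hqM, hq.star_eq]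
      cstar := fun N => by
        obtain ⟨M, rfl⟩ := hlift N
        rw [hstar, hmul, hqM, hqM, hq.cstar] }
  rw [← hqM]
  refine hqs.eq_norm_s17 (fun N hN => ?_) _
  obtain ⟨M, rfl⟩ := hlift N
  rw [hqM, hpn.ker] at hN
  ext i j
  have := hN i j
  rw [← hnorm, norm_eq_zero] at this
  simpa using this

theorem MatPosOp.sum_inner_nonneg {H : Type*} [NormedAddCommGroup H] [InnerProductSpace ℂ H]
    [CompleteSpace H] {n : ℕ} {T : Matrix (Fin n) (Fin n) (H →L[ℂ] H)} (hT : MatPosOp T)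
    (y : Fin n → H) : 0 ≤ ∑ i, ∑ j, ⟪y i, T i j (y j)⟫_ℂ := by
  obtain ⟨X, rfl⟩ := hT
  have : ∑ i, ∑ j, ⟪y i, (star X * X) i j (y j)⟫_ℂ =
      ∑ r, ⟪∑ i, X r i (y i), ∑ j, X r j (y j)⟫_ℂ := by
    simp only [Matrix.mul_apply, Matrix.star_apply, sum_apply, inner_sum, sum_inner,
      mul_apply_eq_comp, ContinuousLinearMap.star_eq_adjoint,
      ContinuousLinearMap.adjoint_inner_right]
    calc _ = ∑ j, ∑ i, ∑ r, ⟪X r i (y i), X r j (y j)⟫_ℂ := Finset.sum_comm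
      _ = ∑ j, ∑ r, ∑ i, ⟪X r i (y i), X r j (y j)⟫_ℂ :=
          Finset.sum_congr rfl fun j _ => Finset.sum_comm
      _ = _ := Finset.sum_comm
  rw [this]
  refine Finset.sum_nonneg fun r _ => ?_
  rw [inner_self_eq_norm_sq_to_K]
  rw [← RCLike.ofReal_pow]
  exact RCLike.ofReal_nonneg.2 (sq_nonneg _)

theorem exists_isPosKernelMap_descent {H : Type*} [NormedAddCommGroup H] [InnerProductSpace ℂ H]
    [CompleteSpace H] (hsurj : Function.Surjective π) (φ : A →ₗ[ℂ] (H →L[ℂ] H))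
    (hφ : ∀ (N : ℕ) (X : Matrix (Fin N) (Fin N) A), MatPosOp ((star X * X).map φ))
    (hn : ∀ a, ‖φ a‖ ≤ ‖π a‖) :
    ∃ χ : B →ₗ[ℂ] (H →L[ℂ] H), (∀ a, χ (π a) = φ a) ∧ IsPosKernelMap χ := by
  let g : B → A := Function.surjInv hsurj
  have hg : ∀ b, π (g b) = b := Function.surjInv_eq hsurj
  have hwd : ∀ a a', π a = π a' → φ a = φ a' := fun a a' h => by
    have := hn (a - a')
    rw [map_sub, map_sub, h, sub_self, norm_zero] at this
    exact sub_eq_zero.1 (norm_le_zero_iff.1 this)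
  let χ : B →ₗ[ℂ] (H →L[ℂ] H) :=
    { toFun := fun b => φ (g b)
      map_add' := fun a b => by
        rw [← map_add]
        exact hwd _ _ (by simp [hg])
      map_smul' := fun c b => by
        rw [RingHom.id_apply, ← map_smul]
        exact hwd _ _ (by simp [hg]) }
  have hχ : ∀ a, χ (π a) = φ a := fun a => hwd _ _ (hg _)
  refine ⟨χ, hχ, fun N c y => ?_⟩
  rcases N with _ | N
  · simp
  let X : Matrix (Fin (N + 1)) (Fin (N + 1)) A := 
    Matrix.of fun r j => if r = 0 then g (c j) else 0
  have hX : ∀ i j, (star X * X) i j = star (g (c i)) * g (c j) := by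
    intro i j
    rw [Matrix.mul_apply, Finset.sum_eq_single 0]
    · simp [X, Matrix.star_apply]
    · intro r _ hr
      simp [X, hr]
    · simp
  have := (hφ _ X).sum_inner_nonneg y
  have e : ∀ i j, χ (star (c i) * c j) = ((star X * X).map φ) i j := by
    intro i j
    rw [Matrix.map_apply, hX, ← hχ, map_mul π, map_star π, hg, hg]
  simpa only [e] using this

end descent

theorem exists_adm_rep_of_mem {A : Type*} [Ring A] [StarRing A] [Algebra ℂ A] {B : Type u}
    [CStarAlgebra B] [TopologicalSpace.SeparableSpace B] [Nontrivial B] (π : A →⋆ₐ[ℂ] B)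
    (hsurj : Function.Surjective π) {p : A → ℝ} (hnorm : ∀ a, ‖π a‖ = p a)
    {pn : ∀ n : ℕ, Matrix (Fin n) (Fin n) A → ℝ} (hpn : IsMatrixCstarSeminormFamily p pn)
    (S : Submodule ℂ A) (hgen : closure (Algebra.adjoin ℂ (π '' S) : Set B) = Set.univ)
    {n : ℕ} (M : Matrix (Fin (n + 1)) (Fin (n + 1)) S) :
    ∃ (H : Type) (_ : NormedAddCommGroup H) (_ : InnerProductSpace ℂ H) (_ : CompleteSpace H)
      (πr : A →⋆ₐ[ℂ] (H →L[ℂ] H)), HasTrivialCommutant ⇑πr ∧ (∀ a, ‖πr a‖ ≤ p a) ∧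
      (∀ φ : A →ₗ[ℂ] (H →L[ℂ] H), φ 1 = 1 →
        (∀ (N : ℕ) (X : Matrix (Fin N) (Fin N) A), MatPosOp ((star X * X).map φ)) →
        (∀ a, ‖φ a‖ ≤ p a) → (∀ s ∈ S, φ s = πr s) → ∀ a, φ a = πr a) ∧
      ∀ C : Matrix (Fin (n + 1)) (Fin (n + 1)) A, (∀ i j, πr (C i j) = 0) →
        pn (n + 1) (M.map Subtype.val) ≤ pn (n + 1) (M.map Subtype.val + C) := by
  let := CStarAlgebra.spectralOrder B
  have := CStarAlgebra.spectralOrderedRing B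
  have : Nonempty (π '' S) := ⟨⟨π 0, 0, S.zero_mem, rfl⟩⟩
  let s : ℕ → B := fun i => (TopologicalSpace.denseSeq (π '' S) i : B)
  have hsS : ∀ i, ∃ a ∈ S, π a = s i := fun i => (TopologicalSpace.denseSeq (π '' S) i).2
  have hs : closure (Algebra.adjoin ℂ (Set.range s) : Set B) = Set.univ := by
    rw [← Subalgebra.topologicalClosure_coe, Set.eq_univ_iff_forall]
    intro b
    have hsub : π '' S ⊆ (Algebra.adjoin ℂ (Set.range s)).topologicalClosure := by
      intro t ht
      have h1 := TopologicalSpace.denseRange_denseSeq (π '' S) ⟨t, ht⟩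
      have h2 := image_closure_subset_closure_image continuous_subtype_val
        (Set.mem_image_of_mem Subtype.val h1)
      rw [Subalgebra.topologicalClosure_coe]
      refine closure_mono ?_ h2
      rw [← Set.range_comp]
      exact Algebra.subset_adjoin
    have h3 : closure (Algebra.adjoin ℂ (π '' S) : Set B) ⊆
        (Algebra.adjoin ℂ (Set.range s)).topologicalClosure :=
      closure_minimal (Algebra.adjoin_le hsub) (Subalgebra.isClosed_topologicalClosure _)
    exact h3 (hgen ▸ Set.mem_univ b)
  let M' : Matrix (Fin (n + 1)) (Fin (n + 1)) A := M.map Subtype.val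
  obtain ⟨H, _, _, _, ρ, x, hirr, huep, hle, heq⟩ :=
    exists_norming_boundary_representation hs (CStarMatrix.ofMatrix (M'.map π))
  refine ⟨H, inferInstance, inferInstance, inferInstance, ρ.comp π, ?_, fun a => ?_,
    fun φ h1 hφ hφn hφS => ?_, fun C hC => ?_⟩
  · intro T hT
    refine hirr T fun b => ?_
    obtain ⟨a, rfl⟩ := hsurj b
    exact hT a
  · rw [← hnorm]
    exact NonUnitalStarAlgHom.norm_apply_le ρ (π a)
  · obtain ⟨χ, hχ, hχp⟩ := exists_isPosKernelMap_descent π hsurj φ hφ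
      fun a => (hφn a).trans_eq (hnorm a).symm
    have hχS : ∀ a ∈ S, χ (π a) = ρ (π a) := fun a ha => (hχ a).trans (hφS a ha)
    have := huep χ hχp (by rw [← map_one π, hχ, h1]) (fun b => by
        obtain ⟨a, rfl⟩ := hsurj b
        rw [hχ, hnorm]
        exact hφn a) (fun i => by
        obtain ⟨a, ha, hai⟩ := hsS i
        rw [← hai]
        exact hχS a ha) (fun i j => hχS _ (M i j).2)
    intro a
    rw [← hχ, this]
    rfl
  · change pn (n + 1) M' ≤ pn (n + 1) (M' + C)
    rw [matrixSeminorm_eq_norm π hsurj hnorm hpn, matrixSeminorm_eq_norm π hsurj hnorm hpn]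
    refine (abs_le_of_sq_le_sq' ?_ (norm_nonneg _)).2
    rw [← heq]
    refine le_trans (le_of_eq ?_) (hle _)
    refine Finset.sum_congr rfl fun r _ => ?_
    congr 2
    refine Finset.sum_congr rfl fun j _ => ?_
    have h0 : ρ (π (C r j)) = 0 := hC r j
    simp [h0]

/-- for a separable `A`, the intersection `J` of the kernels of all admissible
local boundary representations for `S` is a local boundary ideal for `S`. -/
theorem stmt17 {Λ : Type*} [Preorder Λ] {A : Type*} [Ring A] [StarRing A] [Algebra ℂ A] [StarModule ℂ A]
    {B : Λ → Type*} [∀ l, NormedRing (B l)] [∀ l, StarRing (B l)] [∀ l, CStarRing (B l)]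
    [∀ l, NormedAlgebra ℂ (B l)] [∀ l, StarModule ℂ (B l)] [∀ l, CompleteSpace (B l)]
    (p : Λ → A → ℝ) (hp : ∀ l, IsCstarSeminorm (p l))
    (hmono : ∀ ⦃l₁ l₂ : Λ⦄, l₁ ≤ l₂ → ∀ a, p l₁ a ≤ p l₂ a)
    (π : ∀ l, A →⋆ₐ[ℂ] B l) (hsurj : ∀ l, Function.Surjective ⇑(π l))
    (hnorm : ∀ l a, ‖(π l) a‖ = p l a)
    (pn : Λ → ∀ n : ℕ, Matrix (Fin n) (Fin n) A → ℝ)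
    (hpn : ∀ l, IsMatrixCstarSeminormFamily (p l) (pn l))
    (S : Submodule ℂ A) (hSstar : ∀ s ∈ S, star s ∈ S) (hSone : (1 : A) ∈ S)
    [TopologicalSpace A] (hind : Topology.IsInducing (fun a : A => fun l => (π l) a))
    [TopologicalSpace.SeparableSpace A]
    (hgen : closure ((StarAlgebra.adjoin ℂ (S : Set A) : StarSubalgebra ℂ A) : Set A)
      = Set.univ) :
    IsLocBdryIdeal pn S
      {a : A | ∀ (H : Type) (_ : NormedAddCommGroup H) (_ : InnerProductSpace ℂ H)
        (_ : CompleteSpace H) (πr : A →⋆ₐ[ℂ] (H →L[ℂ] H)),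
        IsAdmLocBdryRep p pn S πr → πr a = 0} := by
  set I : Set A := {a : A | ∀ (H : Type) (_ : NormedAddCommGroup H) (_ : InnerProductSpace ℂ H)
        (_ : CompleteSpace H) (πr : A →⋆ₐ[ℂ] (H →L[ℂ] H)),
        IsAdmLocBdryRep p pn S πr → πr a = 0} with hI
  have hI0 : (0 : A) ∈ I := fun H _ _ _ πr _ => map_zero πr
  refine ⟨⟨TwoSidedIdeal.mk' I hI0 (fun ha hb H _ _ _ πr h => ?_) (fun ha H _ _ _ πr h => ?_)
    (fun hb H _ _ _ πr h => ?_) (fun ha H _ _ _ πr h => ?_), TwoSidedIdeal.coe_mk' ..⟩,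
    fun a ha H _ _ _ πr h => ?_, ?_, fun l n M => ?_⟩
  · rw [map_add, ha H _ _ _ πr h, hb H _ _ _ πr h, add_zero]
  · rw [map_neg, ha H _ _ _ πr h, neg_zero]
  · rw [map_mul, hb H _ _ _ πr h, mul_zero]
  · rw [map_mul, ha H _ _ _ πr h, zero_mul]
  · rw [map_star, ha H _ _ _ πr h, star_zero]
  · simp only [hI, Set.ofPred_forall]
    refine isClosed_iInter fun H => isClosed_iInter fun _ => isClosed_iInter fun _ =>
      isClosed_iInter fun _ => isClosed_iInter fun πr => isClosed_iInter fun h => ?_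
    obtain ⟨-, l₀, hle, -⟩ := h
    refine isClosed_singleton.preimage (f := πr) (continuous_iff_continuousAt.2 fun a => ?_)
    refine tendsto_iff_norm_sub_tendsto_zero.2 ?_
    have hc : Continuous (π l₀) := (continuous_apply l₀).comp hind.continuous
    refine squeeze_zero (fun _ => norm_nonneg _) (fun b => ?_)
      (tendsto_iff_norm_sub_tendsto_zero.1 (hc.tendsto a))
    rw [← map_sub, ← map_sub, hnorm]
    exact hle _
  · refine IsLeast.csInf_eq ⟨⟨0, fun _ _ => hI0, by rw [add_zero]⟩, ?_⟩
    rintro _ ⟨C, hC, rfl⟩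
    rcases n with _ | n
    · exact (congrArg _ (Subsingleton.elim _ _)).le
    cases subsingleton_or_nontrivial (B l)
    · rw [((hpn l).ker _ (M.map Subtype.val)).2 fun i j => by
        rw [← hnorm, Subsingleton.elim (π l _) 0, norm_zero]]
      exact ((hpn l).cstar _).nonneg _
    have hc : Continuous (π l) := (continuous_apply l).comp hind.continuous
    have := (hsurj l).denseRange.separableSpace hc
    have hgenB : closure (Algebra.adjoin ℂ (π l '' S) : Set (B l)) = Set.univ := by
      have hS : (S : Set A) ∪ star (S : Set A) = S :=
        Set.union_eq_self_of_subset_right fun s hs => by simpa using hSstar _ hs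
      have hA : ((StarAlgebra.adjoin ℂ (S : Set A) : StarSubalgebra ℂ A) : Set A) =
          Algebra.adjoin ℂ (S : Set A) := by
        rw [← StarSubalgebra.coe_toSubalgebra, StarAlgebra.adjoin_toSubalgebra, hS]
      rw [hA] at hgen
      have himg : (Algebra.adjoin ℂ (π l '' S) : Set (B l)) =
          π l '' (Algebra.adjoin ℂ (S : Set A) : Set A) := by
        have := AlgHom.map_adjoin (π l).toAlgHom (S : Set A)
        exact congrArg SetLike.coe this.symm
      rw [himg, Set.eq_univ_iff_forall]
      intro b
      obtain ⟨a, rfl⟩ := hsurj l b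
      exact image_closure_subset_closure_image hc ⟨a, hgen ▸ Set.mem_univ a, rfl⟩
    let : CStarAlgebra (B l) := { }
    obtain ⟨H, _, _, _, πr, hirr, hle, huep, hmin⟩ :=
      exists_adm_rep_of_mem (π l) (hsurj l) (hnorm l) (hpn l) S hgenB M
    refine hmin C fun i j => hC i j H _ _ _ πr ⟨hirr, l, hle, fun φ h1 hφ hφn hφS => ?_⟩
    obtain ⟨l', hl'⟩ := hφ
    exact huep φ h1 (fun N X => hl'.1 N _
      ⟨X, 0, ((hpn l').cstar N).map_zero', (add_zero _).symm⟩) hφn hφS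
end
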